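/- For odd positive integers a and m, let d = a²m² + 4a. If d is squarefree and d > 1253, then h(d) > 1. -/

import Mathlib

open Filter Topology
set_option linter.all false

noncomputable def QF (A B C X Y : ℝ) : ℝ := Real.exp (-(A*X^2+B*X*Y+C*Y^2))

/-- quadratic interpolation functional -/
noncomputable def ell (x y f f00 f10 f01 f20 f02 f11 : ℝ) : ℝ :=
  f - (f00 + x*(f10-f00) + y*(f01-f00) + x*(x-1)/2*(f20-2*f10+f00)
    + y*(y-1)/2*(f02-2*f01+f00) + x*y*(f11-f10-f01+f00))

lemma exp_taylor2 (δ : ℝ) (h : 0 ≤ δ) : |Real.exp (-δ) - (1 - δ + δ^2/2)| ≤ δ^3 := by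
  have h1 : ∀ t : ℝ, 0 ≤ t → Real.exp (-t) ≤ 1 - t + t^2/2 := by
    intro t ht
    have := Real.quadratic_le_exp_of_nonneg ht
    rw [Real.exp_neg]
    rw [inv_le_iff_one_le_mul₀ (Real.exp_pos t)]
    have h3 : 0 < 1 - t + t^2/2 := by nlinarith [sq_nonneg (t-1)]
    have : (1 - t + t^2/2) * (1 + t + t^2/2) ≤ (1 - t + t^2/2) * Real.exp t :=
      mul_le_mul_of_nonneg_left this h3.le
    nlinarith [sq_nonneg (t^2)]
  have h0 := h1 δ h
  rw [abs_le]
  constructor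
  · -- lower bound
    have key : 1 - δ + δ^2/2 - δ^3 ≤ Real.exp (-δ) := by
      by_cases hδ : δ ≤ 1
      · have hb := Real.abs_exp_sub_one_sub_id_le (x := -δ) (by rw [abs_neg, abs_of_nonneg h]; exact hδ)
        have := Real.exp_bound (x := -δ) (by rw [abs_neg, abs_of_nonneg h]; exact hδ) (n := 3) (by norm_num)
        rw [abs_neg, abs_of_nonneg h] at this
        simp [Finset.sum_range_succ, Nat.factorial] at this
        rw [abs_le] at this
        have := this.1
        have : 0 ≤ δ^3 := by positivity
        nlinarith
      · push Not at hδ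
        have := Real.exp_pos (-δ)
        nlinarith [mul_pos (sub_pos.mpr hδ) (sub_pos.mpr hδ), sq_nonneg δ, mul_nonneg h (sq_nonneg δ)]
    linarith
  · have : 0 ≤ δ^3 := by positivity
    linarith

lemma ell_bound (x y : ℝ) (hx : 0 ≤ x ∧ x ≤ 1) (hy : 0 ≤ y ∧ y ≤ 1) (K f f00 f10 f01 f20 f02 f11 : ℝ)
    (h : |f| ≤ K) (h00 : |f00| ≤ K) (h10 : |f10| ≤ K) (h01 : |f01| ≤ K) (h20 : |f20| ≤ K)
    (h02 : |f02| ≤ K) (h11 : |f11| ≤ K) : |ell x y f f00 f10 f01 f20 f02 f11| ≤ 20 * K := by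
  have aux : ∀ c e B : ℝ, |c| ≤ 1 → |e| ≤ B → |c*e| ≤ B := by
    intro c e B hc he
    rw [abs_mul]
    calc |c| * |e| ≤ 1 * |e| := by gcongr
      _ ≤ B := by linarith
  have hx1 : |x| ≤ 1 := by rw [abs_le]; constructor <;> linarith
  have hy1 : |y| ≤ 1 := by rw [abs_le]; constructor <;> linarith
  have hx2 : |x*(x-1)/2| ≤ 1 := by rw [abs_le]; constructor <;> nlinarith
  have hy2 : |y*(y-1)/2| ≤ 1 := by rw [abs_le]; constructor <;> nlinarith
  have hxy : |x*y| ≤ 1 := by rw [abs_le]; constructor <;> nlinarith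
  rw [abs_le] at h h00 h10 h01 h20 h02 h11
  have a1 := abs_le.mp (aux x (f10-f00) (2*K) hx1 (by rw [abs_le]; constructor <;> linarith))
  have a2 := abs_le.mp (aux y (f01-f00) (2*K) hy1 (by rw [abs_le]; constructor <;> linarith))
  have a3 := abs_le.mp (aux _ (f20-2*f10+f00) (4*K) hx2 (by rw [abs_le]; constructor <;> linarith))
  have a4 := abs_le.mp (aux _ (f02-2*f01+f00) (4*K) hy2 (by rw [abs_le]; constructor <;> linarith))
  have a5 := abs_le.mp (aux _ (f11-f10-f01+f00) (4*K) hxy (by rw [abs_le]; constructor <;> linarith))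
  unfold ell
  rw [abs_le]
  constructor <;> linarith [a1.1, a1.2, a2.1, a2.2, a3.1, a3.2, a4.1, a4.2, a5.1, a5.2]

lemma exp_err_aux (S z h L Q : ℝ) (hS0 : 0 < S) (hz1 : 1 ≤ z) (hh : 0 < h) (hh1 : h ≤ 1)
    (hL0 : 0 ≤ L) (hQ0 : 0 ≤ Q) (hL1 : L ≤ 4*S*z) (hQ1 : Q ≤ 4*S) :
    |Real.exp (-(h*L+h^2*Q)) - (1 - h*L - h^2*Q + h^2*L^2/2)| ≤ (512*S^3+24*S^2)*(h^3*z^3) := by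
  have hδ0 : 0 ≤ h*L+h^2*Q := by positivity
  have ht2 := exp_taylor2 (h*L+h^2*Q) hδ0
  have hz0 : 0 < z := by linarith
  have hδ1 : h*L+h^2*Q ≤ 8*S*(h*z) := by
    have e1 : h*(h*Q) ≤ h*(4*S*z) := by
      have : h*Q ≤ 1*(4*S) := by gcongr
      have : 4*S*1 ≤ 4*S*z := by gcongr
      exact mul_le_mul_of_nonneg_left (by linarith) hh.le
    have e2 : h*L ≤ h*(4*S*z) := by gcongr
    linarith
  have hδ3 : (h*L+h^2*Q)^3 ≤ (8*S*(h*z))^3 := by gcongr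
  have hLQ : L*Q ≤ (4*S*z)*(4*S) := by gcongr
  have hz3 : z ≤ z^3 := le_self_pow₀ hz1 (by norm_num)
  have hz31 : 1 ≤ z^3 := one_le_pow₀ hz1
  have e3 : h^3*(L*Q) ≤ h^3*(16*S^2*z^3) := by
    refine mul_le_mul_of_nonneg_left ?_ (by positivity)
    calc L*Q ≤ (4*S*z)*(4*S) := hLQ
      _ = 16*S^2*z := by ring
      _ ≤ 16*S^2*z^3 := by gcongr
  have e4 : h^4*Q^2 ≤ h^3*(16*S^2*z^3) := by
    have : Q^2 ≤ (4*S)^2 := by gcongr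
    calc h^4*Q^2 = h^3*(h*Q^2) := by ring
      _ ≤ h^3*(1*(4*S)^2) := by gcongr
      _ = h^3*(16*S^2*1) := by ring
      _ ≤ _ := by gcongr
  have e5 : 0 ≤ h^3*(L*Q) := by positivity
  have e6 : 0 ≤ h^4*Q^2 := by positivity
  have e7 : Real.exp (-(h*L+h^2*Q)) - (1 - h*L - h^2*Q + h^2*L^2/2)
    = (Real.exp (-(h*L+h^2*Q)) - (1 - (h*L+h^2*Q) + (h*L+h^2*Q)^2/2)) + h^3*(L*Q) + h^4*Q^2/2 := by
    ring
  have e8 : (8*S*(h*z))^3 = 512*S^3*(h^3*z^3) := by ring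
  rw [abs_le] at ht2 ⊢
  rw [e7]
  have e9 : (512*S^3+24*S^2)*(h^3*z^3) = 512*S^3*(h^3*z^3) + h^3*(16*S^2*z^3)+ h^3*(16*S^2*z^3)/2 := by ring
  constructor <;> linarith [ht2.1, ht2.2]

lemma QF_shift_err (A B C : ℝ) (hA : 0 < A) (hB : 0 < B) (hC : 0 < C) (h X Y s t : ℝ) (hh : 0 < h)
    (hh1 : h ≤ 1) (hX : 0 ≤ X) (hY : 0 ≤ Y) (hs : 0 ≤ s) (hs2 : s ≤ 2) (ht : 0 ≤ t) (ht2 : t ≤ 2) :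
    |QF A B C (X+h*s) (Y+h*t) - QF A B C X Y *
      (1 - h*(s*(2*A*X+B*Y)+t*(B*X+2*C*Y)) - h^2*(A*s^2+B*s*t+C*t^2)
        + h^2*(s*(2*A*X+B*Y)+t*(B*X+2*C*Y))^2/2)|
    ≤ (512*(A+B+C)^3+24*(A+B+C)^2) * (h^3*(1+X+Y)^3) * QF A B C X Y := by
  have hL0 : 0 ≤ s*(2*A*X+B*Y)+t*(B*X+2*C*Y) := by positivity
  have hQ0 : 0 ≤ A*s^2+B*s*t+C*t^2 := by positivity
  have hL1 : s*(2*A*X+B*Y)+t*(B*X+2*C*Y) ≤ 4*(A+B+C)*(1+X+Y) := by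
    have e1 : s*(2*A*X+B*Y) ≤ 2*(2*A*X+B*Y) := by gcongr
    have e2 : t*(B*X+2*C*Y) ≤ 2*(B*X+2*C*Y) := by gcongr
    nlinarith [mul_nonneg hA.le hX, mul_nonneg hA.le hY, mul_nonneg hB.le hX, mul_nonneg hB.le hY, mul_nonneg hC.le hX, mul_nonneg hC.le hY]
  have hQ1 : A*s^2+B*s*t+C*t^2 ≤ 4*(A+B+C) := by
    have e1 : A*s^2 ≤ A*2^2 := by gcongr
    have e2 : C*t^2 ≤ C*2^2 := by gcongr
    have e3 : B*s*t ≤ B*2*2 := by gcongr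
    linarith
  have hF : QF A B C (X+h*s) (Y+h*t) = QF A B C X Y * Real.exp (-(h*(s*(2*A*X+B*Y)+t*(B*X+2*C*Y))+h^2*(A*s^2+B*s*t+C*t^2))) := by
    unfold QF; rw [← Real.exp_add]; congr 1; ring
  have hF0 : 0 < QF A B C X Y := Real.exp_pos _
  rw [hF, ← mul_sub, abs_mul, abs_of_pos hF0, mul_comm]
  gcongr
  exact exp_err_aux _ _ _ _ _ (by positivity) (by linarith) hh hh1 hL0 hQ0 hL1 hQ1

lemma QF_decay (A B C : ℝ) (hA : 0 < A) (hB : 0 < B) (hC : 0 < C) (X Y : ℝ) (hX : 0 ≤ X) (hY : 0 ≤ Y) :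
    (1+X+Y)^3 * QF A B C X Y ≤ 6*Real.exp (1+1/A+1/C) * Real.exp (-(X+Y)) := by
  have h1 : (1+X+Y)^3 ≤ 6*Real.exp (1+X+Y) := by
    have := Real.pow_div_factorial_le_exp (1+X+Y) (by positivity) 3
    norm_num [Nat.factorial] at this
    linarith
  calc (1+X+Y)^3 * QF A B C X Y ≤ 6*Real.exp (1+X+Y) * QF A B C X Y := by
        gcongr; exact (Real.exp_pos _).le
    _ = 6 * Real.exp (1+X+Y + -(A*X^2+B*X*Y+C*Y^2)) := by
        unfold QF; rw [mul_assoc, ← Real.exp_add]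
    _ ≤ 6 * Real.exp (1+1/A+1/C + -(X+Y)) := by
        have e1 : 2*X - A*X^2 ≤ 1/A := by
          rw [le_div_iff₀ hA]; nlinarith [sq_nonneg (A*X-1)]
        have e2 : 2*Y - C*Y^2 ≤ 1/C := by
          rw [le_div_iff₀ hC]; nlinarith [sq_nonneg (C*Y-1)]
        have : 0 ≤ B*X*Y := by positivity
        gcongr 6 * Real.exp ?_
        linarith
    _ = _ := by rw [Real.exp_add]; ring

lemma ell_local (A B C x y : ℝ) (hA : 0 < A) (hB : 0 < B) (hC : 0 < C) (hx : 0 ≤ x ∧ x ≤ 1) (hy : 0 ≤ y ∧ y ≤ 1) :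
    ∃ K : ℝ, 0 ≤ K ∧ ∀ h X Y : ℝ, 0 < h → h ≤ 1 → 0 ≤ X → 0 ≤ Y →
      |ell x y (QF A B C (X+h*x) (Y+h*y)) (QF A B C X Y) (QF A B C (X+h*1) Y) (QF A B C X (Y+h*1))
        (QF A B C (X+h*2) Y) (QF A B C X (Y+h*2)) (QF A B C (X+h*1) (Y+h*1))| ≤ K * h^3 * Real.exp (-(X+Y)) := by
  refine ⟨20 * ((512*(A+B+C)^3+24*(A+B+C)^2) * (6*Real.exp (1+1/A+1/C))), by positivity, ?_⟩
  intro h X Y hh hh1 hX hY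
  have key := fun s t hs hs2 ht ht2 => QF_shift_err A B C hA hB hC h X Y s t hh hh1 hX hY hs hs2 ht ht2
  have k := key x y hx.1 (by linarith) hy.1 (by linarith)
  have k00 := key 0 0 (by norm_num) (by norm_num) (by norm_num) (by norm_num)
  have k10 := key 1 0 (by norm_num) (by norm_num) (by norm_num) (by norm_num)
  have k01 := key 0 1 (by norm_num) (by norm_num) (by norm_num) (by norm_num)
  have k20 := key 2 0 (by norm_num) (by norm_num) (by norm_num) (by norm_num)
  have k02 := key 0 2 (by norm_num) (by norm_num) (by norm_num) (by norm_num)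
  have k11 := key 1 1 (by norm_num) (by norm_num) (by norm_num) (by norm_num)
  rw [show h*(0:ℝ) = 0 by ring, add_zero, add_zero] at k00
  rw [show h*(0:ℝ) = 0 by ring, add_zero] at k10 k20 k01 k02
  have e := ell_bound x y hx hy _ _ _ _ _ _ _ _ k k00 k10 k01 k20 k02 k11
  have e2 := QF_decay A B C hA hB hC X Y hX hY
  refine le_trans (le_of_eq ?_) (e.trans ?_)
  · congr 1; unfold ell; ring
  · calc _ = 20 * ((512*(A+B+C)^3+24*(A+B+C)^2) * ((1+X+Y)^3 * QF A B C X Y)) * h^3 := by ring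
      _ ≤ 20 * ((512*(A+B+C)^3+24*(A+B+C)^2) * (6*Real.exp (1+1/A+1/C) * Real.exp (-(X+Y)))) * h^3 := by
        gcongr
      _ = _ := by ring

lemma summable_exp_h (h : ℝ) (hh : 0 < h) : Summable (fun k : ℕ => Real.exp (-(h*k))) := by
  have : (fun k : ℕ => Real.exp (-(h*k))) = fun k : ℕ => (Real.exp (-h))^k := by
    funext k; rw [← Real.exp_nat_mul]; congr 1; ring
  rw [this]
  exact summable_geometric_of_lt_one (Real.exp_pos _).le (by rw [Real.exp_lt_one_iff]; linarith)

lemma tsum_exp_h_le (h : ℝ) (hh : 0 < h) (hh1 : h ≤ 1) : ∑' k : ℕ, Real.exp (-(h*k)) ≤ 2/h := by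
  have : (fun k : ℕ => Real.exp (-(h*k))) = fun k : ℕ => (Real.exp (-h))^k := by
    funext k; rw [← Real.exp_nat_mul]; congr 1; ring
  rw [this, tsum_geometric_of_lt_one (Real.exp_pos _).le (by rw [Real.exp_lt_one_iff]; linarith)]
  have hb : Real.exp (-h) ≤ 1 - h/2 := by
    have h1 := Real.add_one_le_exp h
    rw [Real.exp_neg, inv_le_iff_one_le_mul₀ (Real.exp_pos h)]
    have : (1-h/2)*(h+1) ≤ (1-h/2)*Real.exp h := mul_le_mul_of_nonneg_left h1 (by linarith)
    nlinarith
  rw [inv_le_comm₀ (by linarith) (by positivity)]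
  rw [inv_div]; linarith

lemma summable_exp_h2 (h : ℝ) (hh : 0 < h) :
    Summable (fun p : ℕ × ℕ => Real.exp (-(h*p.1+h*p.2))) := by
  have := (summable_exp_h h hh).mul_of_nonneg (summable_exp_h h hh) (fun _ => (Real.exp_pos _).le) (fun _ => (Real.exp_pos _).le)
  refine this.congr ?_
  intro p; rw [← Real.exp_add]; congr 1; ring

lemma tsum_exp_h2_le (h : ℝ) (hh : 0 < h) (hh1 : h ≤ 1) :
    ∑' p : ℕ × ℕ, Real.exp (-(h*p.1+h*p.2)) ≤ (2/h)^2 := by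
  have e : ∀ p : ℕ × ℕ, Real.exp (-(h*p.1+h*p.2)) = Real.exp (-(h*p.1)) * Real.exp (-(h*p.2)) := by
    intro p; rw [← Real.exp_add]; congr 1; ring
  simp_rw [e]
  have hs : Summable (fun p : ℕ × ℕ => Real.exp (-(h*p.1)) * Real.exp (-(h*p.2))) :=
    (summable_exp_h2 h hh).congr e
  rw [← (summable_exp_h h hh).tsum_mul_tsum (summable_exp_h h hh) hs, sq]
  have := tsum_exp_h_le h hh hh1
  have h0 : 0 ≤ ∑' k : ℕ, Real.exp (-(h*k)) := tsum_nonneg fun _ => (Real.exp_pos _).le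
  gcongr

lemma QF_le (A B C : ℝ) (hA : 0 < A) (hB : 0 < B) (hC : 0 < C) (X Y : ℝ) (hX : 0 ≤ X) (hY : 0 ≤ Y) :
    QF A B C X Y ≤ 6*Real.exp (1+1/A+1/C) * Real.exp (-(X+Y)) := by
  refine le_trans ?_ (QF_decay A B C hA hB hC X Y hX hY)
  have h1 : 1 ≤ (1+X+Y)^3 := one_le_pow₀ (by linarith)
  have h2 : 0 ≤ QF A B C X Y := (Real.exp_pos _).le
  nlinarith

lemma QF_summable (A B C : ℝ) (hA : 0 < A) (hB : 0 < B) (hC : 0 < C) (h x y : ℝ) (hh : 0 < h)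
    (hx : 0 ≤ x) (hy : 0 ≤ y) : Summable (fun p : ℕ × ℕ => QF A B C (h*(p.1+x)) (h*(p.2+y))) := by
  refine Summable.of_nonneg_of_le (fun _ => (Real.exp_pos _).le) ?_
    ((summable_exp_h2 h hh).mul_left (6*Real.exp (1+1/A+1/C)))
  intro p
  refine (QF_le A B C hA hB hC _ _ (by positivity) (by positivity)).trans ?_
  gcongr
  · nlinarith
  · nlinarith

lemma QF_summable1 (A B C : ℝ) (hA : 0 < A) (hB : 0 < B) (hC : 0 < C) (h X : ℝ) (hh : 0 < h)
    (hX : 0 ≤ X) : Summable (fun l : ℕ => QF A B C X (h*l)) := by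
  refine Summable.of_nonneg_of_le (fun _ => (Real.exp_pos _).le) ?_
    ((summable_exp_h h hh).mul_left (6*Real.exp (1+1/A+1/C)))
  intro p
  refine (QF_le A B C hA hB hC _ _ (by positivity) (by positivity)).trans ?_
  gcongr
  nlinarith

lemma QF_swap (A B C X Y : ℝ) : QF A B C X Y = QF C B A Y X := by
  unfold QF; congr 1; ring

/-- shifted Gaussian lattice sum -/
noncomputable def GS (A B C h x y : ℝ) : ℝ := ∑' p : ℕ × ℕ, QF A B C (h*(p.1+x)) (h*(p.2+y))
/-- boundary theta sum -/
noncomputable def GT (C h : ℝ) : ℝ := ∑' l : ℕ, Real.exp (-(C*(h*l)^2))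

lemma GS_swap (A B C h x y : ℝ) : GS A B C h x y = GS C B A h y x := by
  unfold GS
  rw [← (Equiv.prodComm ℕ ℕ).tsum_eq]
  refine tsum_congr fun p => ?_
  rw [QF_swap]; rfl

lemma tsum_prod_shift (φ : ℕ → ℕ → ℝ) (hφ : Summable (fun p : ℕ × ℕ => φ p.1 p.2)) :
    ∑' p : ℕ × ℕ, φ p.1 p.2 = ∑' l, φ 0 l + ∑' p : ℕ × ℕ, φ (p.1+1) p.2 := by
  have h2 : Summable (fun p : ℕ × ℕ => φ (p.1+1) p.2) :=
    hφ.comp_injective (i := fun p : ℕ × ℕ => (p.1+1, p.2)) (by rintro ⟨a,b⟩ ⟨c,d⟩ h; simpa using h)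
  rw [hφ.tsum_prod, h2.tsum_prod, hφ.prod.tsum_eq_zero_add]

lemma GS_shift1 (A B C : ℝ) (hA : 0 < A) (hB : 0 < B) (hC : 0 < C) (h x y : ℝ) (hh : 0 < h)
    (hx : 0 ≤ x) (hy : 0 ≤ y) :
    GS A B C h x y = ∑' l : ℕ, QF A B C (h*x) (h*(l+y)) + GS A B C h (x+1) y := by
  unfold GS
  have := tsum_prod_shift (fun k l => QF A B C (h*(k+x)) (h*(l+y))) (QF_summable A B C hA hB hC h x y hh hx hy)
  rw [this]
  congr 1
  · simp
  · refine tsum_congr fun p => ?_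
    push_cast; ring_nf

lemma GT_eq (A B C h : ℝ) : ∑' l : ℕ, QF A B C 0 (h*l) = GT C h := by
  unfold GT QF; refine tsum_congr fun l => ?_
  congr 1; ring

lemma exp_taylor1 (δ : ℝ) (h : 0 ≤ δ) : |1 - Real.exp (-δ) - δ| ≤ δ^2 := by
  have h1 := Real.add_one_le_exp (-δ)
  have h2 : Real.exp (-δ) ≤ 1 - δ + δ^2 := by
    rw [Real.exp_neg, inv_le_iff_one_le_mul₀ (Real.exp_pos δ)]
    have h3 := Real.add_one_le_exp δ
    have : (1-δ+δ^2)*(δ+1) ≤ (1-δ+δ^2)*Real.exp δ := mul_le_mul_of_nonneg_left h3 (by nlinarith [sq_nonneg (δ-1)])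
    nlinarith [mul_nonneg h (sq_nonneg δ)]
  rw [abs_le]; constructor <;> nlinarith [sq_nonneg δ]

lemma tendsto_of_le_mul (f : ℝ → ℝ) (c K : ℝ) (hf : ∀ h, 0 < h → h ≤ 1 → |f h - c| ≤ K * h) :
    Tendsto f (𝓝[>] 0) (𝓝 c) := by
  rw [tendsto_iff_norm_sub_tendsto_zero]
  have h1 : Tendsto (fun h : ℝ => K * h) (𝓝[>] 0) (𝓝 0) := by
    have : Tendsto (fun h : ℝ => K * h) (𝓝 0) (𝓝 (K*0)) := (continuous_const.mul continuous_id).tendsto 0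
    rw [mul_zero] at this
    exact this.mono_left nhdsWithin_le_nhds
  refine tendsto_of_tendsto_of_tendsto_of_le_of_le' tendsto_const_nhds h1 ?_ ?_
  · exact Eventually.of_forall fun _ => norm_nonneg _
  · filter_upwards [Ioc_mem_nhdsGT (show (0:ℝ) < 1 by norm_num)] with h hh
    exact hf h hh.1 hh.2

lemma GT_summable (C h : ℝ) (hC : 0 < C) (hh : 0 < h) : Summable (fun l : ℕ => Real.exp (-(C*(h*l)^2))) := by
  refine (QF_summable1 C C C hC hC hC h 0 hh le_rfl).congr ?_
  intro l; unfold QF; congr 1; ring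

lemma one_dim (A B C : ℝ) (hA : 0 < A) (hB : 0 < B) (hC : 0 < C) :
    Tendsto (fun h : ℝ => GT C h - ∑' l : ℕ, QF A B C h (h*l)) (𝓝[>] 0) (𝓝 (B/(2*C))) := by
  set M := 6*Real.exp (1+1/A+1/C) with hM
  set K := (|A-B/2| + (A+B)^2 + B/(2*C)*(2*C)^2)*M with hK
  have hK0 : 0 ≤ K := by positivity
  apply tendsto_of_le_mul _ _ (K*2)
  intro h hh hh1
  have s1 := GT_summable C h hC hh
  have s2 := QF_summable1 A B C hA hB hC h h hh hh.le
  have s3 : Summable (fun l : ℕ => Real.exp (-(C*(h*(l+1:ℕ))^2))) := (summable_nat_add_iff 1).mpr s1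
  have e1 : GT C h = 1 + ∑' l : ℕ, Real.exp (-(C*(h*(l+1:ℕ))^2)) := by
    unfold GT; rw [s1.tsum_eq_zero_add]; simp
  have hs := (s1.hasSum.sub s2.hasSum).sub ((s1.hasSum.sub s3.hasSum).mul_left (B/(2*C)))
  have e2 : GT C h - ∑' l : ℕ, QF A B C h (h*l) - B/(2*C) = ∑' l : ℕ, ((Real.exp (-(C*(h*l)^2)) - QF A B C h (h*l)) - B/(2*C) * (Real.exp (-(C*(h*l)^2)) - Real.exp (-(C*(h*(l+1:ℕ))^2)))) := by
    rw [hs.tsum_eq]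
    change _ = GT C h - _ - B/(2*C) * (GT C h - _)
    rw [e1]; ring
  rw [e2]
  have bd : ∀ l : ℕ, ‖(Real.exp (-(C*(h*l)^2)) - QF A B C h (h*l)) - B/(2*C) * (Real.exp (-(C*(h*l)^2)) - Real.exp (-(C*(h*(l+1:ℕ))^2)))‖ ≤ K*h^2 * Real.exp (-(h*l)) := by
    intro l
    set Y := h*(l:ℝ) with hY
    have hY0 : 0 ≤ Y := by positivity
    set H := Real.exp (-(C*Y^2)) with hH
    have hH0 : 0 < H := Real.exp_pos _
    have f1 : QF A B C h Y = H * Real.exp (-(A*h^2+B*h*Y)) := by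
      rw [hH, ← Real.exp_add]; unfold QF; congr 1; ring
    have f2 : Real.exp (-(C*(h*(l+1:ℕ))^2)) = H * Real.exp (-(C*h^2+2*C*h*Y)) := by
      rw [hH, ← Real.exp_add]; congr 1; push_cast; rw [hY]; ring
    rw [f1, f2, Real.norm_eq_abs]
    have t1 := exp_taylor1 (A*h^2+B*h*Y) (by positivity)
    have t2 := exp_taylor1 (C*h^2+2*C*h*Y) (by positivity)
    have g1 : (A*h^2+B*h*Y)^2 ≤ ((A+B)*h*(1+Y))^2 := by
      gcongr
      have : h*h ≤ h*1 := by gcongr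
      nlinarith [mul_pos hA hh, mul_pos hB hh, mul_nonneg (mul_pos hA hh).le hY0]
    have g2 : (C*h^2+2*C*h*Y)^2 ≤ ((2*C)*h*(1+Y))^2 := by
      gcongr
      have : h*h ≤ h*1 := by gcongr
      nlinarith [mul_pos hC hh]
    have g3 := QF_decay A B C hA hB hC 0 Y le_rfl hY0
    have g4 : QF A B C 0 Y = H := by rw [hH]; unfold QF; congr 1; ring
    rw [g4, add_zero, zero_add] at g3
    have g5 : (1+Y)^2*H ≤ M*Real.exp (-Y) := by
      refine le_trans ?_ g3
      gcongr
      · linarith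
      · norm_num
    have eq : H - H * Real.exp (-(A*h^2+B*h*Y)) - B/(2*C)*(H - H*Real.exp (-(C*h^2+2*C*h*Y)))
       = H * ((A-B/2)*h^2 + (1 - Real.exp (-(A*h^2+B*h*Y)) - (A*h^2+B*h*Y)) - B/(2*C)*(1 - Real.exp (-(C*h^2+2*C*h*Y)) - (C*h^2+2*C*h*Y))) := by
      field_simp; ring
    rw [eq, abs_mul, abs_of_pos hH0]
    have b1 : |(A-B/2)*h^2| ≤ |A-B/2| * h^2*(1+Y)^2 := by
      rw [abs_mul, abs_of_nonneg (sq_nonneg h)]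
      have : 1 ≤ (1+Y)^2 := one_le_pow₀ (by linarith)
      exact le_mul_of_one_le_right (by positivity) this
    have b3 : |B/(2*C)*(1 - Real.exp (-(C*h^2+2*C*h*Y)) - (C*h^2+2*C*h*Y))| ≤ B/(2*C)*((2*C)*h*(1+Y))^2 := by
      rw [abs_mul, abs_of_pos (by positivity : 0 < B/(2*C))]
      gcongr
      exact t2.trans g2
    have b4 : |(A-B/2)*h^2 + (1 - Real.exp (-(A*h^2+B*h*Y)) - (A*h^2+B*h*Y)) - B/(2*C)*(1 - Real.exp (-(C*h^2+2*C*h*Y)) - (C*h^2+2*C*h*Y))| ≤ |A-B/2| * h^2*(1+Y)^2 + ((A+B)*h*(1+Y))^2 + B/(2*C)*((2*C)*h*(1+Y))^2 := by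
      refine (abs_sub _ _).trans (add_le_add ((abs_add_le _ _).trans (add_le_add b1 (t1.trans g1))) b3)
    calc _ ≤ H * (|A-B/2| * h^2*(1+Y)^2 + ((A+B)*h*(1+Y))^2 + B/(2*C)*((2*C)*h*(1+Y))^2) := by gcongr
      _ = (|A-B/2| + (A+B)^2 + B/(2*C)*(2*C)^2)*h^2*((1+Y)^2*H) := by ring
      _ ≤ (|A-B/2| + (A+B)^2 + B/(2*C)*(2*C)^2)*h^2*(M*Real.exp (-Y)) := by gcongr
      _ = K*h^2 * Real.exp (-Y) := by rw [hK]; ring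
  have := tsum_of_norm_bounded (((summable_exp_h h hh).mul_left (K*h^2)).hasSum) bd
  refine this.trans ?_
  rw [tsum_mul_left]
  calc K*h^2 * ∑' l : ℕ, Real.exp (-(h*l)) ≤ K*h^2*(2/h) := by
        gcongr; exact tsum_exp_h_le h hh hh1
    _ = K*2*h := by field_simp

lemma EM (A B C x y : ℝ) (hA : 0 < A) (hB : 0 < B) (hC : 0 < C) (hx : 0 ≤ x ∧ x ≤ 1) (hy : 0 ≤ y ∧ y ≤ 1) :
    Tendsto (fun h : ℝ => GS A B C h x y - GS A B C h 0 0 + x * GT C h + y * GT A h) (𝓝[>] 0)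
      (𝓝 (x*(x-1)/2*(B/(2*C)) + y*(y-1)/2*(B/(2*A)) + x*y)) := by
  obtain ⟨K, hK0, hK⟩ := ell_local A B C x y hA hB hC hx hy
  have t1 := one_dim A B C hA hB hC
  have t2 := one_dim C B A hC hB hA
  have t3 : Tendsto (fun h : ℝ => ell x y (GS A B C h x y) (GS A B C h 0 0) (GS A B C h 1 0) (GS A B C h 0 1) (GS A B C h 2 0) (GS A B C h 0 2) (GS A B C h 1 1)) (𝓝[>] 0) (𝓝 0) := by
    apply tendsto_of_le_mul _ _ (K*4)
    intro h hh hh1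
    rw [sub_zero]
    have S := fun x y hx hy => (QF_summable A B C hA hB hC h x y hh hx hy).hasSum
    have s := S x y hx.1 hy.1
    have s00 := S 0 0 le_rfl le_rfl
    have s10 := S 1 0 zero_le_one le_rfl
    have s01 := S 0 1 le_rfl zero_le_one
    have s20 := S 2 0 zero_le_two le_rfl
    have s02 := S 0 2 le_rfl zero_le_two
    have s11 := S 1 1 zero_le_one zero_le_one
    have hs := s.sub (((((s00.add ((s10.sub s00).mul_left x)).add ((s01.sub s00).mul_left y)).add
      (((s20.sub (s10.mul_left 2)).add s00).mul_left (x*(x-1)/2))).add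
      (((s02.sub (s01.mul_left 2)).add s00).mul_left (y*(y-1)/2))).add
      ((((s11.sub s10).sub s01).add s00).mul_left (x*y)))
    have e := hs.tsum_eq
    have e' : ell x y (GS A B C h x y) (GS A B C h 0 0) (GS A B C h 1 0) (GS A B C h 0 1) (GS A B C h 2 0) (GS A B C h 0 2) (GS A B C h 1 1) = _ := e.symm
    rw [e', ← Real.norm_eq_abs]
    refine (tsum_of_norm_bounded (((summable_exp_h2 h hh).mul_left (K*h^3)).hasSum) (fun p => ?_)).trans ?_
    rotate_left
    · rw [tsum_mul_left]
      calc K*h^3 * ∑' p : ℕ × ℕ, Real.exp (-(h*p.1+h*p.2)) ≤ K*h^3*(2/h)^2 := by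
            gcongr; exact tsum_exp_h2_le h hh hh1
        _ = K*4*h := by field_simp; norm_num
    · have := hK h (h*p.1) (h*p.2) hh hh1 (by positivity) (by positivity)
      rw [Real.norm_eq_abs]
      refine le_trans (le_of_eq ?_) this
      congr 1
      simp only [ell, mul_add, mul_zero, add_zero]
  have t4 := ((t1.const_mul (x*(x-1)/2)).add (t2.const_mul (y*(y-1)/2))).add_const (x*y)
  have t5 := t3.add t4
  rw [zero_add] at t5
  refine t5.congr' ?_
  filter_upwards [self_mem_nhdsWithin] with h hh
  have hh : 0 < h := hh
  have a1 := GS_shift1 A B C hA hB hC h 0 0 hh le_rfl le_rfl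
  have a2 := GS_shift1 A B C hA hB hC h 1 0 hh zero_le_one le_rfl
  have a3 := GS_shift1 C B A hC hB hA h 0 0 hh le_rfl le_rfl
  have a4 := GS_shift1 C B A hC hB hA h 1 0 hh zero_le_one le_rfl
  have a5 := GS_shift1 C B A hC hB hA h 0 1 hh le_rfl zero_le_one
  simp only [mul_zero, add_zero, zero_add, mul_one, GT_eq] at a1 a2 a3 a4 a5
  rw [show (1:ℝ)+1 = 2 by norm_num] at a2 a4
  simp only [GS_swap C B A] at a3 a4 a5
  have a6 : ∑' l : ℕ, QF C B A 0 (h*(l+1)) = GT A h - 1 := by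
    have s1 := GT_summable A h hA hh
    unfold GT; rw [s1.tsum_eq_zero_add]
    simp only [Nat.cast_zero, mul_zero, QF]
    simp
  rw [a6] at a5
  unfold ell
  have b1 : GS A B C h 1 0 = GS A B C h 0 0 - GT C h := by linarith
  have b2 : GS A B C h 0 1 = GS A B C h 0 0 - GT A h := by linarith
  have b3 : GS A B C h 1 1 = GS A B C h 1 0 - (GT A h - 1) := by linarith
  have b4 : GS A B C h 2 0 = GS A B C h 1 0 - ∑' l : ℕ, QF A B C h (h*l) := by linarith
  have b5 : GS A B C h 0 2 = GS A B C h 0 1 - ∑' l : ℕ, QF C B A h (h*l) := by linarith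
  rw [b3, b4, b5, b1, b2]
  ring


lemma tsum_resid2 (q : ℕ) [NeZero q] (f : ℕ × ℕ → ℝ) (hf : Summable f) :
    ∑' p, f p = ∑ i ∈ Finset.range q, ∑ j ∈ Finset.range q, ∑' p : ℕ × ℕ, f (q*p.1+i, q*p.2+j) := by
  let e : (Fin q × Fin q) × (ℕ × ℕ) ≃ ℕ × ℕ :=
    ((Equiv.prodProdProdComm (Fin q) (Fin q) ℕ ℕ).trans
      (Equiv.prodCongr ((Equiv.prodComm _ _).trans (Nat.divModEquiv q).symm)
        ((Equiv.prodComm _ _).trans (Nat.divModEquiv q).symm)))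
  have he : ∀ i j p, e ((i,j),p) = (q*p.1+i, q*p.2+j) := by
    intro i j p
    simp [e, Nat.divModEquiv, mul_comm, add_comm]
  rw [← e.tsum_eq, ((e.summable_iff).mpr hf).tsum_prod (f := fun x => f (e x)), tsum_fintype, Fintype.sum_prod_type, Finset.sum_range]
  refine Finset.sum_congr rfl fun i _ => ?_
  rw [Finset.sum_range]
  refine Finset.sum_congr rfl fun j _ => ?_
  simp only [he]

noncomputable def cellSum (A B C : ℝ) (q : ℕ) (G : ZMod q → ZMod q → ℝ) (τ : ℝ) : ℝ :=
  ∑' p : ℕ × ℕ, G (p.1+1) p.2 * QF A B C (τ*(p.1+1)) (τ*p.2)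

lemma bdd_zmod (q : ℕ) [NeZero q] (G : ZMod q → ZMod q → ℝ) : ∃ K, 0 ≤ K ∧ ∀ s w, |G s w| ≤ K := by
  refine ⟨∑ s, ∑ w, |G s w|, by positivity, fun s w => ?_⟩
  refine le_trans ?_ (Finset.single_le_sum (f := fun s => ∑ w, |G s w|) (fun i _ => by positivity) (Finset.mem_univ s))
  exact Finset.single_le_sum (f := fun w => |G s w|) (fun i _ => by positivity) (Finset.mem_univ w)

lemma cell_summable (A B C : ℝ) (hA : 0 < A) (hB : 0 < B) (hC : 0 < C) (q : ℕ) [NeZero q]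
    (G : ZMod q → ZMod q → ℝ) (τ : ℝ) (hτ : 0 < τ) :
    Summable (fun p : ℕ × ℕ => G (p.1+1) p.2 * QF A B C (τ*(p.1+1)) (τ*p.2)) := by
  obtain ⟨K, hK0, hK⟩ := bdd_zmod q G
  have h := (QF_summable A B C hA hB hC τ 1 0 hτ zero_le_one le_rfl).mul_left K
  refine Summable.of_norm_bounded h ?_
  intro p
  rw [norm_mul, Real.norm_eq_abs, Real.norm_eq_abs, abs_of_pos (show 0 < QF A B C (τ*(p.1+1)) (τ*p.2) from Real.exp_pos _), add_zero]
  gcongr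
  · exact (Real.exp_pos _).le
  · exact hK _ _

lemma cellSum_eq (A B C : ℝ) (hA : 0 < A) (hB : 0 < B) (hC : 0 < C) (q : ℕ) [NeZero q]
    (G : ZMod q → ZMod q → ℝ) (τ : ℝ) (hτ : 0 < τ) :
    cellSum A B C q G τ = ∑ i ∈ Finset.range q, ∑ j ∈ Finset.range q,
      G ((i+1 : ℕ) : ZMod q) (j : ZMod q) * GS A B C (q*τ) ((i+1 : ℕ)/q) (j/q) := by
  unfold cellSum
  rw [tsum_resid2 q _ (cell_summable A B C hA hB hC q G τ hτ)]
  refine Finset.sum_congr rfl fun i _ => Finset.sum_congr rfl fun j _ => ?_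
  unfold GS
  rw [← tsum_mul_left]
  refine tsum_congr fun p => ?_
  have hq : (q:ℝ) ≠ 0 := by exact_mod_cast NeZero.ne q
  congr 1
  · push_cast; simp
  · congr 1 <;> push_cast <;> field_simp <;> ring

/-- twice `q` times the sawtooth function -/
def b1 {q : ℕ} (s : ZMod q) : ℤ := if s = 0 then 0 else 2 * (s.val : ℤ) - q
def b2 {q : ℕ} (s : ZMod q) : ℤ := (s.val : ℤ) * ((s.val : ℤ) - q)

lemma b1_neg {q : ℕ} [NeZero q] (s : ZMod q) : b1 (-s) = - b1 s := by
  unfold b1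
  by_cases h : s = 0
  · simp [h]
  · have h' : -s ≠ 0 := neg_ne_zero.mpr h
    have : NeZero s := ⟨h⟩
    rw [if_neg h, if_neg h', ZMod.val_neg_of_ne_zero, Nat.cast_sub (ZMod.val_lt s).le]; ring

lemma b2_neg {q : ℕ} [NeZero q] (s : ZMod q) : b2 (-s) = b2 s := by
  unfold b2
  by_cases h : s = 0
  · simp [h]
  · have : NeZero s := ⟨h⟩
    rw [ZMod.val_neg_of_ne_zero, Nat.cast_sub (ZMod.val_lt s).le]; ring

def val1 {q : ℕ} (s : ZMod q) : ℕ := if s = 0 then q else s.val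

lemma sum_range_zmod (q : ℕ) [NeZero q] (φ : ℕ → ℝ) :
    ∑ i ∈ Finset.range q, φ i = ∑ s : ZMod q, φ s.val := by
  refine Finset.sum_nbij' (fun i => (i : ZMod q)) (fun s => s.val) ?_ ?_ ?_ ?_ ?_
  · simp
  · intro s _; simpa using ZMod.val_lt s
  · intro i hi; exact ZMod.val_cast_of_lt (by simpa using hi)
  · intro s _; simp
  · intro i hi; rw [ZMod.val_cast_of_lt (by simpa using hi)]

lemma sum_range_zmod1 (q : ℕ) [NeZero q] (φ : ℕ → ℝ) :
    ∑ i ∈ Finset.range q, φ (i+1) = ∑ s : ZMod q, φ (val1 s) := by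
  have h1 := Finset.sum_range_succ φ q
  have h2 := Finset.sum_range_succ' φ q
  have h3 : ∑ s : ZMod q, φ (val1 s) = ∑ s : ZMod q, φ s.val + (φ q - φ 0) := by
    rw [← Finset.add_sum_erase Finset.univ _ (Finset.mem_univ (0 : ZMod q)), ← Finset.add_sum_erase Finset.univ (fun s : ZMod q => φ s.val) (Finset.mem_univ (0 : ZMod q))]
    have : ∑ x ∈ Finset.univ.erase (0 : ZMod q), φ (val1 x) = ∑ x ∈ Finset.univ.erase (0 : ZMod q), φ (x.val) := by
      refine Finset.sum_congr rfl fun x hx => ?_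
      simp [val1, Finset.ne_of_mem_erase hx]
    rw [this]; simp [val1]; ring
  rw [h3, ← sum_range_zmod]; linarith

lemma cast_val1 {q : ℕ} [NeZero q] (s : ZMod q) : ((val1 s : ℕ) : ZMod q) = s := by
  unfold val1; split_ifs with h <;> simp [h]

lemma cell_limit_raw (A B C : ℝ) (hA : 0 < A) (hB : 0 < B) (hC : 0 < C) (q : ℕ) [NeZero q]
    (G : ZMod q → ZMod q → ℝ) (hW : ∑ s, ∑ w, G s w = 0) :
    Tendsto (fun τ : ℝ => cellSum A B C q G τ + GT C (q*τ) * (∑ s, ∑ w, G s w * (val1 s / q))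
       + GT A (q*τ) * (∑ s, ∑ w, G s w * (w.val / q))) (𝓝[>] 0)
      (𝓝 (∑ s, ∑ w, G s w * ((val1 s/q : ℝ)*(val1 s/q-1)/2*(B/(2*C)) + (w.val/q : ℝ)*(w.val/q-1)/2*(B/(2*A)) + (val1 s/q : ℝ)*(w.val/q)))) := by
  have hq : (0:ℝ) < q := by exact_mod_cast NeZero.pos q
  have ht : Tendsto (fun τ : ℝ => q*τ) (𝓝[>] 0) (𝓝[>] 0) := by
    refine tendsto_nhdsWithin_of_tendsto_nhds_of_eventually_within _ ?_ ?_
    · have : Tendsto (fun τ : ℝ => q*τ) (𝓝 0) (𝓝 (q*0)) := (continuous_const.mul continuous_id).tendsto 0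
      rw [mul_zero] at this
      exact this.mono_left nhdsWithin_le_nhds
    · filter_upwards [self_mem_nhdsWithin] with τ hτ
      exact mul_pos hq hτ
  have key : Tendsto (fun τ : ℝ => ∑ s : ZMod q, ∑ w : ZMod q, G s w * (GS A B C (q*τ) (val1 s/q) (w.val/q) - GS A B C (q*τ) 0 0 + (val1 s/q) * GT C (q*τ) + (w.val/q) * GT A (q*τ))) (𝓝[>] 0)
      (𝓝 (∑ s, ∑ w, G s w * ((val1 s/q : ℝ)*(val1 s/q-1)/2*(B/(2*C)) + (w.val/q : ℝ)*(w.val/q-1)/2*(B/(2*A)) + (val1 s/q : ℝ)*(w.val/q)))) := by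
    refine tendsto_finsetSum _ fun s _ => tendsto_finsetSum _ fun w _ => Tendsto.const_mul _ ?_
    refine (EM A B C (val1 s/q) (w.val/q) hA hB hC ⟨by positivity, ?_⟩ ⟨by positivity, ?_⟩).comp ht
    · rw [div_le_one hq]
      have : val1 s ≤ q := by unfold val1; split_ifs <;> [rfl; exact (ZMod.val_lt s).le]
      exact_mod_cast this
    · rw [div_le_one hq]; exact_mod_cast (ZMod.val_lt w).le
  refine key.congr' ?_
  filter_upwards [self_mem_nhdsWithin] with τ hτ
  rw [cellSum_eq A B C hA hB hC q G τ hτ]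
  rw [sum_range_zmod1 q (fun i => ∑ j ∈ Finset.range q, G (i : ZMod q) (j : ZMod q) * GS A B C (q*τ) (i/q) (j/q))]
  have : ∀ s : ZMod q, ∑ j ∈ Finset.range q, G ((val1 s : ℕ) : ZMod q) (j : ZMod q) * GS A B C (q*τ) (val1 s/q) (j/q) = ∑ w : ZMod q, G s w * GS A B C (q*τ) (val1 s/q) (w.val/q) := by
    intro s
    rw [sum_range_zmod q (fun j => G ((val1 s : ℕ) : ZMod q) (j : ZMod q) * GS A B C (q*τ) (val1 s/q) (j/q))]
    simp [cast_val1]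
  simp_rw [this]
  have e0 : ∑ s, ∑ w, G s w * GS A B C (q*τ) 0 0 = 0 := by
    simp_rw [← Finset.sum_mul]; rw [hW, zero_mul]
  have : ∀ (a b c d g : ℝ), g * (a - b + c + d) = g*a - g*b + g*c + g*d := by intros; ring
  simp_rw [this, Finset.sum_add_distrib, Finset.sum_sub_distrib]
  rw [e0, Finset.mul_sum, Finset.mul_sum]
  simp_rw [Finset.mul_sum]
  rw [sub_zero]
  congr 1
  · congr 1
    refine Finset.sum_congr rfl fun s _ => Finset.sum_congr rfl fun w _ => ?_
    ring
  · refine Finset.sum_congr rfl fun s _ => Finset.sum_congr rfl fun w _ => ?_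
    ring

lemma sum_even_odd (q : ℕ) [NeZero q] (G : ZMod q → ZMod q → ℝ) (hG : ∀ s w, G (-s) (-w) = G s w)
    (φ : ZMod q → ZMod q → ℝ) (hφ : ∀ s w, φ (-s) (-w) = - φ s w) : ∑ s, ∑ w, G s w * φ s w = 0 := by
  have h : ∑ s, ∑ w, G s w * φ s w = - ∑ s, ∑ w, G s w * φ s w := by
    rw [← Finset.sum_neg_distrib]
    rw [← Equiv.sum_comp (Equiv.neg (ZMod q))]
    refine Finset.sum_congr rfl fun s _ => ?_
    rw [← Finset.sum_neg_distrib, ← Equiv.sum_comp (Equiv.neg (ZMod q))]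
    refine Finset.sum_congr rfl fun w _ => ?_
    simp only [Equiv.neg_apply, hG, hφ]; ring
  linarith

lemma cell_limit (A B C : ℝ) (hA : 0 < A) (hB : 0 < B) (hC : 0 < C) (q : ℕ) [NeZero q]
    (G : ZMod q → ZMod q → ℝ) (hW : ∑ s, ∑ w, G s w = 0) (hG : ∀ s w, G (-s) (-w) = G s w)
    (hG0 : G 0 0 = 0) :
    Tendsto (fun τ : ℝ => cellSum A B C q G τ + (GT C (q*τ) * (∑ w, G 0 w)
       - GT A (q*τ) * (∑ s, G s 0)) / 2) (𝓝[>] 0)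
      (𝓝 ((∑ s, ∑ w, G s w * (B/C * b2 s + B/A * b2 w + b1 s * b1 w))/(4*q^2)
        + ((∑ w, G 0 w) - ∑ s, G s 0)/4)) := by
  have hq : (0:ℝ) < q := by exact_mod_cast NeZero.pos q
  have h := cell_limit_raw A B C hA hB hC q G hW
  have v1 : ∀ s : ZMod q, (val1 s : ℝ) = (b1 s + q + (if s = 0 then (q:ℝ) else 0))/2 := by
    intro s; unfold val1 b1; split_ifs <;> push_cast <;> ring
  have v0 : ∀ s : ZMod q, (s.val : ℝ) = (b1 s + q - (if s = 0 then (q:ℝ) else 0))/2 := by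
    intro s; unfold b1; split_ifs with hs
    · subst hs; simp
    · push_cast; ring
  have w2 : ∀ s : ZMod q, (s.val : ℝ)/q * (s.val/q - 1) = b2 s / q^2 := by
    intro s; unfold b2; push_cast; field_simp
  have w1 : ∀ s : ZMod q, (val1 s : ℝ)/q * (val1 s/q - 1) = b2 s / q^2 := by
    intro s; rw [← w2]; unfold val1; split_ifs with hs
    · subst hs; simp [hq.ne']
    · rfl
  have o1 := sum_even_odd q G hG (fun s w => (b1 s : ℝ)) (by intro s w; simp [b1_neg])
  have o2 := sum_even_odd q G hG (fun s w => (b1 w : ℝ)) (by intro s w; simp [b1_neg])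
  have o3 := sum_even_odd q G hG (fun s w => (b1 s : ℝ) * if w = 0 then 1 else 0) (by intro s w; simp [b1_neg]; split_ifs <;> simp)
  have o4 := sum_even_odd q G hG (fun s w => (b1 w : ℝ) * if s = 0 then 1 else 0) (by intro s w; simp [b1_neg]; split_ifs <;> simp)
  have o5 : ∑ s, ∑ w, G s w * (if s = 0 then 1 else 0) = ∑ w, G 0 w := by
    rw [Finset.sum_comm]; simp
  have o6 : ∑ s, ∑ w, G s w * (if w = 0 then 1 else 0) = ∑ s, G s 0 := by
    simp
  have o7 : ∑ s, ∑ w, G s w * ((if s = 0 then 1 else 0) * if w = 0 then 1 else 0) = 0 := by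
    simp [hG0]
  have W1 : (∑ s, ∑ w, G s w * (val1 s / q)) = (∑ w, G 0 w) / 2 := by
    have : ∀ s w, G s w * (val1 s / q) = (1/(2*q)) * (G s w * b1 s) + (1/2) * G s w + (1/2) * (G s w * (if s = 0 then 1 else 0)) := by
      intro s w; rw [v1]; split_ifs <;> field_simp <;> ring
    simp_rw [this, Finset.sum_add_distrib, ← Finset.mul_sum]
    rw [o1, hW, o5]; ring
  have W2 : (∑ s, ∑ w, G s w * (w.val / q)) = - (∑ s, G s 0) / 2 := by
    have : ∀ s w : ZMod q, G s w * (w.val / q) = (1/(2*q)) * (G s w * b1 w) + (1/2) * G s w - (1/2) * (G s w * (if w = 0 then 1 else 0)) := by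
      intro s w; rw [v0]; split_ifs <;> field_simp <;> ring
    simp_rw [this, Finset.sum_sub_distrib, Finset.sum_add_distrib, ← Finset.mul_sum]
    rw [o2, hW, o6]; ring
  have L : (∑ s, ∑ w, G s w * ((val1 s/q : ℝ)*(val1 s/q-1)/2*(B/(2*C)) + (w.val/q : ℝ)*(w.val/q-1)/2*(B/(2*A)) + (val1 s/q : ℝ)*(w.val/q))) = (∑ s, ∑ w, G s w * (B/C * b2 s + B/A * b2 w + b1 s * b1 w))/(4*q^2)
        + ((∑ w, G 0 w) - ∑ s, G s 0)/4 := by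
    have : ∀ s w, G s w * ((val1 s/q : ℝ)*(val1 s/q-1)/2*(B/(2*C)) + (w.val/q : ℝ)*(w.val/q-1)/2*(B/(2*A)) + (val1 s/q : ℝ)*(w.val/q))
       = (1/(4*q^2)) * (G s w * (B/C * b2 s + B/A * b2 w + b1 s * b1 w))
         + (1/(4*q)) * (G s w * b1 s) + (1/(4*q)) * (G s w * b1 w) + (1/4) * G s w
         - (1/(4*q)) * (G s w * (b1 s * if w = 0 then 1 else 0))
         + (1/(4*q)) * (G s w * (b1 w * if s = 0 then 1 else 0))
         + (1/4) * (G s w * if s = 0 then 1 else 0)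
         - (1/4) * (G s w * if w = 0 then 1 else 0)
         - (1/4) * (G s w * ((if s = 0 then 1 else 0) * if w = 0 then 1 else 0)) := by
      intro s w; rw [w1, w2, v1, v0]; split_ifs <;> field_simp <;> ring
    simp_rw [this, Finset.sum_sub_distrib, Finset.sum_add_distrib, Finset.sum_sub_distrib, Finset.sum_add_distrib, ← Finset.mul_sum]
    rw [o1, o2, o3, o4, o5, o6, o7, hW]; ring
  rw [W1, W2, L] at h
  refine h.congr fun τ => ?_
  ring


lemma three_term {q : ℕ} [NeZero q] (x y : ZMod q) (h : ¬ (x = 0 ∧ y = 0)) :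
    b1 x * b1 y = -(q:ℤ)^2 - 2 * b2 x - 2 * b2 y - 2 * b2 (x+y) + b1 (x+y) * (b1 x + b1 y) := by
  have hq : 0 < q := NeZero.pos q
  have hx := ZMod.val_lt x
  have hy := ZMod.val_lt y
  have vx : x = 0 ↔ x.val = 0 := (ZMod.val_eq_zero x).symm
  have vy : y = 0 ↔ y.val = 0 := (ZMod.val_eq_zero y).symm
  have vxy : x + y = 0 ↔ (x+y).val = 0 := (ZMod.val_eq_zero _).symm
  unfold b1 b2
  rw [vx, vy] at h
  simp only [vx, vy, vxy]
  by_cases hlt : x.val + y.val < q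
  · have e : (x+y).val = x.val + y.val := ZMod.val_add_of_lt hlt
    rw [e]
    generalize x.val = a at *
    generalize y.val = b at *
    by_cases ha : a = 0
    · have hb : b ≠ 0 := fun hb => h ⟨ha, hb⟩
      subst ha; simp [hb]; ring
    · by_cases hb : b = 0
      · subst hb; simp [ha]; ring
      · have : a + b ≠ 0 := by omega
        simp [ha, hb]; ring
  · push Not at hlt
    have e : x.val + y.val = (x+y).val + q := (ZMod.val_add_val_of_le hlt)
    have e2 : ((x+y).val : ℤ) = x.val + y.val - q := by
      have : (x.val : ℤ) + y.val = (x+y).val + q := by exact_mod_cast e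
      linarith
    have hx0 : x.val ≠ 0 := by omega
    have hy0 : y.val ≠ 0 := by omega
    rw [e2]
    simp only [hx0, hy0, if_false]
    by_cases h0 : (x+y).val = 0
    · simp only [h0, if_true]
      have : (y.val : ℤ) = q - x.val := by rw [h0] at e2; push_cast at e2; linarith
      rw [this]; ring
    · simp only [h0, if_false]; ring

def gM (q A E L : ℕ) (f : ZMod q → ℤ) (u v : ZMod q) : ℝ := f (A*u^2 + E*v*(L*u-v))

/-- the sum over the cone -/
noncomputable def coneTerm (q A E L : ℕ) (f : ZMod q → ℤ) (τ : ℝ) (p : ℕ × ℕ) : ℝ :=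
  if p.2 < L*(p.1+1) then gM q A E L f (p.1+1) p.2 *
    Real.exp (-(τ^2*(A*(p.1+1)^2+E*p.2*(L*(p.1+1)-p.2)))) else 0

def cellMap (L : ℕ) (x : Fin L × (ℕ × ℕ)) : ℕ × ℕ := (x.2.1+x.2.2, x.1*(x.2.1+1)+(x.1+1)*x.2.2)

lemma cellMap_inj (L : ℕ) : Function.Injective (cellMap L) := by
  rintro ⟨j, s, w⟩ ⟨j', s', w'⟩ h
  simp only [cellMap, Prod.mk.injEq] at h
  obtain ⟨h1, h2⟩ := h
  have e1 : (j:ℕ)*(s+1)+(j+1)*w = j*(s+w+1)+w := by ring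
  have e2 : (j':ℕ)*(s'+1)+(j'+1)*w' = j'*(s+w+1)+w' := by rw [h1]; ring
  rw [e1, e2] at h2
  have hw : w < s+w+1 := by omega
  have hw' : w' < s+w+1 := by omega
  have hj : (j:ℕ) = j' := by
    have := congrArg (· / (s+w+1)) h2
    beta_reduce at this
    rw [add_comm, Nat.add_mul_div_right _ _ (by omega), add_comm _ w', Nat.add_mul_div_right _ _ (by omega), Nat.div_eq_of_lt hw, Nat.div_eq_of_lt hw'] at this
    simpa using this
  have hww : w = w' := by rw [hj] at h2; omega
  have hs : s = s' := by omega
  simp [hww, hs, Fin.ext_iff, hj]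

lemma cellMap_range (L : ℕ) (p : ℕ × ℕ) : p ∈ Set.range (cellMap L) ↔ p.2 < L*(p.1+1) := by
  constructor
  · rintro ⟨⟨j, s, w⟩, rfl⟩
    simp only [cellMap]
    have : (j:ℕ)+1 ≤ L := j.2
    calc (j:ℕ)*(s+1)+(j+1)*w < ((j:ℕ)+1)*(s+w+1) := by nlinarith
      _ ≤ _ := Nat.mul_le_mul_right _ this
  · obtain ⟨u, v⟩ := p
    intro h
    simp only at h
    have hj : v/(u+1) < L := by rw [Nat.div_lt_iff_lt_mul (by omega)]; exact h
    have hm := Nat.mod_lt v (show 0 < u+1 by omega)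
    refine ⟨(⟨v/(u+1), hj⟩, (u - v%(u+1), v%(u+1))), ?_⟩
    simp only [cellMap, Prod.mk.injEq]
    constructor
    · omega
    · have := Nat.div_add_mod v (u+1)
      have e : u - v%(u+1) + 1 + v%(u+1) = u+1 := by omega
      calc v/(u+1)*(u - v%(u+1) + 1)+(v/(u+1)+1)*(v%(u+1)) = v/(u+1)*(u - v%(u+1) + 1 + v%(u+1)) + v%(u+1) := by ring
        _ = (u+1)*(v/(u+1)) + v%(u+1) := by rw [e]; ring
        _ = v := this

noncomputable def cA (A E L : ℕ) (j : ℕ) : ℝ := A + E*j*(L-j)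
noncomputable def cP (E L : ℕ) (j : ℕ) : ℝ := E*(L-2*j)
def cG (q A E L : ℕ) (f : ZMod q → ℤ) (j : ℕ) (s w : ZMod q) : ℝ := gM q A E L f (s+w) (j*s+(j+1)*w)

lemma cA_pos (A E L : ℕ) (hA : 0 < A) (j : ℕ) (hj : j ≤ L) : 0 < cA A E L j := by
  unfold cA
  have : (j:ℝ) ≤ L := by exact_mod_cast hj
  have h2 : 0 ≤ (E:ℝ)*j*(L-j) := mul_nonneg (by positivity) (by linarith)
  have : (0:ℝ) < A := by exact_mod_cast hA
  linarith

lemma cA_succ (A E L j : ℕ) : cA A E L (j+1) = cA A E L j + cP E L j - E := by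
  unfold cA cP; push_cast; ring

lemma cB_eq (A E L j : ℕ) : 2*cA A E L j + cP E L j = 2*cA A E L (j+1) - cP E L (j+1) := by
  unfold cA cP; push_cast; ring

lemma cB_pos (A E L : ℕ) (hA : 0 < A) (j : ℕ) (hj : j < L) : 0 < 2*cA A E L j + cP E L j := by
  have h1 := cA_succ A E L j
  have h2 := cA_pos A E L hA j hj.le
  have h3 := cA_pos A E L hA (j+1) hj
  have : (0:ℝ) ≤ E := by positivity
  linarith

lemma coneTerm_cell (q A E L : ℕ) (f : ZMod q → ℤ) (τ : ℝ) (j : Fin L) (p : ℕ × ℕ) :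
    coneTerm q A E L f τ (cellMap L (j,p)) = cG q A E L f j (p.1+1) p.2 *
      QF (cA A E L j) (2*cA A E L j + cP E L j) (cA A E L (j+1)) (τ*(p.1+1)) (τ*p.2) := by
  unfold coneTerm
  rw [if_pos ((cellMap_range L _).mp ⟨(j,p), rfl⟩)]
  congr 1
  · unfold cG; simp only [cellMap]; push_cast; congr 1; ring
  · unfold QF; congr 1; simp only [cellMap, cA, cP]; push_cast; ring

lemma cone_summable (q A E L : ℕ) [NeZero q] (hA : 0 < A) (f : ZMod q → ℤ) (τ : ℝ) (hτ : 0 < τ) :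
    Summable (fun x : Fin L × (ℕ × ℕ) => coneTerm q A E L f τ (cellMap L x)) := by
  apply Summable.of_norm
  rw [summable_prod_of_nonneg (fun _ => norm_nonneg _)]
  refine ⟨fun j => ?_, Summable.of_finite⟩
  apply Summable.norm
  simp only [coneTerm_cell]
  exact cell_summable _ _ _ (cA_pos A E L hA j j.2.le) (cB_pos A E L hA j j.2) (cA_pos A E L hA (j+1) j.2) q _ τ hτ

lemma cone_summable' (q A E L : ℕ) [NeZero q] (hA : 0 < A) (f : ZMod q → ℤ) (τ : ℝ) (hτ : 0 < τ) :
    Summable (coneTerm q A E L f τ) := by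
  rw [← (cellMap_inj L).summable_iff]
  · exact cone_summable q A E L hA f τ hτ
  · intro x hx
    rw [cellMap_range] at hx
    simp [coneTerm, hx]

lemma cone_eq (q A E L : ℕ) [NeZero q] (hA : 0 < A) (f : ZMod q → ℤ) (τ : ℝ) (hτ : 0 < τ) :
    ∑' p, coneTerm q A E L f τ p = ∑ j ∈ Finset.range L,
      cellSum (cA A E L j) (2*cA A E L j + cP E L j) (cA A E L (j+1)) q (cG q A E L f j) τ := by
  rw [← (cellMap_inj L).tsum_eq]
  · rw [(cone_summable q A E L hA f τ hτ).tsum_prod, tsum_fintype, Finset.sum_range]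
    refine Finset.sum_congr rfl fun j _ => ?_
    unfold cellSum
    refine tsum_congr fun p => coneTerm_cell q A E L f τ j p
  · intro x hx
    rw [cellMap_range]
    by_contra h
    simp [coneTerm, h] at hx


noncomputable def cT (A E L : ℕ) {q : ℕ} (j : ℕ) (u v : ZMod q) : ℝ :=
  b1 u * b1 (v - (j:ZMod q)*u) + cP E L j / cA A E L j * b2 (v - (j:ZMod q)*u)

lemma cG_sum (q A E L : ℕ) [NeZero q] (f : ZMod q → ℤ) (j : ℕ) (φ : ZMod q → ZMod q → ℝ) :
    ∑ s, ∑ w, cG q A E L f j s w * φ s w = ∑ u, ∑ v, gM q A E L f u v * φ (((j:ZMod q)+1)*u - v) (v - (j:ZMod q)*u) := by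
  rw [← Finset.sum_product', ← Finset.sum_product']
  refine Finset.sum_nbij' (fun p => (p.1+p.2, j*p.1+(j+1)*p.2)) (fun p => ((j+1)*p.1 - p.2, p.2 - j*p.1)) ?_ ?_ ?_ ?_ ?_
  · intros; simp
  · intros; simp
  · rintro ⟨s, w⟩ _; ext <;> simp <;> ring
  · rintro ⟨s, w⟩ _; ext <;> simp <;> ring
  · rintro ⟨s, w⟩ _
    simp only [cG]
    congr 2 <;> ring

lemma cell_bracket (q A E L : ℕ) [NeZero q] (hA : 0 < A) (j : ℕ) (hj : j < L) (u v : ZMod q)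
    (h : ¬ (u = 0 ∧ v = 0)) :
    (2*cA A E L j + cP E L j)/cA A E L (j+1) * b2 (((j:ZMod q)+1)*u - v) + (2*cA A E L j + cP E L j)/cA A E L j * b2 (v-(j:ZMod q)*u)
      + (b1 (((j:ZMod q)+1)*u - v) : ℝ) * b1 (v-(j:ZMod q)*u) = cT A E L j u v - cT A E L (j+1) u v - 2 * b2 u - q^2 := by
  have h1 := (cA_pos A E L hA j hj.le).ne'
  have h2 := (cA_pos A E L hA (j+1) hj).ne'
  have e1 : (2*cA A E L j + cP E L j)/cA A E L j = 2 + cP E L j / cA A E L j := by field_simp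
  have e2 : (2*cA A E L j + cP E L j)/cA A E L (j+1) = 2 - cP E L (j+1) / cA A E L (j+1) := by
    rw [cB_eq]; field_simp
  rw [e1, e2]
  have t := three_term (((j:ZMod q)+1)*u - v) (v-(j:ZMod q)*u) (by
    rintro ⟨h3, h4⟩
    apply h
    have hu : u = 0 := by linear_combination h3 + h4
    refine ⟨hu, ?_⟩
    rw [hu] at h4; simpa using h4)
  have e3 : ((j:ZMod q)+1)*u - v + (v-(j:ZMod q)*u) = u := by ring
  rw [e3] at t
  have t' : (b1 (((j:ZMod q)+1)*u - v) : ℝ) * b1 (v-(j:ZMod q)*u) = -(q:ℝ)^2 - 2 * b2 (((j:ZMod q)+1)*u - v) - 2 * b2 (v-(j:ZMod q)*u) - 2 * b2 u + b1 u * (b1 (((j:ZMod q)+1)*u - v) + b1 (v-(j:ZMod q)*u)) := by exact_mod_cast t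
  rw [t']
  unfold cT
  have e4 : v - ((j+1:ℕ) : ZMod q)*u = -(((j:ZMod q)+1)*u - v) := by push_cast; ring
  rw [e4, b1_neg, b2_neg]
  push_cast; ring

lemma gM_symm (q A E L : ℕ) (f : ZMod q → ℤ) (u v : ZMod q) : gM q A E L f u (L*u-v) = gM q A E L f u v := by
  unfold gM; congr 2; ring

lemma cone_limit (q A E L : ℕ) [NeZero q] (hA : 0 < A) (f : ZMod q → ℤ) (hf : f 0 = 0)
    (hW : ∑ u, ∑ v, gM q A E L f u v = 0) :
    Tendsto (fun τ : ℝ => ∑' p, coneTerm q A E L f τ p) (𝓝[>] 0)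
      (𝓝 ((∑ u, ∑ v, gM q A E L f u v * ((b1 u : ℝ) * b1 v + (E*L/A : ℝ) * b2 v - L * b2 u)) / (2*q^2))) := by
  set V : ℕ → ℝ := fun j => ∑ s, gM q A E L f s (j*s) with hV
  have hV1 : ∀ j, ∑ s, cG q A E L f j s 0 = V j := by
    intro j; simp [hV, cG]
  have hV2 : ∀ j, ∑ w, cG q A E L f j 0 w = V (j+1) := by
    intro j; simp [hV, cG]
  have key : ∀ j ∈ Finset.range L, Tendsto (fun τ : ℝ =>
      cellSum (cA A E L j) (2*cA A E L j + cP E L j) (cA A E L (j+1)) q (cG q A E L f j) τ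
       + (GT (cA A E L (j+1)) (q*τ) * V (j+1) - GT (cA A E L j) (q*τ) * V j) / 2) (𝓝[>] 0)
      (𝓝 ((∑ u, ∑ v, gM q A E L f u v * (cT A E L j u v - cT A E L (j+1) u v - 2 * b2 u - q^2)) / (4*q^2)
        + (V (j+1) - V j)/4)) := by
    intro j hj
    rw [Finset.mem_range] at hj
    have h := cell_limit (cA A E L j) (2*cA A E L j + cP E L j) (cA A E L (j+1)) (cA_pos A E L hA j hj.le)
      (cB_pos A E L hA j hj) (cA_pos A E L hA (j+1) hj) q (cG q A E L f j) (by
        have := cG_sum q A E L f j (fun _ _ => 1)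
        simp only [mul_one] at this
        rw [this, hW]) (by
        intro s w
        unfold cG gM
        congr 2; ring) (by simp [cG, gM, hf])
    rw [cG_sum q A E L f j (fun s w => (2*cA A E L j + cP E L j)/cA A E L (j+1) * b2 s + (2*cA A E L j + cP E L j)/cA A E L j * b2 w + b1 s * b1 w)] at h
    rw [hV1, hV2] at h
    convert h using 6 with u _ v _
    by_cases h0 : u = 0 ∧ v = 0
    · obtain ⟨rfl, rfl⟩ := h0
      simp [gM, hf]
    · rw [cell_bracket q A E L hA j hj u v h0]
  have hs := tendsto_finsetSum _ key
  have hVL : V L = V 0 := by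
    simp only [hV]
    refine Finset.sum_congr rfl fun s _ => ?_
    have := gM_symm q A E L f s 0
    simpa using this
  have hAL : cA A E L L = cA A E L 0 := by unfold cA; simp
  have hlim : ∑ j ∈ Finset.range L, ((∑ u, ∑ v, gM q A E L f u v * (cT A E L j u v - cT A E L (j+1) u v - 2 * b2 u - q^2)) / (4*q^2)
        + (V (j+1) - V j)/4) = ((∑ u, ∑ v, gM q A E L f u v * ((b1 u : ℝ) * b1 v + (E*L/A : ℝ) * b2 v - L * b2 u)) / (2*q^2)) := by
    rw [Finset.sum_add_distrib, ← Finset.sum_div, ← Finset.sum_div, Finset.sum_range_sub, hVL, sub_self, zero_div, add_zero]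
    rw [Finset.sum_comm]
    have e1 : ∀ u : ZMod q, ∑ j ∈ Finset.range L, ∑ v, gM q A E L f u v * (cT A E L j u v - cT A E L (j+1) u v - 2 * b2 u - q^2)
      = ∑ v, gM q A E L f u v * (2*((b1 u : ℝ) * b1 v + (E*L/A : ℝ) * b2 v - L * b2 u)) - L*q^2 * ∑ v, gM q A E L f u v := by
      intro u
      rw [Finset.sum_comm]
      have e2 : ∀ v, ∑ j ∈ Finset.range L, gM q A E L f u v * (cT A E L j u v - cT A E L (j+1) u v - 2 * b2 u - q^2)
        = gM q A E L f u v * (cT A E L 0 u v - L*(2 * b2 u + q^2)) - gM q A E L f u v * cT A E L L u v := by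
        intro v
        rw [← Finset.mul_sum]
        have : ∀ j, cT A E L j u v - cT A E L (j+1) u v - 2 * b2 u - q^2 = (cT A E L j u v - cT A E L (j+1) u v) - (2 * b2 u + q^2) := by intro j; ring
        simp only [this]
        rw [Finset.sum_sub_distrib, Finset.sum_range_sub']
        simp
        ring
      rw [Finset.sum_congr rfl fun v _ => e2 v, Finset.sum_sub_distrib]
      have e3 : ∑ v, gM q A E L f u v * cT A E L L u v = - ∑ v, gM q A E L f u v * cT A E L 0 u v := by
        rw [← Equiv.sum_comp (Equiv.subLeft ((L:ZMod q)*u)) (fun v => gM q A E L f u v * cT A E L L u v), ← Finset.sum_neg_distrib]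
        refine Finset.sum_congr rfl fun v _ => ?_
        simp only [Equiv.subLeft_apply]
        rw [gM_symm]
        have e4 : (L:ZMod q)*u - v - L*u = -v := by ring
        unfold cT
        rw [e4, b1_neg, b2_neg, hAL]
        simp [cP]
        ring
      rw [e3, Finset.mul_sum, ← Finset.sum_neg_distrib, ← Finset.sum_sub_distrib, ← Finset.sum_sub_distrib]
      refine Finset.sum_congr rfl fun v _ => ?_
      simp [cT, cA, cP]
      ring
    rw [Finset.sum_congr rfl fun u _ => e1 u, Finset.sum_sub_distrib, ← Finset.mul_sum, hW, mul_zero, sub_zero]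
    have e5 : ∑ u, ∑ v, gM q A E L f u v * (2*((b1 u : ℝ) * b1 v + (E*L/A : ℝ) * b2 v - L * b2 u)) =
       2 * ∑ u, ∑ v, gM q A E L f u v * ((b1 u : ℝ) * b1 v + (E*L/A : ℝ) * b2 v - L * b2 u) := by
      simp only [Finset.mul_sum]
      refine Finset.sum_congr rfl fun u _ => Finset.sum_congr rfl fun v _ => ?_
      ring
    rw [e5]
    rw [show (4*(q:ℝ)^2) = 2 * (2*q^2) by ring, mul_div_mul_left _ _ two_ne_zero]
  rw [hlim] at hs
  refine hs.congr' ?_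
  filter_upwards [self_mem_nhdsWithin] with τ hτ
  rw [cone_eq q A E L hA f τ hτ, Finset.sum_add_distrib, ← Finset.sum_div,
    Finset.sum_range_sub (fun j => GT (cA A E L j) (q*τ) * V j), hAL, hVL]
  simp


/-- functions on the unit interval with a uniform quadratic Taylor bound -/
def Good (φ : ℝ → ℝ) : Prop := ∃ φ1 : ℝ → ℝ, ∃ M : ℝ, 0 ≤ M ∧ ∀ x, 0 ≤ x → x ≤ 1 → |φ x| ≤ M ∧ |φ1 x| ≤ M ∧
  ∀ y, 0 ≤ y → y ≤ 1 → |φ y - φ x - (y-x)*φ1 x| ≤ M*(y-x)^2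

lemma Good.const (c : ℝ) : Good (fun _ => c) := by
  refine ⟨fun _ => 0, |c|, abs_nonneg c, fun x _ _ => ⟨le_rfl, by simp, fun y _ _ => ?_⟩⟩
  simp; positivity

lemma Good.id : Good (fun x => x) := by
  refine ⟨fun _ => 1, 1, zero_le_one, fun x h0 h1 => ⟨?_, by simp, fun y _ _ => ?_⟩⟩
  · rw [abs_of_nonneg h0]; exact h1
  · simp; positivity

lemma Good.add {φ ψ : ℝ → ℝ} (h1 : Good φ) (h2 : Good ψ) : Good (fun x => φ x + ψ x) := by
  obtain ⟨φ1, M, hM, hφ⟩ := h1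
  obtain ⟨ψ1, N, hN, hψ⟩ := h2
  refine ⟨fun x => φ1 x + ψ1 x, M+N, by positivity, fun x h0 h1 => ?_⟩
  obtain ⟨a1, a2, a3⟩ := hφ x h0 h1
  obtain ⟨b1, b2, b3⟩ := hψ x h0 h1
  refine ⟨(abs_add_le _ _).trans (by linarith), (abs_add_le _ _).trans (by linarith), fun y hy0 hy1 => ?_⟩
  have := a3 y hy0 hy1
  have := b3 y hy0 hy1
  calc |φ y + ψ y - (φ x + ψ x) - (y-x)*(φ1 x + ψ1 x)| = |(φ y - φ x - (y-x)*φ1 x) + (ψ y - ψ x - (y-x)*ψ1 x)| := by congr 1; ring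
    _ ≤ _ := (abs_add_le _ _).trans (by linarith)

lemma good_lip {M : ℝ} {φx φy φ1 x y : ℝ} (hM : 0 ≤ M) (h1 : |φ1| ≤ M) (hE : |φy - φx - (y-x)*φ1| ≤ M*(y-x)^2)
    (hx : 0 ≤ x) (hx1 : x ≤ 1) (hy : 0 ≤ y) (hy1 : y ≤ 1) : |φy - φx| ≤ 2*M*|y-x| := by
  have hyx : |y-x| ≤ 1 := by rw [abs_le]; constructor <;> linarith
  calc |φy - φx| = |(φy - φx - (y-x)*φ1) + (y-x)*φ1| := by congr 1; ring
    _ ≤ M*(y-x)^2 + |y-x| * M := (abs_add_le _ _).trans (by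
        rw [abs_mul]; exact add_le_add hE (mul_le_mul_of_nonneg_left h1 (abs_nonneg _)))
    _ ≤ 2*M*|y-x| := by
        rw [← sq_abs]
        nlinarith [abs_nonneg (y-x), mul_nonneg hM (abs_nonneg (y-x))]

lemma Good.mul {φ ψ : ℝ → ℝ} (h1 : Good φ) (h2 : Good ψ) : Good (fun x => φ x * ψ x) := by
  obtain ⟨φ1, M, hM, hφ⟩ := h1
  obtain ⟨ψ1, N, hN, hψ⟩ := h2
  refine ⟨fun x => φ1 x * ψ x + φ x * ψ1 x, 6*M*N, by positivity, fun x h0 h1 => ?_⟩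
  obtain ⟨a1, a2, a3⟩ := hφ x h0 h1
  obtain ⟨b1, b2, b3⟩ := hψ x h0 h1
  have hMN : 0 ≤ M*N := by positivity
  refine ⟨?_, ?_, fun y hy0 hy1 => ?_⟩
  · rw [abs_mul]; nlinarith [mul_le_mul a1 b1 (abs_nonneg _) hM]
  · refine (abs_add_le _ _).trans ?_
    rw [abs_mul, abs_mul]
    nlinarith [mul_le_mul a2 b1 (abs_nonneg _) hM, mul_le_mul a1 b2 (abs_nonneg _) hM]
  · have e1 := a3 y hy0 hy1
    have e2 := b3 y hy0 hy1
    have l1 := good_lip hM a2 e1 h0 h1 hy0 hy1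
    have l2 := good_lip hN b2 e2 h0 h1 hy0 hy1
    have e : φ y * ψ y - φ x * ψ x - (y-x)*(φ1 x * ψ x + φ x * ψ1 x) =
      (φ y - φ x - (y-x)*φ1 x) * ψ x + φ x * (ψ y - ψ x - (y-x)*ψ1 x) + (φ y - φ x)*(ψ y - ψ x) := by ring
    rw [e]
    refine (abs_add_three _ _ _).trans ?_
    rw [abs_mul, abs_mul, abs_mul]
    have k1 := mul_le_mul e1 b1 (abs_nonneg _) (by positivity)
    have k2 := mul_le_mul a1 e2 (abs_nonneg _) hM
    have k3 := mul_le_mul l1 l2 (abs_nonneg _) (by positivity)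
    have k4 : 2*M*|y-x| * (2*N*|y-x|) = 4*M*N*(y-x)^2 := by rw [← sq_abs (y-x)]; ring
    rw [k4] at k3
    linarith

lemma Good.inv {φ : ℝ → ℝ} (h1 : Good φ) (hp : ∀ x, 0 ≤ x → 1 ≤ φ x) : Good (fun x => (φ x)⁻¹) := by
  obtain ⟨φ1, M, hM, hφ⟩ := h1
  refine ⟨fun x => -φ1 x / (φ x)^2, 4*M^2+M+1, by positivity, fun x h0 h1 => ?_⟩
  obtain ⟨a1, a2, a3⟩ := hφ x h0 h1
  have px := hp x h0
  have px0 : 0 < φ x := by linarith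
  refine ⟨?_, ?_, fun y hy0 hy1 => ?_⟩
  · rw [abs_of_pos (inv_pos.mpr px0)]
    have := inv_le_one_of_one_le₀ px
    nlinarith
  · rw [abs_div, abs_neg, abs_of_pos (by positivity : 0 < φ x^2)]
    refine (div_le_self (abs_nonneg _) (by nlinarith)).trans (by nlinarith)
  · have e1 := a3 y hy0 hy1
    have l1 := good_lip hM a2 e1 h0 h1 hy0 hy1
    have py := hp y hy0
    have py0 : 0 < φ y := by linarith
    have e : (φ y)⁻¹ - (φ x)⁻¹ - (y-x)*(-φ1 x / (φ x)^2) =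
      (φ y - φ x)^2 / (φ x^2 * φ y) - (φ y - φ x - (y-x)*φ1 x)/φ x^2 := by field_simp; ring
    rw [e]
    have s1 : 1 ≤ φ x^2 := by nlinarith
    refine (abs_sub _ _).trans ?_
    rw [abs_div, abs_div, abs_of_pos (by positivity : 0 < φ x^2), abs_of_pos (by positivity : 0 < φ x^2 * φ y), abs_of_nonneg (sq_nonneg _)]
    have k1 : (φ y - φ x)^2 / (φ x^2 * φ y) ≤ (φ y - φ x)^2 := div_le_self (sq_nonneg _) (by nlinarith)
    have k2 : |φ y - φ x - (y-x)*φ1 x| / φ x^2 ≤ |φ y - φ x - (y-x)*φ1 x| := div_le_self (abs_nonneg _) s1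
    have k3 : (φ y - φ x)^2 ≤ 4*M^2*(y-x)^2 := by
      have := mul_self_le_mul_self (abs_nonneg _) l1
      rw [← sq, sq_abs] at this
      calc _ ≤ _ := this
        _ = 4*M^2*|y-x|^2 := by ring
        _ = _ := by rw [sq_abs]
    nlinarith [sq_nonneg (y-x)]

lemma Good.sum {ι : Type*} (s : Finset ι) (φ : ι → ℝ → ℝ) (h : ∀ i ∈ s, Good (φ i)) : Good (fun x => ∑ i ∈ s, φ i x) := by
  classical
  induction s using Finset.induction_on with
  | empty => simpa using Good.const 0
  | insert a s ha ih =>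
    simp only [Finset.sum_insert ha]
    exact (h a (by simp)).add (ih fun i hi => h i (by simp [hi]))

lemma Good.pow (n : ℕ) : Good (fun x => x^n) := by
  induction n with
  | zero => simpa using Good.const 1
  | succ n ih => simpa [pow_succ] using ih.mul Good.id

lemma good_block {φ : ℝ → ℝ} (h : Good φ) (P k0 : ℕ) (hk : k0 < P) : ∃ K, 0 ≤ K ∧ ∀ t, 0 < t → t ≤ 1 → ∀ y, 0 ≤ y → y ≤ 1 →
    |φ (y*Real.exp (-(t*k0))) - φ y - (k0/P) * (φ (y*Real.exp (-(t*P))) - φ y)| ≤ K * t^2 * y := by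
  obtain ⟨φ1, M, hM, hφ⟩ := h
  refine ⟨M*(4*P^2), by positivity, fun t ht ht1 y hy hy1 => ?_⟩
  obtain ⟨_, a2, a3⟩ := hφ y hy hy1
  have hPk : (k0:ℝ) ≤ P := by exact_mod_cast hk.le
  have hP : (0:ℝ) < P := by exact_mod_cast (show 0 < P by omega)
  have hk0 : (0:ℝ) ≤ k0 := by positivity
  have rng : ∀ k : ℝ, 0 ≤ k → k ≤ P → (∃ r, 1 - Real.exp (-(t*k)) = t*k + r ∧ |r| ≤ t^2*P^2) ∧
      |φ (y*Real.exp (-(t*k))) - φ y - (y*Real.exp (-(t*k)) - y)*φ1 y| ≤ M*(t^2*P^2*y) := by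
    intro k hk0 hkP
    have h1 : Real.exp (-(t*k)) ≤ 1 := by rw [Real.exp_le_one_iff]; nlinarith
    have h2 : 1 - Real.exp (-(t*k)) ≤ t*k := by linarith [Real.add_one_le_exp (-(t*k))]
    have h3 := Real.exp_pos (-(t*k))
    have h4 : t*k ≤ t*P := mul_le_mul_of_nonneg_left hkP ht.le
    have h5 : 0 ≤ t*k := by positivity
    constructor
    · refine ⟨1 - Real.exp (-(t*k)) - t*k, by ring, (exp_taylor1 (t*k) h5).trans ?_⟩
      nlinarith
    · refine (a3 _ (by positivity) (by nlinarith)).trans ?_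
      refine mul_le_mul_of_nonneg_left ?_ hM
      have : (y*Real.exp (-(t*k)) - y)^2 = y^2*(1 - Real.exp (-(t*k)))^2 := by ring
      rw [this]
      have h6 : (1 - Real.exp (-(t*k)))^2 ≤ t^2*P^2 := by nlinarith
      have h7 : y^2 ≤ y := by nlinarith
      calc _ ≤ y*(t^2*P^2) := mul_le_mul h7 h6 (sq_nonneg _) hy
        _ = _ := by ring
  obtain ⟨⟨r, hr, hr'⟩, e1⟩ := rng k0 hk0 hPk
  obtain ⟨⟨r2, hr2, hr2'⟩, e2⟩ := rng P hP.le le_rfl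
  have hc0 : 0 ≤ (k0/P : ℝ) := by positivity
  have hc1 : (k0/P : ℝ) ≤ 1 := (div_le_one hP).mpr hPk
  have e : φ (y*Real.exp (-(t*k0))) - φ y - (k0/P) * (φ (y*Real.exp (-(t*P))) - φ y) =
     (φ (y*Real.exp (-(t*k0))) - φ y - (y*Real.exp (-(t*k0)) - y)*φ1 y)
     - (k0/P) * (φ (y*Real.exp (-(t*P))) - φ y - (y*Real.exp (-(t*P)) - y)*φ1 y)
     + (-r + (k0/P)*r2) * (y * φ1 y) := by
    have x1 : Real.exp (-(t*k0)) = 1 - t*k0 - r := by linarith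
    have x2 : Real.exp (-(t*P)) = 1 - t*P - r2 := by linarith
    generalize φ (y*Real.exp (-(t*k0))) = w1
    generalize φ (y*Real.exp (-(t*P))) = w2
    rw [x1, x2]
    field_simp
    ring
  rw [e]
  refine (abs_add_le _ _).trans ?_
  have f1 := abs_sub (φ (y*Real.exp (-(t*k0))) - φ y - (y*Real.exp (-(t*k0)) - y)*φ1 y) ((k0/P : ℝ) * (φ (y*Real.exp (-(t*P))) - φ y - (y*Real.exp (-(t*P)) - y)*φ1 y))
  rw [abs_mul (k0/P : ℝ), abs_of_nonneg hc0] at f1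
  have f2 : (k0/P : ℝ) * |φ (y*Real.exp (-(t*P))) - φ y - (y*Real.exp (-(t*P)) - y)*φ1 y| ≤ M*(t^2*P^2*y) :=
    (mul_le_of_le_one_left (abs_nonneg _) hc1).trans e2
  have f3 : |(-r + (k0/P)*r2) * (y * φ1 y)| ≤ (2*(t^2*P^2))*(y*M) := by
    rw [abs_mul, abs_mul, abs_of_nonneg hy]
    refine mul_le_mul ?_ (mul_le_mul_of_nonneg_left a2 hy) (by positivity) (by positivity)
    refine (abs_add_le _ _).trans ?_
    rw [abs_neg, abs_mul, abs_of_nonneg hc0]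
    have := mul_le_of_le_one_left (abs_nonneg r2) hc1
    linarith
  linarith

/-- Abel type summation -/
lemma block_limit (P : ℕ) (hP : 0 < P) (c : ℕ → ℝ) (φ : ℕ → ℝ → ℝ) (hφ : ∀ k, Good (φ k))
    (hz : ∀ y, 0 ≤ y → y ≤ 1 → ∑ k ∈ Finset.range P, c k * φ k y = 0) (h0 : ∀ k, φ k 0 = 0)
    (F : ℝ → ℝ)
    (hF : ∀ t, 0 < t → HasSum (fun j : ℕ => ∑ k ∈ Finset.range P, c k * φ k (Real.exp (-(t*(P*j+k))))) (F t)) :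
    Tendsto F (𝓝[>] 0) (𝓝 (-∑ k ∈ Finset.range P, c k * (k/P) * φ k 1)) := by
  have hb : ∀ k, ∃ K, 0 ≤ K ∧ (k < P → ∀ t, 0 < t → t ≤ 1 → ∀ y, 0 ≤ y → y ≤ 1 →
    |φ k (y*Real.exp (-(t*k))) - φ k y - (k/P) * (φ k (y*Real.exp (-(t*P))) - φ k y)| ≤ K * t^2 * y) := by
    intro k
    by_cases hk : k < P
    · obtain ⟨K, h1, h2⟩ := good_block (hφ k) P k hk
      exact ⟨K, h1, fun _ => h2⟩
    · exact ⟨0, le_rfl, fun h => absurd h hk⟩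
  choose K hK0 hK using hb
  have hPr : (1:ℝ) ≤ P := by exact_mod_cast hP
  apply tendsto_of_le_mul _ _ (2 * ∑ k ∈ Finset.range P, |c k| * K k)
  intro t ht ht1
  set Y : ℕ → ℝ := fun j => Real.exp (-(t*(P*j))) with hY
  have hY0 : ∀ j, 0 < Y j := fun j => Real.exp_pos _
  have hY1 : ∀ j, Y j ≤ 1 := fun j => by simp only [hY]; rw [Real.exp_le_one_iff]; have : 0 ≤ t*(P*j) := by positivity
                                         linarith
  have hYs : ∀ j, Y (j+1) = Y j * Real.exp (-(t*P)) := fun j => by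
    simp only [hY]; rw [← Real.exp_add]; congr 1; push_cast; ring
  have hYe : ∀ j, Y j ≤ Real.exp (-(t*j)) := fun j => by
    simp only [hY]
    apply Real.exp_le_exp.mpr
    have : (0:ℝ) ≤ j := by positivity
    nlinarith [mul_nonneg ht.le this, mul_nonneg (mul_nonneg ht.le this) (sub_nonneg.mpr hPr)]
  have hlimY : Tendsto Y atTop (𝓝 0) := by
    refine squeeze_zero (fun j => (hY0 j).le) hYe ?_
    exact (summable_exp_h t ht).tendsto_atTop_zero
  -- telescoping part
  have htel : HasSum (fun j => ∑ k ∈ Finset.range P, c k * (k/P) * (φ k (Y (j+1)) - φ k (Y j)))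
      (-∑ k ∈ Finset.range P, c k * (k/P) * φ k 1) := by
    rw [← Finset.sum_neg_distrib]
    apply hasSum_sum
    intro k _
    have hlip : ∃ M, 0 ≤ M ∧ ∀ x y, 0 ≤ x → x ≤ 1 → 0 ≤ y → y ≤ 1 → |φ k y - φ k x| ≤ M*|y-x| := by
      obtain ⟨φ1, M, hM, h⟩ := hφ k
      exact ⟨2*M, by positivity, fun x y hx hx1 hy hy1 => good_lip hM (h x hx hx1).2.1 ((h x hx hx1).2.2 y hy hy1) hx hx1 hy hy1⟩
    obtain ⟨M, hM, hlip⟩ := hlip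
    have hlim : Tendsto (fun j => φ k (Y j)) atTop (𝓝 0) := by
      rw [tendsto_zero_iff_abs_tendsto_zero]
      refine squeeze_zero (fun _ => abs_nonneg _) (fun j => ?_) (by simpa using hlimY.const_mul M)
      have := hlip 0 (Y j) le_rfl zero_le_one (hY0 j).le (hY1 j)
      rw [h0, sub_zero, sub_zero, abs_of_pos (hY0 j)] at this
      exact this
    have hsum : Summable (fun j => φ k (Y (j+1)) - φ k (Y j)) := by
      apply Summable.of_norm_bounded (g := fun j : ℕ => M * Real.exp (-(t*j))) ((summable_exp_h t ht).mul_left M)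
      intro j
      refine (hlip _ _ (hY0 j).le (hY1 j) (hY0 _).le (hY1 _)).trans ?_
      refine mul_le_mul_of_nonneg_left ?_ hM
      have e1 : Y (j+1) ≤ Y j := by
        rw [hYs]
        exact mul_le_of_le_one_right (hY0 j).le (by rw [Real.exp_le_one_iff]; nlinarith)
      rw [abs_le]; constructor <;> linarith [hYe j, hY0 (j+1), hY0 j]
    have : HasSum (fun j => φ k (Y (j+1)) - φ k (Y j)) (-φ k 1) := by
      rw [hsum.hasSum_iff_tendsto_nat]
      simp only [Finset.sum_range_sub (fun j => φ k (Y j))]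
      have h1 : Y 0 = 1 := by simp [hY]
      rw [h1]
      simpa using hlim.sub_const (φ k 1)
    have := this.mul_left (c k * (k/P))
    simpa using this
  have hdiff := (hF t ht).sub htel
  have hbd : ∀ j : ℕ, ‖(∑ k ∈ Finset.range P, c k * φ k (Real.exp (-(t*(P*j+k))))) - ∑ k ∈ Finset.range P, c k * (k/P) * (φ k (Y (j+1)) - φ k (Y j))‖ ≤ ((∑ k ∈ Finset.range P, |c k| * K k) * t^2) * Real.exp (-(t*j)) := by
    intro j
    have hz' := hz (Y j) (hY0 j).le (hY1 j)
    have e : (∑ k ∈ Finset.range P, c k * φ k (Real.exp (-(t*(P*j+k))))) - ∑ k ∈ Finset.range P, c k * (k/P) * (φ k (Y (j+1)) - φ k (Y j))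
      = ∑ k ∈ Finset.range P, c k * (φ k (Y j * Real.exp (-(t*k))) - φ k (Y j) - (k/P) * (φ k (Y j*Real.exp (-(t*P))) - φ k (Y j))) := by
      rw [← sub_zero (∑ k ∈ Finset.range P, c k * φ k (Real.exp (-(t*(P*j+k))))), ← hz', ← Finset.sum_sub_distrib, ← Finset.sum_sub_distrib]
      refine Finset.sum_congr rfl fun k _ => ?_
      rw [hYs]
      have : Real.exp (-(t*(P*j+k))) = Y j * Real.exp (-(t*k)) := by
        simp only [hY]; rw [← Real.exp_add]; congr 1; ring
      rw [this]; ring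
    rw [e]
    refine (norm_sum_le _ _).trans ?_
    rw [Finset.sum_mul, Finset.sum_mul]
    refine Finset.sum_le_sum fun k hk => ?_
    rw [norm_mul, Real.norm_eq_abs, Real.norm_eq_abs, mul_assoc, mul_assoc]
    refine mul_le_mul_of_nonneg_left ?_ (abs_nonneg _)
    refine (hK k (Finset.mem_range.mp hk) t ht ht1 (Y j) (hY0 j).le (hY1 j)).trans ?_
    rw [mul_assoc]
    exact mul_le_mul_of_nonneg_left (mul_le_mul_of_nonneg_left (hYe j) (by positivity)) (hK0 k)
  have hsm := (summable_exp_h t ht).mul_left ((∑ k ∈ Finset.range P, |c k| * K k) * t^2)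
  have := tsum_of_norm_bounded hsm.hasSum hbd
  rw [hdiff.tsum_eq, Real.norm_eq_abs] at this
  refine this.trans ?_
  rw [tsum_mul_left]
  have h2 := tsum_exp_h_le t ht ht1
  have hKs : 0 ≤ ∑ k ∈ Finset.range P, |c k| * K k := Finset.sum_nonneg fun k _ => mul_nonneg (abs_nonneg _) (hK0 k)
  calc _ ≤ (∑ k ∈ Finset.range P, |c k| * K k) * t^2 * (2/t) := mul_le_mul_of_nonneg_left h2 (by positivity)
    _ = _ := by field_simp

noncomputable def Rser (q : ℕ) (f : ZMod q → ℤ) (κ : ℕ) (y : ℝ) : ℝ :=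
  ∑ m ∈ Finset.range q, (-(f (κ*m) : ℝ)) * ((∑ i ∈ Finset.range m, y^i) * (∑ i ∈ Finset.range q, y^i)⁻¹)

lemma geom_good (m : ℕ) : Good (fun y => ∑ i ∈ Finset.range m, y^i) := Good.sum _ _ fun i _ => Good.pow i

lemma geom_ge_one (q : ℕ) [NeZero q] (y : ℝ) (hy : 0 ≤ y) : 1 ≤ ∑ i ∈ Finset.range q, y^i := by
  have := Finset.single_le_sum (f := fun i => y^i) (fun i _ => pow_nonneg hy i) (Finset.mem_range.mpr (NeZero.pos q))
  simpa using this

lemma Rser_good (q : ℕ) [NeZero q] (f : ZMod q → ℤ) (κ : ℕ) : Good (Rser q f κ) :=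
  Good.sum _ _ fun m _ => (Good.const _).mul ((geom_good m).mul ((geom_good q).inv (geom_ge_one q)))

lemma odd_sum_zero {q : ℕ} [NeZero q] (g : ZMod q → ℝ) (hg : ∀ x, g (-x) = - g x) : ∑ x, g x = 0 := by
  have := Equiv.sum_comp (Equiv.neg (ZMod q)) g
  simp only [Equiv.neg_apply, hg, Finset.sum_neg_distrib] at this
  linarith

lemma f_zero {q : ℕ} (f : ZMod q → ℤ) (hf : ∀ x, f (-x) = - f x) : f 0 = 0 := by
  have := hf 0
  rw [neg_zero] at this; omega

lemma Rser_sum_zero (q : ℕ) [NeZero q] (f : ZMod q → ℤ) (hf : ∀ x, f (-x) = - f x) (κ : ℕ) :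
    ∑ m ∈ Finset.range q, (f (κ*m) : ℝ) = 0 := by
  have h := sum_range_zmod q (fun m => (f (κ*m) : ℝ))
  rw [h]
  apply odd_sum_zero
  intro x
  simp only [ZMod.natCast_val, ZMod.cast_id', id]
  rw [mul_neg, hf]; push_cast; ring

lemma Rser_hasSum (q : ℕ) [NeZero q] (f : ZMod q → ℤ) (hf : ∀ x, f (-x) = - f x) (κ : ℕ) (y : ℝ) (hy : 0 ≤ y) (hy1 : y < 1) :
    HasSum (fun m : ℕ => (f (κ*(m+1)) : ℝ) * y^(m+1)) (Rser q f κ y) := by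
  obtain ⟨B, hB⟩ : ∃ B : ℝ, ∀ x : ZMod q, |(f x : ℝ)| ≤ B := by
    obtain ⟨B, hB⟩ := Finite.exists_le (fun x : ZMod q => |(f x : ℝ)|)
    exact ⟨B, hB⟩
  have hs : Summable (fun m : ℕ => (f (κ*m) : ℝ) * y^m) := by
    apply Summable.of_norm_bounded (g := fun m => B * y^m) ((summable_geometric_of_lt_one hy hy1).mul_left B)
    intro m
    rw [norm_mul, Real.norm_eq_abs, norm_pow, Real.norm_eq_abs, abs_of_nonneg hy]
    exact mul_le_mul_of_nonneg_right (hB _) (by positivity)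
  have hs' : Summable (fun m : ℕ => (f (κ*((m+1:ℕ):ZMod q)) : ℝ) * y^(m+1)) := (summable_nat_add_iff 1).mpr hs
  have hs2 := hs'
  simp only [Nat.cast_add, Nat.cast_one] at hs2
  refine (hs2.hasSum_iff).mpr ?_
  have h0 := hs.tsum_eq_zero_add
  have hf0 := f_zero f hf
  simp only [Nat.cast_zero, mul_zero, hf0, Int.cast_zero, zero_mul, zero_add, Nat.cast_add, Nat.cast_one] at h0
  rw [← h0, Nat.sumByResidueClasses hs q]
  have hyq : y^q < 1 := pow_lt_one₀ hy hy1 (NeZero.ne q)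
  have e1 : ∀ j : ZMod q, ∑' m : ℕ, (f (κ*((j.val + q*m : ℕ):ZMod q)) : ℝ) * y^(j.val+q*m) = (f (κ*j) : ℝ) * y^j.val * (1-y^q)⁻¹ := by
    intro j
    rw [← tsum_geometric_of_lt_one (pow_nonneg hy q) hyq, ← tsum_mul_left]
    refine tsum_congr fun m => ?_
    rw [pow_add, pow_mul]
    push_cast
    simp
    ring
  rw [Finset.sum_congr rfl fun j _ => e1 j]
  have e2 := sum_range_zmod q (fun m => (f (κ*m) : ℝ) * y^m * (1-y^q)⁻¹)
  simp only [ZMod.natCast_val, ZMod.cast_id', id] at e2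
  rw [← e2]
  have e3 := Rser_sum_zero q f hf κ
  rw [← sub_zero (∑ m ∈ Finset.range q, (f (κ*m) : ℝ) * y^m * (1-y^q)⁻¹), ← zero_mul ((1-y^q)⁻¹), ← e3, Finset.sum_mul, ← Finset.sum_sub_distrib]
  unfold Rser
  refine Finset.sum_congr rfl fun m _ => ?_
  rw [geom_sum_eq hy1.ne, geom_sum_eq hy1.ne]
  have h1 : y - 1 ≠ 0 := by linarith
  have h2 : y^q - 1 ≠ 0 := by linarith
  have h3 : 1 - y^q ≠ 0 := by linarith
  rw [show 1 - y^q = -(y^q-1) by ring]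
  field_simp
  ring

lemma Rser_zero (q : ℕ) [NeZero q] (f : ZMod q → ℤ) (hf : ∀ x, f (-x) = - f x) (κ : ℕ) : Rser q f κ 0 = 0 := by
  have := (Rser_hasSum q f hf κ 0 le_rfl one_pos).tsum_eq
  simpa using this.symm

lemma Rser_one (q : ℕ) [NeZero q] (f : ZMod q → ℤ) (κ : ℕ) : Rser q f κ 1 = -(∑ m ∈ Finset.range q, (m:ℝ) * f (κ*m))/q := by
  unfold Rser
  simp only [one_pow, Finset.sum_const, Finset.card_range, nsmul_eq_mul, mul_one]
  rw [← Finset.sum_neg_distrib, Finset.sum_div]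
  refine Finset.sum_congr rfl fun m _ => ?_
  ring

lemma Rser_congr (q : ℕ) (f : ZMod q → ℤ) (κ κ' : ℕ) (h : (κ : ZMod q) = κ') : Rser q f κ = Rser q f κ' := by
  unfold Rser; rw [h]

lemma hasSum_blocks (P : ℕ) [NeZero P] (g : ℕ → ℝ) (hg : Summable g) :
    HasSum (fun j : ℕ => ∑ k ∈ Finset.range P, g (P*j+k)) (∑' k, g k) := by
  have hs : ∀ k : ℕ, Summable (fun j : ℕ => g (P*j+k)) := fun k => hg.comp_injective (fun a b h => by
    have : P*a = P*b := by simpa using h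
    exact Nat.eq_of_mul_eq_mul_left (NeZero.pos P) this)
  have h := hasSum_sum (s := Finset.range P) fun k _ => (hs k).hasSum
  convert h using 1
  rw [Nat.sumByResidueClasses hg P, sum_range_zmod P (fun k => ∑' j : ℕ, g (P*j+k))]
  refine Finset.sum_congr rfl fun k _ => tsum_congr fun j => ?_
  rw [add_comm]

noncomputable def dirTerm (q D : ℕ) (χ : ZMod D → ℤ) (f : ZMod q → ℤ) (t : ℝ) (p : ℕ × ℕ) : ℝ :=
  χ (p.1+1) * f ((p.1+1)*(p.2+1)) * Real.exp (-(t*((p.1+1)*(p.2+1))))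

lemma dir_summable (q D : ℕ) [NeZero q] [NeZero D] (χ : ZMod D → ℤ) (f : ZMod q → ℤ) (t : ℝ) (ht : 0 < t) :
    Summable (dirTerm q D χ f t) := by
  obtain ⟨B, hB⟩ := Finite.exists_le (fun x : ZMod q => |(f x : ℝ)|)
  obtain ⟨B', hB'⟩ := Finite.exists_le (fun x : ZMod D => |(χ x : ℝ)|)
  have h1 := (summable_exp_h t ht).mul_of_nonneg (summable_exp_h t ht) (fun _ => (Real.exp_pos _).le) (fun _ => (Real.exp_pos _).le)
  apply Summable.of_norm_bounded (h1.mul_left (B'*B))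
  rintro ⟨k, m⟩
  simp only [dirTerm]
  rw [norm_mul, norm_mul, Real.norm_eq_abs, Real.norm_eq_abs, Real.norm_eq_abs, abs_of_pos (Real.exp_pos _), ← Real.exp_add]
  have hb := hB ((k+1)*(m+1))
  have hb' := hB' (k+1)
  refine mul_le_mul (mul_le_mul hb' hb (abs_nonneg _) ((abs_nonneg _).trans hb')) ?_ (Real.exp_pos _).le (mul_nonneg ((abs_nonneg _).trans hb') ((abs_nonneg _).trans hb))
  apply Real.exp_le_exp.mpr
  have : (0:ℝ) ≤ k*m := by positivity
  nlinarith

lemma dir_limit (q D : ℕ) [NeZero q] [NeZero D] (χ : ZMod D → ℤ) (hχ : ∀ x, χ (-x) = χ x)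
    (f : ZMod q → ℤ) (hf : ∀ x, f (-x) = - f x) :
    Tendsto (fun t : ℝ => ∑' p, dirTerm q D χ f t p) (𝓝[>] 0)
      (𝓝 ((∑ k ∈ Finset.range (q*D), ∑ m ∈ Finset.range q, (m:ℝ)*k*χ k*f (k*m))/(q^2*D))) := by
  have : NeZero (q*D) := ⟨mul_ne_zero (NeZero.ne q) (NeZero.ne D)⟩
  have hR0 : ∀ y, Rser q f 0 y = 0 := by
    intro y; unfold Rser; simp [f_zero f hf]
  have key := block_limit (q*D) (NeZero.pos _) (fun k => (χ k : ℝ)) (fun k => Rser q f k) (fun k => Rser_good q f k)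
    (by
      intro y hy hy1
      unfold Rser
      simp only [Finset.mul_sum]
      rw [Finset.sum_comm]
      apply Finset.sum_eq_zero
      intro m _
      have e := sum_range_zmod (q*D) (fun k => (χ k : ℝ) * (-(f (k*m) : ℝ) * ((∑ i ∈ Finset.range m, y^i) * (∑ i ∈ Finset.range q, y^i)⁻¹)))
      rw [e]
      apply odd_sum_zero
      intro x
      have c1 : (((-x).val : ℕ) : ZMod D) = -((x.val : ℕ) : ZMod D) := by
        have h1 := map_neg (ZMod.castHom (Dvd.intro_left q rfl) (ZMod D)) x
        rw [ZMod.castHom_apply, ZMod.castHom_apply] at h1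
        rwa [ZMod.natCast_val, ZMod.natCast_val]
      have c2 : (((-x).val : ℕ) : ZMod q) = -((x.val : ℕ) : ZMod q) := by
        have h1 := map_neg (ZMod.castHom (Dvd.intro D rfl) (ZMod q)) x
        rw [ZMod.castHom_apply, ZMod.castHom_apply] at h1
        rwa [ZMod.natCast_val, ZMod.natCast_val]
      rw [c1, c2, hχ, neg_mul (α := ZMod q), hf]
      push_cast; ring)
    (fun k => Rser_zero q f hf k) (fun t => ∑' p, dirTerm q D χ f t p)
    (by
      intro t ht
      have hs := dir_summable q D χ f t ht
      have hy1 : ∀ k : ℕ, Real.exp (-(t*(k+1))) < 1 := fun k => by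
        rw [Real.exp_lt_one_iff]
        have : 0 < t*(k+1) := by positivity
        linarith
      have e1 : ∀ k : ℕ, ∑' m, dirTerm q D χ f t (k,m) = χ ((k+1 : ℕ)) * Rser q f (k+1) (Real.exp (-(t*((k+1:ℕ):ℝ)))) := by
        intro k
        have h := (Rser_hasSum q f hf (k+1) (Real.exp (-(t*(k+1)))) (Real.exp_pos _).le (hy1 k)).mul_left (χ ((k+1:ℕ)) : ℝ)
        push_cast at h ⊢
        rw [← h.tsum_eq]
        refine tsum_congr fun m => ?_
        simp only [dirTerm]
        rw [← Real.exp_nat_mul]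
        rw [mul_assoc]
        congr 3
        push_cast; ring
      have hs1 := hs.prod
      simp only [e1] at hs1
      have hs2 : Summable (fun k : ℕ => (χ k : ℝ) * Rser q f k (Real.exp (-(t*(k:ℝ))))) := (summable_nat_add_iff 1).mp hs1
      have hb := hasSum_blocks (q*D) _ hs2
      rw [hs.tsum_prod]
      simp only [e1]
      have e2 := hs2.tsum_eq_zero_add
      rw [hR0, mul_zero, zero_add] at e2
      rw [e2] at hb
      convert hb using 1
      funext j
      refine Finset.sum_congr rfl fun k _ => ?_
      have c1 : ((q*D*j+k : ℕ) : ZMod D) = k := by push_cast; simp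
      have c2 : Rser q f (q*D*j+k) = Rser q f k := Rser_congr _ _ _ _ (by push_cast; simp)
      rw [c1, c2]
      push_cast; rfl)
  convert key using 2
  rw [Finset.sum_div, ← Finset.sum_neg_distrib]
  refine Finset.sum_congr rfl fun k _ => ?_
  rw [Rser_one]
  have hq : (q:ℝ) ≠ 0 := by exact_mod_cast NeZero.ne q
  have hD : (D:ℝ) ≠ 0 := by exact_mod_cast NeZero.ne D
  push_cast
  have : ∑ m ∈ Finset.range q, (m:ℝ)*k*χ k*f (k*m) = k*χ k * ∑ m ∈ Finset.range q, (m:ℝ)*f (k*m) := by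
    rw [Finset.mul_sum]; refine Finset.sum_congr rfl fun m _ => ?_; ring
  rw [this]
  generalize ∑ m ∈ Finset.range q, (m:ℝ)*f (k*m) = z
  field_simp


section Count
variable {R : Type*} [CommRing R] [IsDomain R]

lemma ncard_dvd (H : Subgroup Rˣ) (P : Set R) (hP0 : ∀ x ∈ P, x ≠ 0)
    (hrep : ∀ x : R, x ≠ 0 → ∃! y, y ∈ P ∧ ∃ u ∈ H, y = (u:R)*x) (ν : R →* ℕ) (hν : ∀ u : Rˣ, ν u = 1)
    (π : R) (hπ : π ≠ 0) (hπν : ν π ≠ 0) (N : ℕ) :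
    {y | (y ∈ P ∧ ν y = ν π * N) ∧ π ∣ y}.ncard = {x | x ∈ P ∧ ν x = N}.ncard := by
  have hrep' : ∀ x : R, ∃ y, x ≠ 0 → (y ∈ P ∧ ∃ u ∈ H, y = (u:R)*x) := by
    intro x
    by_cases hx : x = 0
    · exact ⟨0, fun h => absurd hx h⟩
    · obtain ⟨y, hy, _⟩ := hrep x hx
      exact ⟨y, fun _ => hy⟩
  choose rp hrp using hrep'
  have huniq : ∀ x y z : R, x ≠ 0 → y ∈ P → z ∈ P → (∃ u ∈ H, y = (u:R)*x) → (∃ u ∈ H, z = (u:R)*x) → y = z := by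
    intro x y z hx hy hz h1 h2
    exact (hrep x hx).unique ⟨hy, h1⟩ ⟨hz, h2⟩
  symm
  refine Set.ncard_congr (fun x _ => rp (π*x)) ?_ ?_ ?_
  · rintro x ⟨hx, hN⟩
    obtain ⟨h1, u, hu, h2⟩ := hrp (π*x) (mul_ne_zero hπ (hP0 x hx))
    refine ⟨⟨h1, ?_⟩, ?_⟩
    · rw [h2, map_mul, map_mul, hν, hN, one_mul]
    · rw [h2]; exact ⟨u*x, by ring⟩
  · rintro x y ⟨hx, hN⟩ ⟨hy, hN'⟩ hxy
    obtain ⟨h1, u, hu, h2⟩ := hrp (π*x) (mul_ne_zero hπ (hP0 x hx))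
    obtain ⟨h3, v, hv, h4⟩ := hrp (π*y) (mul_ne_zero hπ (hP0 y hy))
    have e : (u:R)*x = v*y := by
      apply mul_left_cancel₀ hπ
      have : (u:R)*(π*x) = v*(π*y) := by rw [← h2, ← h4]; exact hxy
      linear_combination this
    have e2 : y = ((v⁻¹*u : Rˣ) : R)*x := by
      rw [Units.val_mul, mul_assoc, e, Units.inv_mul_cancel_left]
    exact huniq x x y (hP0 x hx) hx hy ⟨1, H.one_mem, by simp⟩ ⟨_, H.mul_mem (H.inv_mem hv) hu, e2⟩
  · rintro y ⟨⟨hy, hN⟩, x, rfl⟩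
    have hx0 : x ≠ 0 := right_ne_zero_of_mul (hP0 _ hy)
    obtain ⟨h1, u, hu, h2⟩ := hrp x hx0
    have hνx : ν (rp x) = N := by
      rw [h2, map_mul, hν, one_mul]
      rw [map_mul] at hN
      exact Nat.eq_of_mul_eq_mul_left (Nat.pos_of_ne_zero hπν) hN
    refine ⟨rp x, ⟨h1, hνx⟩, ?_⟩
    obtain ⟨h3, v, hv, h4⟩ := hrp (π*rp x) (mul_ne_zero hπ (hP0 _ h1))
    apply huniq (π*x) _ _ (mul_ne_zero hπ hx0) h3 hy
    · refine ⟨v*u, H.mul_mem hv hu, ?_⟩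
      rw [h4, h2]; push_cast; ring
    · exact ⟨1, H.one_mem, by simp⟩
end Count

lemma rec_pow (c : ℕ → ℤ) (p M : ℕ) (x : ℤ) (h1 : c (p*M) = (1+x) * c M)
    (h2 : ∀ e, c (p*(p*(p^e*M))) = (1+x) * c (p*(p^e*M)) - x * c (p^e*M)) (e : ℕ) :
    c (p^e*M) = c M * ∑ i ∈ Finset.range (e+1), x^i := by
  have : ∀ e, c (p^e*M) = c M * ∑ i ∈ Finset.range (e+1), x^i ∧ c (p^(e+1)*M) = c M * ∑ i ∈ Finset.range (e+2), x^i := by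
    intro e
    induction e with
    | zero =>
      constructor
      · simp
      · simp [h1, Finset.sum_range_succ]; ring
    | succ e ih =>
      refine ⟨ih.2, ?_⟩
      have e1 : p^(e+1+1)*M = p*(p*(p^e*M)) := by ring
      have e2 : p*(p^e*M) = p^(e+1)*M := by ring
      rw [e1, h2, e2, ih.1, ih.2]
      simp only [Finset.sum_range_succ]
      ring
  exact (this e).1

lemma rho_mul (χ : ℕ → ℤ) (hχ : ∀ m n, χ (m*n) = χ m * χ n) (h1 : χ 1 = 1) (p : ℕ) (hp : p.Prime) (M : ℕ) (hM : ¬ p ∣ M) (e : ℕ) :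
    ∑ k ∈ (p^e*M).divisors, χ k = (∑ k ∈ M.divisors, χ k) * ∑ i ∈ Finset.range (e+1), χ p^i := by
  have hc : Nat.Coprime (p^e) M := Nat.Coprime.pow_left _ ((Nat.Prime.coprime_iff_not_dvd hp).mpr hM)
  let g : ArithmeticFunction ℤ := ⟨fun k => if k = 0 then 0 else χ k, by simp⟩
  have hg : g.IsMultiplicative := by
    constructor
    · simp [g, h1]
    · intro m n _
      by_cases hm : m = 0
      · simp [g, hm]
      · by_cases hn : n = 0
        · simp [g, hn]
        · simp [g, hm, hn, hχ]
  have hgz := hg.mul (ArithmeticFunction.isMultiplicative_zeta.natCast (R := ℤ))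
  have hs : ∀ n, (g * (ArithmeticFunction.zeta : ArithmeticFunction ℤ)) n = ∑ k ∈ n.divisors, χ k := by
    intro n
    rw [ArithmeticFunction.coe_mul_zeta_apply]
    refine Finset.sum_congr rfl fun k hk => ?_
    have : k ≠ 0 := (Nat.pos_of_mem_divisors hk).ne'
    simp [g, this]
  have hpow : ∀ i, χ (p^i) = χ p^i := by
    intro i
    induction i with
    | zero => simp [h1]
    | succ i ih => rw [pow_succ, hχ, ih, pow_succ]
  rw [← hs, hgz.map_mul_of_coprime hc, hs, hs, Nat.sum_divisors_prime_pow hp, mul_comm]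
  simp only [hpow]

lemma rec_all (c : ℕ → ℤ) (χ : ℕ → ℤ) (hχ : ∀ m n, χ (m*n) = χ m * χ n) (hχ1 : χ 1 = 1)
    (h1 : ∀ p M, p.Prime → ¬ p ∣ M → 0 < M → c (p*M) = (1+χ p) * c M)
    (h2 : ∀ p N, p.Prime → 0 < N → c (p*(p*N)) = (1+χ p) * c (p*N) - χ p * c N) (N : ℕ) (hN : 0 < N) :
    c N = c 1 * ∑ k ∈ N.divisors, χ k := by
  induction N using Nat.strong_induction_on with
  | _ N ih =>
    by_cases h : N = 1
    · subst h; simp [hχ1]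
    · have hp := Nat.minFac_prime h
      obtain ⟨e, M, hM, hNe⟩ := Nat.exists_eq_pow_mul_and_not_dvd hN.ne' N.minFac hp.ne_one
      have hpd := Nat.minFac_dvd N
      generalize N.minFac = p at *
      have hM0 : 0 < M := Nat.pos_of_ne_zero (by rintro rfl; simp at hM)
      by_cases he : e = 0
      · rw [he, pow_zero, one_mul] at hNe
        exact absurd (hNe ▸ hpd) hM
      · have hlt : M < N := by
          rw [hNe]
          have : 1 < p^e := Nat.one_lt_pow he hp.one_lt
          nlinarith
        rw [hNe, rec_pow c p M (χ p) (h1 p M hp hM hM0) (fun e => h2 p _ hp (Nat.mul_pos (Nat.pow_pos hp.pos) hM0)), ih M hlt hM0,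
          rho_mul χ hχ hχ1 p hp M hM]
        ring


abbrev RR (a n : ℕ) := QuadraticAlgebra ℤ (a:ℤ) ((a:ℤ)*n)

lemma rr_norm {a n : ℕ} (z : RR a n) : z.norm = z.re^2 + a*n*z.re*z.im - a*z.im^2 := by
  rw [QuadraticAlgebra.norm_def]; ring

def epsU (a n : ℕ) : (RR a n)ˣ where
  val := ⟨1, n⟩
  inv := ⟨1+a*n^2, -n⟩
  val_inv := by ext <;> simp [QuadraticAlgebra.re_one, QuadraticAlgebra.im_one] <;> ring
  inv_val := by ext <;> simp [QuadraticAlgebra.re_one, QuadraticAlgebra.im_one] <;> ring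

lemma eps_norm (a n : ℕ) (k : ℤ) : ((epsU a n ^ k : (RR a n)ˣ) : RR a n).norm = 1 := by
  have h : Units.map (QuadraticAlgebra.norm (R := ℤ) (a := (a:ℤ)) (b := (a:ℤ)*n)) (epsU a n) = 1 := by
    ext; simp [epsU, rr_norm]; ring
  have h2 := map_zpow (Units.map (QuadraticAlgebra.norm (R := ℤ) (a := (a:ℤ)) (b := (a:ℤ)*n))) (epsU a n) k
  rw [h, one_zpow] at h2
  exact (congrArg Units.val h2)

def HH (a n : ℕ) : Subgroup (RR a n)ˣ where
  carrier := {u | ∃ k : ℤ, u = epsU a n ^ k ∨ u = - epsU a n ^ k}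
  one_mem' := ⟨0, by simp⟩
  mul_mem' := by
    rintro x y ⟨k, hk⟩ ⟨l, hl⟩
    refine ⟨k+l, ?_⟩
    rw [zpow_add]
    rcases hk with rfl | rfl <;> rcases hl with rfl | rfl <;> simp
  inv_mem' := by
    rintro x ⟨k, hk⟩
    refine ⟨-k, ?_⟩
    rw [zpow_neg]
    rcases hk with rfl | rfl
    · simp
    · right; exact inv_neg

lemma zinc (g : ℤ → ℤ) (hg : ∀ k, g (k-1) < g k) : ∃! k, 0 ≤ g k ∧ g (k-1) < 0 := by
  have hm : StrictMono g := strictMono_int_of_lt_succ (fun k => by have := hg (k+1); simpa using this)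
  have h1 : ∀ m : ℕ, g 0 + m ≤ g m := by
    intro m
    induction m with
    | zero => simp
    | succ m ih => have := hm (show (m:ℤ) < m+1 by omega); push_cast; push_cast at ih; omega
  have h2 : ∀ m : ℕ, g (-(m:ℤ)) ≤ g 0 - m := by
    intro m
    induction m with
    | zero => simp
    | succ m ih => have := hm (show -((m:ℤ)+1) < -m by omega); push_cast; omega
  obtain ⟨k, hk, hk2⟩ := Int.exists_least_of_bdd (P := fun k => 0 ≤ g k) ⟨-(g 0).natAbs, by
    intro z hz
    by_contra hlt
    push Not at hlt
    have := hm hlt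
    have := h2 (g 0).natAbs
    omega⟩ ⟨(g 0).natAbs, by
    have := h1 (g 0).natAbs
    omega⟩
  refine ⟨k, ⟨hk, ?_⟩, ?_⟩
  · by_contra h
    push Not at h
    have := hk2 _ h
    omega
  · rintro l ⟨hl1, hl2⟩
    have h3 := hk2 l hl1
    by_contra hne
    have : k ≤ l - 1 := by omega
    have := hm.monotone this
    omega

lemma zpow_step {a n : ℕ} (x : RR a n) (k : ℤ) : ((epsU a n ^ k : (RR a n)ˣ) : RR a n) * x = ⟨1, n⟩ * (((epsU a n ^ (k-1) : (RR a n)ˣ) : RR a n) * x) := by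
  have : epsU a n ^ k = epsU a n * epsU a n ^ (k-1) := by
    rw [← zpow_one_add]; congr 1; ring
  rw [this, Units.val_mul, mul_assoc]; rfl

lemma step_re {a n : ℕ} (z : RR a n) : ((⟨1, n⟩ : RR a n) * z).re = z.re + a*n*z.im := by simp
lemma step_im {a n : ℕ} (z : RR a n) : ((⟨1, n⟩ : RR a n) * z).im = z.im + n*(z.re + a*n*z.im) := by simp; ring

lemma int_two_way (p : ℤ → Prop) (h0 : p 0) (h : ∀ k, p (k-1) ↔ p k) (k : ℤ) : p k := by
  induction k using Int.induction_on with
  | zero => exact h0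
  | succ k ih => have := h (k+1); rw [add_sub_cancel_right] at this; exact this.mp ih
  | pred k ih => exact (h _).mpr ih

lemma pos_rep {a n : ℕ} (hn : 0 < n) (x : RR a n) (hN : 0 < x.norm) (hu : 0 < x.re) :
    (∀ k : ℤ, 0 < (((epsU a n ^ k : (RR a n)ˣ) : RR a n) * x).re) ∧
    ∃! k : ℤ, 0 ≤ (((epsU a n ^ k : (RR a n)ˣ) : RR a n) * x).im ∧
     (((epsU a n ^ k : (RR a n)ˣ) : RR a n) * x).im < n * (((epsU a n ^ k : (RR a n)ˣ) : RR a n) * x).re := by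
  have hnorm : ∀ k : ℤ, 0 < (((epsU a n ^ k : (RR a n)ˣ) : RR a n) * x).norm := by
    intro k; rw [map_mul, eps_norm, one_mul]; exact hN
  have hpos : ∀ k : ℤ, 0 < (((epsU a n ^ k : (RR a n)ˣ) : RR a n) * x).re := by
    apply int_two_way
    · simpa using hu
    · intro k
      rw [zpow_step x k, step_re]
      have h := hnorm (k-1)
      rw [rr_norm] at h
      generalize ((epsU a n ^ (k-1) : (RR a n)ˣ) : RR a n) * x = z at *
      have : 0 < z.re * (z.re + a*n*z.im) := by nlinarith [mul_nonneg (Int.natCast_nonneg a) (sq_nonneg z.im)]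
      exact (pos_iff_pos_of_mul_pos this)
  refine ⟨hpos, ?_⟩
  have hstep : ∀ k : ℤ, (((epsU a n ^ k : (RR a n)ˣ) : RR a n) * x).im = (((epsU a n ^ (k-1) : (RR a n)ˣ) : RR a n) * x).im + n * (((epsU a n ^ k : (RR a n)ˣ) : RR a n) * x).re := by
    intro k
    rw [zpow_step x k, step_im, step_re]
  have hn' : (0:ℤ) < n := by exact_mod_cast hn
  have := zinc (fun k => (((epsU a n ^ k : (RR a n)ˣ) : RR a n) * x).im) (by
    intro k
    beta_reduce
    rw [hstep k]
    nlinarith [hpos k])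
  refine (existsUnique_congr ?_).mp this
  intro k
  have := hstep k
  constructor
  · rintro ⟨h1, h2⟩; exact ⟨h1, by linarith⟩
  · rintro ⟨h1, h2⟩; exact ⟨h1, by linarith⟩

lemma neg_rep {a n : ℕ} (ha : 0 < a) (hn : 0 < n) (x : RR a n) (hN : x.norm < 0) (hu : 0 < x.im - n*x.re) :
    (∀ k : ℤ, 0 < (((epsU a n ^ k : (RR a n)ˣ) : RR a n) * x).im - n * (((epsU a n ^ k : (RR a n)ˣ) : RR a n) * x).re) ∧
    ∃! k : ℤ, 0 ≤ (((epsU a n ^ k : (RR a n)ˣ) : RR a n) * x).re ∧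
     (((epsU a n ^ k : (RR a n)ˣ) : RR a n) * x).re < a * n * ((((epsU a n ^ k : (RR a n)ˣ) : RR a n) * x).im - n * (((epsU a n ^ k : (RR a n)ˣ) : RR a n) * x).re) := by
  have hnorm : ∀ k : ℤ, (((epsU a n ^ k : (RR a n)ˣ) : RR a n) * x).norm < 0 := by
    intro k; rw [map_mul, eps_norm, one_mul]; exact hN
  have ha' : (0:ℤ) < a := by exact_mod_cast ha
  have hn' : (0:ℤ) < n := by exact_mod_cast hn
  have hpos : ∀ k : ℤ, 0 < (((epsU a n ^ k : (RR a n)ˣ) : RR a n) * x).im - n * (((epsU a n ^ k : (RR a n)ˣ) : RR a n) * x).re := by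
    apply int_two_way
    · simpa using hu
    · intro k
      rw [zpow_step x k, step_re, step_im]
      have h := hnorm (k-1)
      rw [rr_norm] at h
      generalize ((epsU a n ^ (k-1) : (RR a n)ˣ) : RR a n) * x = z at *
      have e : z.im + n*(z.re + a*n*z.im) - n*(z.re+a*n*z.im) = z.im := by ring
      rw [e]
      have : 0 < a * ((z.im - n*z.re) * z.im) := by nlinarith [sq_nonneg z.re]
      exact (pos_iff_pos_of_mul_pos (pos_of_mul_pos_right this ha'.le))
  refine ⟨hpos, ?_⟩
  have hstep : ∀ k : ℤ, (((epsU a n ^ k : (RR a n)ˣ) : RR a n) * x).re = (((epsU a n ^ (k-1) : (RR a n)ˣ) : RR a n) * x).re + a * n * ((((epsU a n ^ k : (RR a n)ˣ) : RR a n) * x).im - n * (((epsU a n ^ k : (RR a n)ˣ) : RR a n) * x).re) := by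
    intro k
    rw [zpow_step x k, step_im, step_re]; ring
  have := zinc (fun k => (((epsU a n ^ k : (RR a n)ˣ) : RR a n) * x).re) (by
    intro k
    beta_reduce
    rw [hstep k]
    nlinarith [hpos k, mul_pos ha' hn', mul_pos (mul_pos ha' hn') (hpos k)])
  refine (existsUnique_congr ?_).mp this
  intro k
  have := hstep k
  constructor
  · rintro ⟨h1, h2⟩; exact ⟨h1, by linarith⟩
  · rintro ⟨h1, h2⟩; exact ⟨h1, by linarith⟩

def DP (a n : ℕ) : Set (RR a n) := {z | 0 ≤ z.im ∧ z.im < n*z.re}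
def DM (a n : ℕ) : Set (RR a n) := {z | 0 ≤ z.re ∧ z.re < a*n*(z.im - n*z.re)}

lemma DP_pos {a n : ℕ} (hn : 0 < n) (z : RR a n) (hz : z ∈ DP a n) : 0 < z.re ∧ 0 < z.norm := by
  obtain ⟨h1, h2⟩ := hz
  have hn' : (0:ℤ) < n := by exact_mod_cast hn
  have h3 : 0 < z.re := by
    by_contra h; push Not at h; nlinarith
  refine ⟨h3, ?_⟩
  rw [rr_norm]
  have : 0 ≤ a*z.im*(n*z.re - z.im) := mul_nonneg (by positivity) (by linarith)
  nlinarith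

lemma DM_neg {a n : ℕ} (ha : 0 < a) (hn : 0 < n) (z : RR a n) (hz : z ∈ DM a n) : 0 < z.im - n*z.re ∧ z.norm < 0 := by
  obtain ⟨h1, h2⟩ := hz
  have hn' : (0:ℤ) < n := by exact_mod_cast hn
  have ha' : (0:ℤ) < a := by exact_mod_cast ha
  have han := mul_pos ha' hn'
  have h3 : 0 < z.im - n*z.re := by
    by_contra h; push Not at h; nlinarith
  refine ⟨h3, ?_⟩
  rw [rr_norm]
  have : 0 ≤ z.re*(a*n*(z.im-n*z.re) - z.re) := mul_nonneg h1 (by linarith)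
  have : 0 < a*(z.im-n*z.re)^2 := by positivity
  nlinarith

lemma rr_rep {a n : ℕ} [IsDomain (RR a n)] (ha : 0 < a) (hn : 0 < n) (x : RR a n) (hx : x ≠ 0) :
    ∃! y, y ∈ DP a n ∪ DM a n ∧ ∃ u ∈ HH a n, y = (u:RR a n)*x := by
  have hN : x.norm ≠ 0 := by
    intro h
    have := QuadraticAlgebra.algebraMap_norm_eq_mul_star x
    rw [h, map_zero] at this
    rcases mul_eq_zero.mp this.symm with h | h
    · exact hx h
    · exact hx (star_eq_zero.mp h)
  have hneg : ∀ y, (∃ u ∈ HH a n, y = (u:RR a n)*(-x)) ↔ (∃ u ∈ HH a n, y = (u:RR a n)*x) := by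
    intro y
    constructor
    · rintro ⟨u, ⟨k, hk⟩, rfl⟩
      refine ⟨-u, ⟨k, ?_⟩, by simp⟩
      rcases hk with rfl | rfl <;> simp
    · rintro ⟨u, ⟨k, hk⟩, rfl⟩
      refine ⟨-u, ⟨k, ?_⟩, by simp⟩
      rcases hk with rfl | rfl <;> simp
  have hcase : ∀ x : RR a n, (0 < x.norm ∧ 0 < x.re) ∨ (x.norm < 0 ∧ 0 < x.im - n*x.re) →
      ∃! y, y ∈ DP a n ∪ DM a n ∧ ∃ u ∈ HH a n, y = (u:RR a n)*x := by
    rintro x (⟨h1, h2⟩ | ⟨h1, h2⟩)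
    · obtain ⟨hp, k, hk, huq⟩ := pos_rep hn x h1 h2
      refine ⟨_, ⟨Or.inl hk, epsU a n ^ k, ⟨k, Or.inl rfl⟩, rfl⟩, ?_⟩
      rintro y ⟨hy, u, ⟨l, hl⟩, rfl⟩
      have hnrm : 0 < ((u:RR a n)*x).norm := by
        rcases hl with rfl | rfl
        · rw [map_mul, eps_norm, one_mul]; exact h1
        · rw [Units.val_neg, neg_mul, QuadraticAlgebra.norm_neg, map_mul, eps_norm, one_mul]; exact h1
      rcases hy with hy | hy
      · have := (DP_pos hn _ hy).1
        rcases hl with rfl | rfl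
        · rw [huq l hy]
        · exfalso
          have h3 := hp l
          rw [Units.val_neg, neg_mul, QuadraticAlgebra.re_neg] at this
          linarith
      · have := (DM_neg ha hn _ hy).2
        linarith
    · obtain ⟨hp, k, hk, huq⟩ := neg_rep ha hn x h1 h2
      refine ⟨_, ⟨Or.inr hk, epsU a n ^ k, ⟨k, Or.inl rfl⟩, rfl⟩, ?_⟩
      rintro y ⟨hy, u, ⟨l, hl⟩, rfl⟩
      have hnrm : ((u:RR a n)*x).norm < 0 := by
        rcases hl with rfl | rfl
        · rw [map_mul, eps_norm, one_mul]; exact h1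
        · rw [Units.val_neg, neg_mul, QuadraticAlgebra.norm_neg, map_mul, eps_norm, one_mul]; exact h1
      rcases hy with hy | hy
      · have := (DP_pos hn _ hy).2
        linarith
      · have := (DM_neg ha hn _ hy).1
        rcases hl with rfl | rfl
        · rw [huq l hy]
        · exfalso
          have h3 := hp l
          rw [Units.val_neg, neg_mul, QuadraticAlgebra.re_neg, QuadraticAlgebra.im_neg] at this
          linarith
  have ha' : (0:ℤ) < a := by exact_mod_cast ha
  rcases lt_or_gt_of_ne hN with h | h
  · have : x.im - n*x.re ≠ 0 := by
      intro h0
      have e : x.im = n*x.re := by linarith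
      rw [rr_norm, e] at h
      nlinarith [sq_nonneg x.re]
    rcases lt_or_gt_of_ne this with h2 | h2
    · have := hcase (-x) (Or.inr ⟨by rwa [QuadraticAlgebra.norm_neg], by simp; linarith⟩)
      simpa only [hneg] using this
    · exact hcase x (Or.inr ⟨h, h2⟩)
  · have : x.re ≠ 0 := by
      intro h0
      rw [rr_norm, h0] at h
      nlinarith [mul_nonneg ha'.le (sq_nonneg x.im)]
    rcases lt_or_gt_of_ne this with h2 | h2
    · have := hcase (-x) (Or.inl ⟨by rwa [QuadraticAlgebra.norm_neg], by simp; linarith⟩)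
      simpa only [hneg] using this
    · exact hcase x (Or.inl ⟨h, h2⟩)


section Count2
variable {R : Type*} [CommRing R] [IsDomain R]

lemma count_inert1 (P : Set R) (ν : R →* ℕ) (ϖ : R) (p M : ℕ) (hp : p.Prime) (hM : ¬ p ∣ M)
    (hν : ν ϖ = p * p) (hdv : ∀ y, p ∣ ν y → ϖ ∣ y) :
    {x | x ∈ P ∧ ν x = p * M}.ncard = 0 := by
  have : {x | x ∈ P ∧ ν x = p * M} = ∅ := by
    ext y
    simp only [Set.mem_ofPred_eq, Set.mem_empty_iff_false, iff_false, not_and]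
    intro _ h
    obtain ⟨z, rfl⟩ := hdv y ⟨M, h⟩
    rw [map_mul, hν, mul_assoc] at h
    exact hM ⟨ν z, (Nat.eq_of_mul_eq_mul_left hp.pos h).symm⟩
  rw [this, Set.ncard_empty]

lemma count_all (H : Subgroup Rˣ) (P : Set R) (hP0 : ∀ x ∈ P, x ≠ 0)
    (hrep : ∀ x : R, x ≠ 0 → ∃! y, y ∈ P ∧ ∃ u ∈ H, y = (u:R)*x) (ν : R →* ℕ) (hν : ∀ u : Rˣ, ν u = 1)
    (π : R) (hπ : π ≠ 0) (hπν : ν π ≠ 0) (hdv : ∀ y, ν π ∣ ν y → π ∣ y) (N : ℕ) :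
    {x | x ∈ P ∧ ν x = ν π * N}.ncard = {x | x ∈ P ∧ ν x = N}.ncard := by
  rw [← ncard_dvd H P hP0 hrep ν hν π hπ hπν N]
  congr 1
  ext y
  simp only [Set.mem_ofPred_eq]
  exact ⟨fun h => ⟨h, hdv y ⟨N, h.2⟩⟩, fun h => h.1⟩

lemma count_split (H : Subgroup Rˣ) (P : Set R) (hP0 : ∀ x ∈ P, x ≠ 0)
    (hrep : ∀ x : R, x ≠ 0 → ∃! y, y ∈ P ∧ ∃ u ∈ H, y = (u:R)*x) (ν : R →* ℕ) (hν : ∀ u : Rˣ, ν u = 1)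
    (hfin : ∀ N, 0 < N → {x | x ∈ P ∧ ν x = N}.Finite)
    (π π' ϖ : R) (p : ℕ) (hp : p ≠ 0) (hπ : π ≠ 0) (hπ' : π' ≠ 0) (hπν : ν π = p) (hπν' : ν π' = p)
    (hdv : ∀ y, p ∣ ν y → π ∣ y ∨ π' ∣ y) (hb : ∀ y, (π ∣ y ∧ π' ∣ y) ↔ ϖ ∣ y) (N : ℕ) (hN : 0 < N) :
    {x | x ∈ P ∧ ν x = p * N}.ncard + {x | (x ∈ P ∧ ν x = p * N) ∧ ϖ ∣ x}.ncard = 2 * {x | x ∈ P ∧ ν x = N}.ncard := by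
  have h1 := ncard_dvd H P hP0 hrep ν hν π hπ (by rw [hπν]; exact hp) N
  have h2 := ncard_dvd H P hP0 hrep ν hν π' hπ' (by rw [hπν']; exact hp) N
  rw [hπν] at h1
  rw [hπν'] at h2
  have hf := hfin (p*N) (by positivity)
  have h3 := Set.ncard_union_add_ncard_inter {y | (y ∈ P ∧ ν y = p * N) ∧ π ∣ y} {y | (y ∈ P ∧ ν y = p * N) ∧ π' ∣ y}
    (hf.subset (fun y hy => hy.1)) (hf.subset (fun y hy => hy.1))
  rw [h1, h2, ← two_mul] at h3
  rw [← h3]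
  congr 2
  · ext y
    simp only [Set.mem_ofPred_eq, Set.mem_union]
    constructor
    · intro h
      rcases hdv y ⟨N, h.2⟩ with h' | h'
      · exact Or.inl ⟨h, h'⟩
      · exact Or.inr ⟨h, h'⟩
    · rintro (h | h) <;> exact h.1
  · ext y
    simp only [Set.mem_ofPred_eq, Set.mem_inter_iff]
    rw [← hb y]
    tauto

end Count2

noncomputable def nuR (a n : ℕ) : RR a n →* ℕ := (Int.natAbsHom : ℤ →* ℕ).comp QuadraticAlgebra.norm

lemma nuR_apply {a n : ℕ} (z : RR a n) : nuR a n z = z.norm.natAbs := rfl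

lemma nuR_unit {a n : ℕ} (u : (RR a n)ˣ) : nuR a n u = 1 := by
  have := u.isUnit.map (nuR a n)
  exact Nat.isUnit_iff.1 this

lemma nuR_cast {a n : ℕ} (p : ℕ) : nuR a n (p : RR a n) = p * p := by
  rw [nuR_apply, QuadraticAlgebra.norm_natCast, Int.natAbs_pow]; simp [sq]

def DD (a n : ℕ) : ℕ := a^2*n^2+4*a

lemma four_norm {a n : ℕ} (z : RR a n) : 4*z.norm = (2*z.re + a*n*z.im)^2 - (DD a n)*z.im^2 := by
  rw [rr_norm]; simp only [DD]; push_cast; ring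

lemma rr_cast_dvd {a n : ℕ} (p : ℕ) (z : RR a n) : (p : RR a n) ∣ z ↔ (p:ℤ) ∣ z.re ∧ (p:ℤ) ∣ z.im := by
  have := QuadraticAlgebra.algebraMap_dvd_iff (a := (a:ℤ)) (b := (a:ℤ)*n) (r := (p:ℤ)) (z := z)
  rw [← this]; simp

lemma rr_inert_odd {a n : ℕ} (p : ℕ) (hp : p.Prime) (h2 : p ≠ 2) (hns : ∀ x : ℤ, ¬ (p:ℤ) ∣ x^2 - DD a n)
    (z : RR a n) (hz : p ∣ nuR a n z) : (p : RR a n) ∣ z := by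
  haveI := Fact.mk hp
  rw [nuR_apply, ← Int.natCast_dvd] at hz
  have h4 : ((p:ℕ):ℤ) ∣ (2*z.re + a*n*z.im)^2 - (DD a n)*z.im^2 := by
    rw [← four_norm]; exact Dvd.dvd.mul_left hz 4
  have him : (p:ℤ) ∣ z.im := by
    by_contra him
    rw [← ZMod.intCast_zmod_eq_zero_iff_dvd] at h4
    rw [← ZMod.intCast_zmod_eq_zero_iff_dvd] at him
    push_cast at h4
    obtain ⟨w, hw⟩ := ZMod.intCast_surjective (((2*(z.re:ZMod p)+(a:ZMod p)*n*(z.im:ZMod p))/(z.im:ZMod p) : ZMod p))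
    apply hns w
    rw [← ZMod.intCast_zmod_eq_zero_iff_dvd]
    push_cast
    rw [hw]
    field_simp
    linear_combination h4
  rw [rr_cast_dvd]
  refine ⟨?_, him⟩
  have hp' : Prime (p:ℤ) := Nat.prime_iff_prime_int.1 hp
  have h5 : (p:ℤ) ∣ (2*z.re + a*n*z.im)^2 := by
    obtain ⟨k, hk⟩ := h4
    obtain ⟨l, hl⟩ := him
    exact ⟨k + DD a n * z.im * l, by linear_combination hk + DD a n * z.im * hl⟩
  have h6 := hp'.dvd_of_dvd_pow h5
  have h7 : (p:ℤ) ∣ 2*z.re := by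
    obtain ⟨k, hk⟩ := h6
    obtain ⟨l, hl⟩ := him
    exact ⟨k - a * n * l, by linear_combination hk - a * n * hl⟩
  rcases hp'.dvd_or_dvd h7 with h | h
  · exfalso
    have : p ∣ 2 := by exact_mod_cast h
    exact h2 ((Nat.prime_dvd_prime_iff_eq hp Nat.prime_two).1 this)
  · exact h

lemma rr_inert_two {a n : ℕ} (ha : Odd a) (hn : Odd n) 
    (z : RR a n) (hz : 2 ∣ nuR a n z) : ((2:ℕ) : RR a n) ∣ z := by
  rw [nuR_apply, ← Int.natCast_dvd, rr_norm] at hz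
  rw [rr_cast_dvd]
  obtain ⟨a', rfl⟩ := ha
  obtain ⟨n', rfl⟩ := hn
  rcases Int.even_or_odd' z.re with ⟨u, hu | hu⟩ <;> rcases Int.even_or_odd' z.im with ⟨v, hv | hv⟩ <;> rw [hu, hv] at hz ⊢
  · exact ⟨⟨u, by simp⟩, ⟨v, by simp⟩⟩
  all_goals
    exfalso
    rw [← ZMod.intCast_zmod_eq_zero_iff_dvd] at hz
    push_cast at hz
    have h20 : (2:ZMod 2) = 0 := rfl
    simp only [h20] at hz
    revert hz
    simp


lemma rr_unit_of_nu {a n : ℕ} (z : RR a n) (h : nuR a n z = 1) : IsUnit z := by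
  rw [QuadraticAlgebra.isUnit_iff_norm_isUnit, Int.isUnit_iff_natAbs_eq]; exact h

lemma rr_prime_of_nu {a n : ℕ} [IsDomain (RR a n)] [IsPrincipalIdealRing (RR a n)] (p : ℕ) (hp : p.Prime)
    (z : RR a n) (h : nuR a n z = p) : Prime z := by
  rw [← irreducible_iff_prime]
  refine ⟨?_, ?_⟩
  · intro hu
    obtain ⟨u, rfl⟩ := hu
    rw [nuR_unit] at h
    exact hp.one_lt.ne h
  · intro x y hxy
    rw [hxy, map_mul] at h
    have := hp
    rw [← h] at this
    rcases Nat.prime_mul_iff.1 this with h' | h'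
    · right; exact rr_unit_of_nu y h'.2
    · left; exact rr_unit_of_nu x h'.2

lemma rr_nu_star {a n : ℕ} (z : RR a n) : nuR a n (star z) = nuR a n z := by
  rw [nuR_apply, nuR_apply, QuadraticAlgebra.norm_star]

lemma rr_mul_star {a n : ℕ} (z : RR a n) : z * star z = ((z.norm : ℤ) : RR a n) := by
  rw [← QuadraticAlgebra.algebraMap_norm_eq_mul_star]; simp

lemma rr_cast_dvd_star {a n : ℕ} (z : RR a n) : ((nuR a n z : ℕ) : RR a n) ∣ z * star z := by
  rw [rr_mul_star, nuR_apply]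
  have : ((z.norm.natAbs : ℕ) : ℤ) ∣ z.norm := Int.natAbs_dvd.2 dvd_rfl
  have := map_dvd (Int.castRingHom (RR a n)) this
  simpa using this

lemma rr_mul_star_dvd {a n : ℕ} (z : RR a n) : z * star z ∣ ((nuR a n z : ℕ) : RR a n) := by
  rw [rr_mul_star, nuR_apply]
  have : z.norm ∣ ((z.norm.natAbs : ℕ) : ℤ) := Int.dvd_natAbs.2 dvd_rfl
  have := map_dvd (Int.castRingHom (RR a n)) this
  simpa using this

lemma rr_exists_pi {a n : ℕ} [IsDomain (RR a n)] [IsPrincipalIdealRing (RR a n)] (p : ℕ) (hp : p.Prime) (h2 : p ≠ 2)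
    (x : ℤ) (hx : (p:ℤ) ∣ x^2 - DD a n) : ∃ π : RR a n, nuR a n π = p := by
  have hnp : ¬ Prime (p : RR a n) := by
    intro hP
    set z : RR a n := ⟨x - a*n, 2⟩ with hz
    have hzn : z.norm = x^2 - DD a n := by
      rw [rr_norm]; simp only [hz, DD]; push_cast; ring
    have h1 : (p : RR a n) ∣ z * star z := by
      rw [rr_mul_star, hzn]
      have := map_dvd (Int.castRingHom (RR a n)) hx
      simpa using this
    have hn2 : ¬ (p:ℤ) ∣ 2 := by
      intro h
      have : p ∣ 2 := by exact_mod_cast h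
      exact h2 ((Nat.prime_dvd_prime_iff_eq hp Nat.prime_two).1 this)
    rcases hP.dvd_or_dvd h1 with h | h
    · exact hn2 ((rr_cast_dvd p z).1 h).2
    · have := ((rr_cast_dvd p (star z)).1 h).2
      rw [hz] at this
      simp at this
      exact hn2 this
  rw [← irreducible_iff_prime, irreducible_iff] at hnp
  have hu : ¬ IsUnit (p : RR a n) := by
    intro h
    obtain ⟨u, hu⟩ := h
    have := nuR_unit u
    rw [hu, nuR_cast] at this
    exact hp.one_lt.ne' (Nat.eq_one_of_mul_eq_one_right this)
  push Not at hnp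
  obtain ⟨α, β, h, hα, hβ⟩ := hnp hu
  have h3 := congrArg (nuR a n) h
  rw [nuR_cast, map_mul] at h3
  refine ⟨α, ?_⟩
  have hα1 : nuR a n α ≠ 1 := fun h => hα (rr_unit_of_nu _ h)
  have hβ1 : nuR a n β ≠ 1 := fun h => hβ (rr_unit_of_nu _ h)
  have := (Nat.Prime.mul_eq_prime_sq_iff hp hα1 hβ1).1 (by rw [← h3, sq])
  exact this.1

def rrS (a n : ℕ) : RR a n := ⟨-(a*n), 2⟩

lemma rrS_star (a n : ℕ) : star (rrS a n) = - rrS a n := by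
  ext <;> simp [rrS]; ring

lemma rrS_norm (a n : ℕ) : (rrS a n).norm = -(DD a n) := by
  rw [rr_norm]; simp only [rrS, DD]; push_cast; ring

lemma rr_star_dvd {a n : ℕ} {x y : RR a n} (h : x ∣ y) : star x ∣ star y := by
  obtain ⟨w, rfl⟩ := h
  rw [star_mul]; exact ⟨star w, by ring⟩

lemma rr_or {a n : ℕ} [IsDomain (RR a n)] [IsPrincipalIdealRing (RR a n)] (p : ℕ) (hp : p.Prime) (π : RR a n)
    (hπ : nuR a n π = p) (y : RR a n) (hy : p ∣ nuR a n y) : π ∣ y ∨ star π ∣ y := by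
  have h1 : π ∣ y * star y := by
    refine (Dvd.intro _ rfl).trans ((rr_mul_star_dvd π).trans (Dvd.dvd.trans ?_ (rr_cast_dvd_star y)))
    rw [hπ]
    exact Nat.cast_dvd_cast hy
  rcases (rr_prime_of_nu p hp π hπ).dvd_or_dvd h1 with h | h
  · exact Or.inl h
  · right
    have := rr_star_dvd h
    rwa [star_star] at this

lemma rr_ramified {a n : ℕ} [IsDomain (RR a n)] [IsPrincipalIdealRing (RR a n)] (p : ℕ) (hp : p.Prime) (h2 : p ≠ 2)
    (hd : p ∣ DD a n) (π : RR a n) (hπ : nuR a n π = p) (y : RR a n) (hy : p ∣ nuR a n y) : π ∣ y := by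
  have key : star π ∣ π := by
    have hs : π ∣ rrS a n := by
      have hν : p ∣ nuR a n (rrS a n) := by
        rw [nuR_apply, rrS_norm]; simpa using hd
      rcases rr_or p hp π hπ _ hν with h | h
      · exact h
      · have := rr_star_dvd h
        rwa [star_star, rrS_star, dvd_neg] at this
    have hs2 : star π ∣ rrS a n := by
      have := rr_star_dvd hs
      rwa [rrS_star, dvd_neg] at this
    obtain ⟨t, ht⟩ := hs
    have hpr := rr_prime_of_nu p hp (star π) (by rw [rr_nu_star, hπ])
    rw [ht] at hs2
    rcases hpr.dvd_or_dvd hs2 with h | h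
    · exact h
    · exfalso
      have h3 : (p : RR a n) ∣ rrS a n := by
        have h4 := rr_cast_dvd_star π
        rw [hπ] at h4
        rw [ht]
        exact h4.trans (mul_dvd_mul_left π h)
      have h5 := ((rr_cast_dvd p _).1 h3).2
      have h5' : (p:ℤ) ∣ 2 := h5
      have : p ∣ 2 := by exact_mod_cast h5'
      exact h2 ((Nat.prime_dvd_prime_iff_eq hp Nat.prime_two).1 this)
  rcases rr_or p hp π hπ y hy with h | h
  · exact h
  · have := rr_star_dvd key
    rw [star_star] at this
    exact this.trans h

lemma rr_split {a n : ℕ} [IsDomain (RR a n)] [IsPrincipalIdealRing (RR a n)] (p : ℕ) (hp : p.Prime) (h2 : p ≠ 2)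
    (hd : ¬ p ∣ DD a n) (π : RR a n) (hπ : nuR a n π = p) (y : RR a n) : (π ∣ y ∧ star π ∣ y) ↔ (p : RR a n) ∣ y := by
  have hp' : Prime (p:ℤ) := Nat.prime_iff_prime_int.1 hp
  constructor
  · rintro ⟨⟨t, rfl⟩, h⟩
    have hpr := rr_prime_of_nu p hp (star π) (by rw [rr_nu_star, hπ])
    rcases hpr.dvd_or_dvd h with h | h
    · exfalso
      have h1 : star π ∣ (π.im : RR a n) * rrS a n := by
        have : (π.im : RR a n) * rrS a n = π - star π := by
          ext <;> simp [rrS] <;> ring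
        rw [this]
        exact dvd_sub h dvd_rfl
      have h3 := map_dvd (nuR a n) h1
      rw [rr_nu_star, hπ, nuR_apply, map_mul, rrS_norm, ← Int.natCast_dvd, QuadraticAlgebra.norm_intCast] at h3
      have him : (p:ℤ) ∣ π.im := by
        rcases hp'.dvd_or_dvd h3 with h | h
        · exact hp'.dvd_of_dvd_pow h
        · exfalso; rw [dvd_neg] at h; exact hd (by exact_mod_cast h)
      have hre : (p:ℤ) ∣ π.re := by
        have h4 : (p:ℤ) ∣ π.norm := by
          rw [Int.natCast_dvd, ← nuR_apply, hπ]
        rw [rr_norm] at h4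
        obtain ⟨k, hk⟩ := h4
        obtain ⟨l, hl⟩ := him
        have : (p:ℤ) ∣ π.re^2 := ⟨k - a*n*π.re*l + a*π.im*l, by linear_combination hk - a*n*π.re*hl + a*π.im*hl⟩
        exact hp'.dvd_of_dvd_pow this
      have h6 := map_dvd (nuR a n) ((rr_cast_dvd p π).2 ⟨hre, him⟩)
      rw [hπ, nuR_cast] at h6
      have := Nat.le_of_dvd hp.pos h6
      have := hp.two_le
      nlinarith
    · have h4 := rr_cast_dvd_star π
      rw [hπ] at h4
      exact h4.trans (mul_dvd_mul_left π h)
  · intro h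
    have h4 := rr_mul_star_dvd π
    rw [hπ] at h4
    exact ⟨(Dvd.intro _ rfl).trans (h4.trans h), (Dvd.intro_left _ rfl).trans (h4.trans h)⟩


noncomputable def cN (a n N : ℕ) : ℕ := {x | x ∈ DP a n ∪ DM a n ∧ nuR a n x = N}.ncard

def chiD (a n : ℕ) (k : ℕ) : ℤ := jacobiSym (k:ℤ) (DD a n)

lemma DP_norm_ge {a n : ℕ} (z : RR a n) (h : z ∈ DP a n) : z.re^2 ≤ z.norm := by
  obtain ⟨h1, h2⟩ := h
  have : 0 ≤ (a:ℤ) * (z.im * (n*z.re - z.im)) := by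
    have : 0 ≤ n*z.re - z.im := by linarith
    positivity
  rw [rr_norm]; linarith

lemma DM_norm_ge {a n : ℕ} (z : RR a n) (h : z ∈ DM a n) : a*(z.im-n*z.re)^2 ≤ -z.norm := by
  obtain ⟨h1, h2⟩ := h
  have : 0 ≤ z.re * (a*n*(z.im-n*z.re) - z.re) := by
    have : 0 ≤ (a*n*(z.im-n*z.re) - z.re) := by linarith
    positivity
  rw [rr_norm]; linarith

lemma cN_finite {a n : ℕ} (ha : 0 < a) (hn : 0 < n) (N : ℕ) : {x | x ∈ DP a n ∪ DM a n ∧ nuR a n x = N}.Finite := by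
  have hf : ((Set.Icc (0:ℤ) (N + a*n*N)) ×ˢ (Set.Icc (0:ℤ) (N + n*N+ n*(a*n*N)))).Finite :=
    (Set.finite_Icc _ _).prod (Set.finite_Icc _ _)
  refine (hf.image (fun p => (⟨p.1, p.2⟩ : RR a n))).subset ?_
  rintro z ⟨hz, hN⟩
  rw [nuR_apply] at hN
  refine ⟨(z.re, z.im), ?_, by ext <;> rfl⟩
  have p1 : (0:ℤ) ≤ a*n*N := by positivity
  have p2 : (0:ℤ) ≤ n*N := by positivity
  have p3 : (0:ℤ) ≤ n*(a*n*N) := by positivity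
  simp only [Set.mem_prod, Set.mem_Icc]
  rcases hz with hz | hz
  · have h1 := DP_norm_ge z hz
    have h2 := (DP_pos hn z hz)
    obtain ⟨h3, h4⟩ := hz
    have h5 : z.re ≤ N := by
      have : z.norm = N := by omega
      nlinarith
    have h6 : n*z.re ≤ n*N := by gcongr
    have : (0:ℤ) ≤ N := by positivity
    refine ⟨⟨?_, ?_⟩, ?_, ?_⟩ <;> linarith
  · have h1 := DM_norm_ge z hz
    have h2 := (DM_neg ha hn z hz)
    obtain ⟨h3, h4⟩ := hz
    have h0 : (1:ℤ) ≤ a := by exact_mod_cast ha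
    have h5 : z.im - n*z.re ≤ N := by
      have : -z.norm = N := by omega
      nlinarith
    have h6 : a*n*(z.im - n*z.re) ≤ a*n*N := by gcongr
    have h8 : z.re ≤ a*n*N := by linarith
    have h7 : n*z.re ≤ n*(a*n*N) := by gcongr
    have : (0:ℤ) ≤ N := by positivity
    have : (0:ℤ) ≤ n * z.re := by positivity
    refine ⟨⟨?_, ?_⟩, ?_, ?_⟩ <;> linarith

lemma DD_mod8 {a n : ℕ} (ha : Odd a) (hn : Odd n) : DD a n % 8 = 5 := by
  have h1 : a^2 % 8 = 1 := by
    have := Nat.odd_iff.1 ha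
    have : a % 8 = 1 ∨ a % 8 = 3 ∨ a % 8 = 5 ∨ a % 8 = 7 := by omega
    rcases this with h | h | h | h <;> rw [Nat.pow_mod, h]
  have h2 : n^2 % 8 = 1 := by
    have := Nat.odd_iff.1 hn
    have : n % 8 = 1 ∨ n % 8 = 3 ∨ n % 8 = 5 ∨ n % 8 = 7 := by omega
    rcases this with h | h | h | h <;> rw [Nat.pow_mod, h]
  have := Nat.odd_iff.1 ha
  have h3 : (a^2*n^2) % 8 = 1 := by rw [Nat.mul_mod, h1, h2]
  unfold DD
  omega

lemma chiD_odd {a n : ℕ} (ha : Odd a) (hn : Odd n) (p : ℕ) [Fact p.Prime] (h2 : p ≠ 2) :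
    chiD a n p = legendreSym p (DD a n) := by
  have h8 := DD_mod8 ha hn
  have hpo : Odd p := (Fact.out : p.Prime).odd_of_ne_two h2
  rw [jacobiSym.legendreSym.to_jacobiSym, jacobiSym.quadratic_reciprocity_one_mod_four (by omega) hpo, chiD]

lemma chiD_two {a n : ℕ} (ha : Odd a) (hn : Odd n) : chiD a n 2 = -1 := by
  have h8 := DD_mod8 ha hn
  have hodd : Odd (DD a n) := by rw [Nat.odd_iff]; omega
  have := jacobiSym.at_two hodd
  rw [chiD]
  push_cast
  rw [this, ZMod.χ₈_nat_mod_eight, h8]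
  decide

lemma chiD_cases {a n : ℕ} (ha : Odd a) (hn : Odd n) (p : ℕ) (hp : p.Prime) (h2 : p ≠ 2) :
    (chiD a n p = -1 ∧ ∀ x : ℤ, ¬ (p:ℤ) ∣ x^2 - DD a n) ∨ (chiD a n p = 0 ∧ p ∣ DD a n) ∨
    (chiD a n p = 1 ∧ ¬ p ∣ DD a n ∧ ∃ x : ℤ, (p:ℤ) ∣ x^2 - DD a n) := by
  haveI := Fact.mk hp
  rw [chiD_odd ha hn p h2]
  by_cases h0 : p ∣ DD a n
  · right; left
    refine ⟨?_, h0⟩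
    rw [legendreSym.eq_zero_iff]
    push_cast
    exact (ZMod.natCast_eq_zero_iff _ _).2 h0
  · have h0' : ((DD a n : ℤ) : ZMod p) ≠ 0 := by
      push_cast
      rw [Ne, ZMod.natCast_eq_zero_iff]; exact h0
    by_cases hs : IsSquare ((DD a n : ℤ) : ZMod p)
    · right; right
      refine ⟨(legendreSym.eq_one_iff p h0').2 hs, h0, ?_⟩
      obtain ⟨r, hr⟩ := hs
      obtain ⟨x, hx⟩ := ZMod.intCast_surjective r
      refine ⟨x, ?_⟩
      rw [← ZMod.intCast_zmod_eq_zero_iff_dvd]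
      push_cast at hr ⊢
      rw [hx, hr]; ring
    · left
      refine ⟨(legendreSym.eq_neg_one_iff p).2 hs, ?_⟩
      intro x hx
      rw [← ZMod.intCast_zmod_eq_zero_iff_dvd] at hx
      push_cast at hx
      apply hs
      refine ⟨x, ?_⟩
      push_cast
      linear_combination -hx

lemma cN_cases {a n : ℕ} (ha : Odd a) (hn : Odd n) [IsDomain (RR a n)] [IsPrincipalIdealRing (RR a n)]
    (p : ℕ) (hp : p.Prime) :
    (∀ M, ¬ p ∣ M → 0 < M → (cN a n (p*M) : ℤ) = (1 + chiD a n p) * cN a n M) ∧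
    (∀ N, 0 < N → (cN a n (p*(p*N)) : ℤ) = (1 + chiD a n p) * cN a n (p*N) - chiD a n p * cN a n N) := by
  have ha0 : 0 < a := ha.pos
  have hn0 : 0 < n := hn.pos
  have hP0 : ∀ x ∈ DP a n ∪ DM a n, x ≠ 0 := by
    rintro x (hx | hx) rfl
    · have := (DP_pos hn0 _ hx).2; simp at this
    · have := (DM_neg ha0 hn0 _ hx).2; simp at this
  have hrep := rr_rep (a := a) (n := n) ha0 hn0
  have hne : (p : RR a n) ≠ 0 := by
    intro h
    have := nuR_cast (a := a) (n := n) p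
    rw [h, nuR_apply] at this
    simp at this
    exact hp.ne_zero this
  have hpp : nuR a n (p : RR a n) ≠ 0 := by
    rw [nuR_cast]; have := hp.ne_zero; positivity
  have inert : (∀ y : RR a n, p ∣ nuR a n y → (p : RR a n) ∣ y) → chiD a n p = -1 → 
    (∀ M, ¬ p ∣ M → 0 < M → (cN a n (p*M) : ℤ) = (1 + chiD a n p) * cN a n M) ∧
    (∀ N, 0 < N → (cN a n (p*(p*N)) : ℤ) = (1 + chiD a n p) * cN a n (p*N) - chiD a n p * cN a n N) := by
    intro h1 h2
    rw [h2]
    refine ⟨?_, ?_⟩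
    · intro M hM _
      have := count_inert1 (DP a n ∪ DM a n) (nuR a n) (p : RR a n) p M hp hM (nuR_cast p) h1
      rw [cN, this]; simp
    · intro N _
      have := count_all (HH a n) (DP a n ∪ DM a n) hP0 hrep (nuR a n) nuR_unit (p : RR a n) hne hpp (by
        intro y hy
        rw [nuR_cast] at hy
        exact h1 y ((Dvd.intro _ rfl).trans hy)) N
      rw [nuR_cast, mul_assoc] at this
      rw [cN, this, ← cN]; ring
  by_cases h2 : p = 2
  · subst h2
    exact inert (rr_inert_two ha hn) (chiD_two ha hn)
  rcases chiD_cases ha hn p hp h2 with ⟨hc, h⟩ | ⟨hc, h⟩ | ⟨hc, hd, x, hx⟩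
  · exact inert (rr_inert_odd p hp h2 h) hc
  · obtain ⟨π, hπ⟩ := rr_exists_pi p hp h2 0 (by
      have : (p:ℤ) ∣ DD a n := by exact_mod_cast h
      simpa using this)
    have hall : ∀ N, cN a n (p*N) = cN a n N := by
      intro N
      have := count_all (HH a n) (DP a n ∪ DM a n) hP0 hrep (nuR a n) nuR_unit π (rr_prime_of_nu p hp π hπ).ne_zero (by
        rw [hπ]; exact hp.ne_zero) (by rw [hπ]; exact rr_ramified p hp h2 h π hπ) N
      rw [hπ] at this
      exact this
    rw [hc]
    refine ⟨fun M _ _ => by rw [hall]; ring, fun N _ => by rw [hall]; ring⟩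
  · obtain ⟨π, hπ⟩ := rr_exists_pi p hp h2 x hx
    have hπ' : nuR a n (star π) = p := by rw [rr_nu_star, hπ]
    have hs := count_split (HH a n) (DP a n ∪ DM a n) hP0 hrep (nuR a n) nuR_unit (fun N _ => cN_finite ha0 hn0 N)
      π (star π) (p : RR a n) p hp.ne_zero (rr_prime_of_nu p hp π hπ).ne_zero (rr_prime_of_nu p hp _ hπ').ne_zero hπ hπ'
      (rr_or p hp π hπ) (rr_split p hp h2 hd π hπ)
    rw [hc]
    refine ⟨?_, ?_⟩
    · intro M hM hM0
      have h1 := hs M hM0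
      have : {x | (x ∈ DP a n ∪ DM a n ∧ nuR a n x = p * M) ∧ (p : RR a n) ∣ x} = ∅ := by
        ext y
        simp only [Set.mem_ofPred_eq, Set.mem_empty_iff_false, iff_false]
        rintro ⟨⟨_, h⟩, z, rfl⟩
        rw [map_mul, nuR_cast, mul_assoc] at h
        exact hM ⟨_, (Nat.eq_of_mul_eq_mul_left hp.pos h).symm⟩
      rw [this, Set.ncard_empty, add_zero] at h1
      rw [cN, h1, cN]; push_cast; ring
    · intro N hN
      have h1 := hs (p*N) (by have := hp.pos; positivity)
      have h3 := ncard_dvd (HH a n) (DP a n ∪ DM a n) hP0 hrep (nuR a n) nuR_unit (p : RR a n) hne hpp N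
      rw [nuR_cast, mul_assoc] at h3
      rw [h3] at h1
      rw [← cN, ← cN, ← cN] at h1
      have h1' : (cN a n (p*(p*N)) : ℤ) + cN a n N = 2 * cN a n (p*N) := by exact_mod_cast h1
      linear_combination h1'

theorem cN_eq {a n : ℕ} (ha : Odd a) (hn : Odd n) [IsDomain (RR a n)] [IsPrincipalIdealRing (RR a n)] (N : ℕ) (hN : 0 < N) :
    (cN a n N : ℤ) = cN a n 1 * ∑ k ∈ N.divisors, chiD a n k := by
  refine rec_all (fun N => (cN a n N : ℤ)) (chiD a n) ?_ ?_ ?_ ?_ N hN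
  · intro m k
    simp only [chiD]
    push_cast
    exact jacobiSym.mul_left _ _ _
  · simp [chiD]
  · intro p M hp hM hM0
    exact (cN_cases ha hn p hp).1 M hM hM0
  · intro p N hp hN
    exact (cN_cases ha hn p hp).2 N hN

lemma cN_one_pos {a n : ℕ} (ha : 0 < a) (hn : 0 < n) : 0 < cN a n 1 := by
  rw [cN, Set.ncard_pos (cN_finite ha hn 1)]
  refine ⟨1, Or.inl ⟨?_, ?_⟩, by simp⟩
  · simp [QuadraticAlgebra.im_one]
  · simp [QuadraticAlgebra.im_one, QuadraticAlgebra.re_one, hn]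


lemma inert_small {a n : ℕ} (ha : Odd a) (hn : Odd n) [IsDomain (RR a n)] [IsPrincipalIdealRing (RR a n)]
    (p : ℕ) (hp : p.Prime) (h2 : p ≠ 2) (hpa : p ≠ a) (hs : 3*p ≤ 2*(a*n)) : ∀ x : ℤ, ¬ (p:ℤ) ∣ x^2 - DD a n := by
  have ha0 : 0 < a := ha.pos
  have hn0 : 0 < n := hn.pos
  rcases chiD_cases ha hn p hp h2 with ⟨hc, h⟩ | h
  · exact h
  exfalso
  have hc : 0 ≤ chiD a n p := by
    rcases h with h | h <;> rw [h.1] <;> norm_num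
  have h1 := cN_eq ha hn p hp.pos
  rw [hp.sum_divisors] at h1
  have h3 : chiD a n 1 = 1 := by simp [chiD]
  have h4 := cN_one_pos ha0 hn0
  have h5 : 0 < cN a n p := by
    have : (0:ℤ) < cN a n p := by
      rw [h1, h3]; positivity
    exact_mod_cast this
  rw [cN, Set.ncard_pos (cN_finite ha0 hn0 p)] at h5
  obtain ⟨z, hz, hν⟩ := h5
  rw [nuR_apply] at hν
  have haZ : (1:ℤ) ≤ a := by exact_mod_cast ha0
  have hnZ : (1:ℤ) ≤ n := by exact_mod_cast hn0
  have hsZ : 3*(p:ℤ) ≤ 2*(a*n) := by exact_mod_cast hs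
  have hanZ : (1:ℤ) ≤ a*n := by nlinarith
  rcases hz with hz | hz
  · obtain ⟨h6, h7⟩ := DP_pos hn0 z hz
    obtain ⟨h8, h9⟩ := hz
    have hN : z.re^2 + a*(z.im*(n*z.re-z.im)) = p := by
      have : z.norm = p := by omega
      rw [← this, rr_norm]; ring
    generalize z.re = u at *
    generalize z.im = v at *
    by_cases hv : v = 0
    · subst hv
      have : u.natAbs^2 = p := by
        zify; rw [sq_abs]; linarith
      rw [← this] at hp
      exact Nat.Prime.not_prime_pow le_rfl hp
    have hv1 : 1 ≤ v := by omega
    have h10 : n*u - 1 ≤ v*(n*u-v) := by nlinarith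
    have h11 : a*(n*u-1) ≤ a*(v*(n*u-v)) := by gcongr
    by_cases hu : u = 1
    · subst hu
      have : n = 1 ∨ 3 ≤ n := by
        have := Nat.odd_iff.1 hn; omega
      rcases this with h | h
      · subst h; push_cast at *; omega
      · have : (3:ℤ) ≤ n := by exact_mod_cast h
        nlinarith
    · have : 2 ≤ u := by omega
      nlinarith [mul_le_mul_of_nonneg_left this (show (0:ℤ) ≤ a*n by positivity)]
  · obtain ⟨h6, h7⟩ := DM_neg ha0 hn0 z hz
    obtain ⟨h8, h9⟩ := hz
    have hN : a*(z.im-n*z.re)^2 + z.re*(a*n*(z.im-n*z.re)-z.re) = p := by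
      have : -z.norm = p := by omega
      rw [← this, rr_norm]; ring
    generalize z.im-n*z.re = u at *
    generalize z.re = v at *
    by_cases hv : v = 0
    · subst hv
      have h12 : a*(u.natAbs^2) = p := by
        zify; rw [sq_abs]; linarith
      rw [← h12] at hp
      rcases Nat.prime_mul_iff.1 hp with h | h
      · apply hpa; rw [← h12, h.2, mul_one]
      · exact Nat.Prime.not_prime_pow le_rfl h.1
    have hv1 : 1 ≤ v := by omega
    have h10 : a*n*u - 1 ≤ v*(a*n*u-v) := by nlinarith
    have h13 : a*n ≤ a*n*u := by nlinarith
    nlinarith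

lemma rat_sq_int (D : ℕ) (hsf : Squarefree D) (s : ℚ) (k : ℤ) (h : D * s^2 = k) : ∃ m : ℤ, s = m := by
  have hden : (s.den:ℚ) ≠ 0 := by exact_mod_cast s.den_ne_zero
  have h1 : (D:ℚ) * (s.num:ℚ)^2 = k * (s.den:ℚ)^2 := by
    rw [← Rat.mul_den_eq_num s, ← h]; ring
  have h2 : (D:ℤ) * s.num^2 = k * (s.den:ℤ)^2 := by exact_mod_cast h1
  have hcop : IsCoprime ((s.den:ℤ)^2) (s.num^2) := by
    apply IsCoprime.pow
    rw [Int.isCoprime_iff_gcd_eq_one, Int.gcd_comm]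
    exact s.reduced
  have h3 : ((s.den:ℤ)^2) ∣ D := by
    apply hcop.dvd_of_dvd_mul_right
    exact ⟨k, by rw [h2]; ring⟩
  have h4 : s.den * s.den ∣ D := by
    rw [← sq]; exact_mod_cast h3
  have h5 := Nat.isUnit_iff.1 (hsf _ h4)
  exact ⟨s.num, (Rat.den_eq_one_iff _).1 h5 |>.symm⟩

lemma rr_equiv (a n : ℕ) (ha : Odd a) (hn : Odd n) (hsf : Squarefree (DD a n)) (K : Type) [Field K] [NumberField K]
    (hdeg : Module.finrank ℚ K = 2) (α : K) (hα : α^2 = (DD a n : K)) : Nonempty (RR a n ≃+* NumberField.RingOfIntegers K) := by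
  have h8 := DD_mod8 ha hn
  have hirr : ∀ q : ℚ, (q:K) ≠ α := by
    intro q hq
    rw [← hq] at hα
    have h1 : q^2 = (DD a n : ℚ) := by exact_mod_cast hα
    have h2 : IsSquare (DD a n) := by
      rw [← Rat.isSquare_natCast_iff]
      exact ⟨q, by rw [← h1, sq]⟩
    obtain ⟨k, hk⟩ := h2
    have h3 := Nat.isUnit_iff.1 (hsf k ⟨1, by rw [hk]; ring⟩)
    rw [h3] at hk
    omega
  have hαD : α^2 = (a:K)^2*n^2+4*a := by
    rw [hα]; simp [DD]
  set w : K := ((a:K)*n + α)/2 with hw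
  have hww : w * w = a + a * n * w := by
    rw [hw]; field_simp; linear_combination hαD
  let ψ : QuadraticAlgebra ℚ (a:ℚ) ((a:ℚ)*n) →ₐ[ℚ] K := QuadraticAlgebra.lift ⟨w, by
    rw [hww]; simp [Algebra.smul_def]⟩
  have hψ : ∀ z, ψ z = (z.re:K) + (z.im:K) * w := by
    intro z
    simp [ψ, Algebra.smul_def]
  let φ : RR a n →ₐ[ℤ] K := QuadraticAlgebra.lift ⟨w, by
    rw [hww]; simp [Algebra.smul_def]⟩
  have hφ : ∀ z, φ z = (z.re:K) + (z.im:K) * w := by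
    intro z
    simp [φ, Algebra.smul_def]
  have hψinj : Function.Injective ψ := by
    rw [injective_iff_map_eq_zero]
    intro z hz
    rw [hψ] at hz
    have him : z.im = 0 := by
      by_contra hne
      have hne' : (z.im : K) ≠ 0 := by exact_mod_cast hne
      apply hirr (-(2*z.re/z.im) - a*n)
      push_cast
      field_simp
      rw [hw] at hz
      linear_combination (-2)*hz
    rw [him] at hz
    have hre : z.re = 0 := by
      have : (z.re:K) = 0 := by simpa using hz
      exact_mod_cast this
    ext <;> simp [him, hre]
  have hψsurj : Function.Surjective ψ := by
    have hf : Module.finrank ℚ (QuadraticAlgebra ℚ (a:ℚ) ((a:ℚ)*n)) = Module.finrank ℚ K := by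
      rw [hdeg, QuadraticAlgebra.finrank_eq_two]
    exact (LinearMap.injective_iff_surjective_of_finrank_eq_finrank (f := ψ.toLinearMap) hf).1 hψinj
  have hIntegral : ∀ z, IsIntegral ℤ (φ z) := by
    intro z
    exact (Algebra.IsIntegral.isIntegral (R := ℤ) z).map φ
  have hφinj : Function.Injective φ := by
    rw [injective_iff_map_eq_zero]
    intro z hz
    have h1 : ψ ⟨z.re, z.im⟩ = 0 := by
      rw [hψ, ← hz, hφ]; simp
    have h2 := (injective_iff_map_eq_zero ψ).1 hψinj _ h1
    have h3 := congrArg QuadraticAlgebra.re h2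
    have h4 := congrArg QuadraticAlgebra.im h2
    simp at h3 h4
    ext <;> simp [h3, h4]
  have hsurj : ∀ y : K, IsIntegral ℤ y → ∃ z, φ z = y := by
    intro y hy
    obtain ⟨z, rfl⟩ := hψsurj y
    have hz : IsIntegral ℤ z := (isIntegral_algHom_iff (ψ.restrictScalars ℤ) hψinj).1 hy
    have hzs : IsIntegral ℤ (star z) := hz.map (starRingEnd (QuadraticAlgebra ℚ (a:ℚ) ((a:ℚ)*n))).toIntAlgHom
    have hinj : Function.Injective (algebraMap ℚ (QuadraticAlgebra ℚ (a:ℚ) ((a:ℚ)*n))) := by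
      intro x y hxy
      have := congrArg QuadraticAlgebra.re hxy
      simpa using this
    have htr : ∃ t : ℤ, 2*z.re + a*n*z.im = t := by
      have h1 : IsIntegral ℤ (algebraMap ℚ (QuadraticAlgebra ℚ (a:ℚ) ((a:ℚ)*n)) (2*z.re + a*n*z.im)) := by
        have := hz.add hzs
        convert this using 1
        ext <;> simp
        ring
      rw [isIntegral_algebraMap_iff hinj] at h1
      obtain ⟨t, ht⟩ := (IsIntegrallyClosed.isIntegral_iff).1 h1
      exact ⟨t, by rw [← ht]; simp⟩
    have hno : ∃ t : ℤ, z.re^2 + a*n*z.re*z.im - a*z.im^2 = t := by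
      have h1 : IsIntegral ℤ (algebraMap ℚ (QuadraticAlgebra ℚ (a:ℚ) ((a:ℚ)*n)) z.norm) := by
        rw [QuadraticAlgebra.algebraMap_norm_eq_mul_star]
        exact hz.mul hzs
      rw [isIntegral_algebraMap_iff hinj] at h1
      obtain ⟨t, ht⟩ := (IsIntegrallyClosed.isIntegral_iff).1 h1
      refine ⟨t, ?_⟩
      rw [QuadraticAlgebra.norm_def] at ht
      simp at ht
      rw [ht]; ring
    obtain ⟨t, ht⟩ := htr
    obtain ⟨k, hk⟩ := hno
    obtain ⟨s, hs⟩ := rat_sq_int (DD a n) hsf z.im (t^2 - 4*k) (by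
      push_cast
      rw [← ht, ← hk]
      simp [DD]; ring)
    have hr : ∃ r : ℤ, z.re = r := by
      rw [hs] at ht hk
      have h1 : (2*z.re) = ((t - a*n*s : ℤ) : ℚ) := by
        push_cast; linarith
      set e : ℤ := t - a*n*s with he
      have h2 : (e:ℚ)^2 + 2*a*n*e*s - 4*a*s^2 = 4*k := by
        rw [← h1, ← hk]; ring
      have h3 : e^2 + 2*a*n*e*s - 4*a*s^2 = 4*k := by exact_mod_cast h2
      have h4 : Even e := by
        have : Even (e^2) := ⟨2*k+2*a*s^2-a*n*e*s, by linarith⟩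
        exact (Int.even_pow.1 this).1
      obtain ⟨r, hr⟩ := h4
      refine ⟨r, ?_⟩
      rw [hr] at h1
      push_cast at h1
      linarith
    obtain ⟨r, hr⟩ := hr
    exact ⟨⟨r, s⟩, by rw [hφ, hψ, hr, hs]; simp⟩
  let Φ : RR a n →+* NumberField.RingOfIntegers K := (φ.toRingHom).codRestrict (integralClosure ℤ K) hIntegral
  refine ⟨RingEquiv.ofBijective Φ ⟨?_, ?_⟩⟩
  · intro x y hxy
    apply hφinj
    exact congrArg (fun t : NumberField.RingOfIntegers K => (t:K)) hxy
  · rintro ⟨y, hy⟩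
    obtain ⟨z, hz⟩ := hsurj y hy
    refine ⟨z, ?_⟩
    apply NumberField.RingOfIntegers.ext
    exact hz


lemma hasSum_congr' {f g : ℕ → ℝ} {s : ℝ} (h : HasSum f s) (hfg : ∀ N, g N = f N) : HasSum g s := by
  rw [funext hfg]; exact h

lemma hasSum_fib (S : Set (ℕ × ℕ)) (g : ℕ × ℕ → ℕ) (F : ℕ → ℝ) (T : ℕ × ℕ → ℝ)
    (hT : ∀ p ∈ S, T p = F (g p)) (hT' : ∀ p, p ∉ S → T p = 0) (hs : Summable T) :
    HasSum (fun N => ({p | p ∈ S ∧ g p = N}.ncard : ℝ) * F N) (∑' p, T p) := by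
  have h := hs.hasSum.tsum_fiberwise g
  refine hasSum_congr' h (fun N => ?_)
  rw [tsum_subtype (g ⁻¹' {N}) T]
  have : (g ⁻¹' {N}).indicator T = ({p | p ∈ S ∧ g p = N}).indicator (fun _ => F N) := by
    ext p
    by_cases h1 : p ∈ S <;> by_cases h2 : g p = N
    · simp [Set.indicator, h1, h2, hT]
    · simp [Set.indicator, h1, h2]
    · simp [Set.indicator, h1, h2, hT']
    · simp [Set.indicator, h1, h2]
  rw [this, ← tsum_subtype, tsum_const]
  simp [Set.ncard]

noncomputable def ccount (A E L N : ℕ) : ℕ :=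
  {p : ℕ × ℕ | p ∈ {p : ℕ × ℕ | p.2 < L*(p.1+1)} ∧ A*(p.1+1)^2+E*p.2*(L*(p.1+1)-p.2) = N}.ncard

lemma cone_hasSum (q A E L : ℕ) [NeZero q] (hA : 0 < A) (f : ZMod q → ℤ) (τ : ℝ) (hτ : 0 < τ) :
    HasSum (fun N : ℕ => (ccount A E L N : ℝ) * (f N * Real.exp (-(τ^2*N)))) (∑' p, coneTerm q A E L f τ p) := by
  refine hasSum_fib {p : ℕ × ℕ | p.2 < L*(p.1+1)} (fun p => A*(p.1+1)^2+E*p.2*(L*(p.1+1)-p.2))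
    (fun N => f N * Real.exp (-(τ^2*N))) _ ?_ ?_ (cone_summable' q A E L hA f τ hτ)
  · intro p hp
    have hp' : p.2 < L*(p.1+1) := hp
    rw [coneTerm, if_pos hp', gM]
    push_cast [Nat.cast_sub hp'.le]
    rfl
  · intro p hp
    have hp' : ¬ p.2 < L*(p.1+1) := hp
    rw [coneTerm, if_neg hp']

lemma dir_hasSum (q D : ℕ) [NeZero q] [NeZero D] (χ : ZMod D → ℤ) (f : ZMod q → ℤ) (hf : f 0 = 0) (t : ℝ) (ht : 0 < t) :
    HasSum (fun N : ℕ => ((∑ k ∈ N.divisors, χ k : ℤ) : ℝ) * (f N * Real.exp (-(t*N)))) (∑' p, dirTerm q D χ f t p) := by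
  have h := (dir_summable q D χ f t ht).hasSum.tsum_fiberwise (fun p : ℕ × ℕ => (p.1+1)*(p.2+1))
  refine hasSum_congr' h (fun N => ?_)
  set F : ℝ := f N * Real.exp (-(t*N)) with hF
  let e : ℕ × ℕ ↪ ℕ × ℕ := ⟨fun p => (p.1+1, p.2+1), fun p q h => by
    simp at h; ext <;> simp [h]⟩
  have h1 : ∀ b : (fun p : ℕ × ℕ => (p.1+1)*(p.2+1)) ⁻¹' {N}, dirTerm q D χ f t b = (fun p : ℕ × ℕ => (χ (p.1+1) : ℝ) * F) b := by
    rintro ⟨p, hp⟩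
    have hp' : (p.1+1)*(p.2+1) = N := hp
    have hpR : ((p.1:ℝ)+1)*(p.2+1) = N := by exact_mod_cast hp'
    have hpZ : ((p.1:ZMod q)+1)*(p.2+1) = N := by exact_mod_cast congrArg (Nat.cast : ℕ → ZMod q) hp'
    simp only [dirTerm, hF, hpR, hpZ]; ring
  rw [tsum_congr h1]
  by_cases hN : N = 0
  · subst hN
    have : F = 0 := by simp [hF, hf]
    simp [this]
  have h2 : ((fun p : ℕ × ℕ => (p.1+1)*(p.2+1)) ⁻¹' {N}) = ((N.divisorsAntidiagonal.image (fun x => (x.1-1,x.2-1)) : Finset (ℕ×ℕ)) : Set (ℕ × ℕ)) := by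
    ext ⟨x, y⟩
    simp only [Set.mem_preimage, Set.mem_singleton_iff, Finset.coe_image, Set.mem_image, Finset.mem_coe, Nat.mem_divisorsAntidiagonal]
    constructor
    · intro h
      exact ⟨(x+1,y+1), ⟨h, hN⟩, by simp⟩
    · rintro ⟨⟨x', y'⟩, ⟨h, _⟩, h'⟩
      simp at h' h
      have hx : x' ≠ 0 := by rintro rfl; simp at h; exact hN h.symm
      have hy : y' ≠ 0 := by rintro rfl; simp at h; exact hN h.symm
      rw [← h'.1, ← h'.2, Nat.sub_add_cancel (by omega), Nat.sub_add_cancel (by omega), h]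
  rw [h2, Finset.tsum_subtype' _ (fun p : ℕ × ℕ => (χ (p.1+1) : ℝ) * F), Finset.sum_image]
  · rw [Nat.sum_divisorsAntidiagonal (f := fun k _ => (χ (((k-1 : ℕ):ZMod D)+1) : ℝ) * F)]
    push_cast
    rw [Finset.sum_mul]
    apply Finset.sum_congr rfl
    intro k hk
    have : 0 < k := Nat.pos_of_mem_divisors hk
    congr 3
    have : ((k-1+1 : ℕ) : ZMod D) = k := by congr 1; omega
    rw [← this]; push_cast; rfl
  · rintro ⟨x, y⟩ h ⟨x', y'⟩ h' he
    simp [Nat.mem_divisorsAntidiagonal] at h h' he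
    have hx : x ≠ 0 := by rintro rfl; simp at h; exact hN h.1.symm
    have hy : y ≠ 0 := by rintro rfl; simp at h; exact hN h.1.symm
    have hx' : x' ≠ 0 := by rintro rfl; simp at h'; exact hN h'.1.symm
    have hy' : y' ≠ 0 := by rintro rfl; simp at h'; exact hN h'.1.symm
    ext <;> simp <;> omega

lemma cN_cones {a n : ℕ} (ha : 0 < a) (hn : 0 < n) (N : ℕ) :
    cN a n N = ccount 1 a n N + ccount a 1 (a*n) N := by
  have hsplit : {x | x ∈ DP a n ∪ DM a n ∧ nuR a n x = N} = {x | x ∈ DP a n ∧ nuR a n x = N} ∪ {x | x ∈ DM a n ∧ nuR a n x = N} := by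
    ext x; simp only [Set.mem_ofPred_eq, Set.mem_union]; tauto
  rw [cN, hsplit, Set.ncard_union_eq (hs := (cN_finite ha hn N).subset (fun x hx => ⟨Or.inl hx.1, hx.2⟩)) (ht := (cN_finite ha hn N).subset (fun x hx => ⟨Or.inr hx.1, hx.2⟩))]
  rotate_left
  · rw [Set.disjoint_left]
    rintro x ⟨h1, _⟩ ⟨h2, _⟩
    have := (DP_pos hn x h1).2
    have := (DM_neg ha hn x h2).2
    omega
  congr 1
  · symm
    refine Set.ncard_congr (fun p _ => (⟨p.1+1, p.2⟩ : RR a n)) ?_ ?_ ?_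
    · rintro p ⟨h1, h2⟩
      have h1' : p.2 < n*(p.1+1) := h1
      refine ⟨⟨by simp, ?_⟩, ?_⟩
      · show (p.2:ℤ) < n*((p.1:ℤ)+1)
        exact_mod_cast h1'
      · rw [nuR_apply, rr_norm]
        rw [← h2]
        zify
        rw [Nat.cast_sub h1'.le]
        have hpos : (0:ℤ) ≤ n*(p.1+1) - p.2 := by
          have : (p.2:ℤ) < n*((p.1:ℤ)+1) := by exact_mod_cast h1'
          linarith
        rw [abs_of_nonneg]
        · push_cast; ring
        · have : (0:ℤ) ≤ (p.1+1)^2+a*p.2*(n*(p.1+1) - p.2) := by positivity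
          linarith
    · rintro ⟨x, y⟩ ⟨x', y'⟩ _ _ h
      simp [QuadraticAlgebra.ext_iff] at h
      ext <;> simp [h]
    · rintro z ⟨hz, hν⟩
      have h1 := (DP_pos hn z hz).1
      have h2 := DP_norm_ge z hz
      obtain ⟨h3, h4⟩ := hz
      obtain ⟨x, hx⟩ := Int.eq_ofNat_of_zero_le (show 0 ≤ z.re - 1 by omega)
      obtain ⟨y, hy⟩ := Int.eq_ofNat_of_zero_le h3
      have hx' : z.re = x + 1 := by omega
      refine ⟨(x, y), ⟨?_, ?_⟩, ?_⟩
      · show y < n*(x+1)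
        rw [hx', hy] at h4
        exact_mod_cast h4
      · rw [← hν, nuR_apply]
        have h4' : y < n*(x+1) := by
          rw [hx', hy] at h4
          exact_mod_cast h4
        zify
        rw [Nat.cast_sub h4'.le, abs_of_nonneg (by nlinarith), rr_norm, hx', hy]
        push_cast; ring
      · ext
        · exact hx'.symm
        · exact hy.symm
  · symm
    refine Set.ncard_congr (fun p _ => (⟨p.2, p.1+1+n*p.2⟩ : RR a n)) ?_ ?_ ?_
    · rintro p ⟨h1, h2⟩
      have h1' : p.2 < a*n*(p.1+1) := h1
      have h1'' : (p.2:ℤ) < a*n*((p.1:ℤ)+1) := by exact_mod_cast h1'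
      have hmem : (⟨p.2, p.1+1+n*p.2⟩ : RR a n) ∈ DM a n := by
        refine ⟨by simp, ?_⟩
        dsimp only
        linarith
      refine ⟨hmem, ?_⟩
      · have h3 := (DM_neg ha hn _ hmem).2
        rw [nuR_apply]
        rw [← h2]
        zify
        rw [Nat.cast_sub h1'.le]
        rw [abs_of_neg h3, rr_norm]
        push_cast; ring
    · rintro ⟨x, y⟩ ⟨x', y'⟩ _ _ h
      simp [QuadraticAlgebra.ext_iff] at h
      obtain ⟨h1, h2⟩ := h
      subst h1
      ext <;> simp
      omega
    · rintro z ⟨hz, hν⟩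
      obtain ⟨h1, h2⟩ := (DM_neg ha hn z hz)
      obtain ⟨h3, h4⟩ := hz
      obtain ⟨x, hx⟩ := Int.eq_ofNat_of_zero_le (show 0 ≤ z.im - n*z.re - 1 by omega)
      obtain ⟨y, hy⟩ := Int.eq_ofNat_of_zero_le h3
      have hx' : z.im = x + 1 + n*y := by rw [hy] at hx; omega
      have h4' : y < a*n*(x+1) := by
        rw [hx', hy] at h4
        have : (y:ℤ) < a*n*(x+1) := by linarith
        exact_mod_cast this
      refine ⟨(x, y), ⟨?_, ?_⟩, ?_⟩
      · exact h4'
      · rw [← hν, nuR_apply]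
        zify
        rw [Nat.cast_sub h4'.le, abs_of_neg h2, rr_norm, hx', hy]
        push_cast; ring
      · ext
        · exact hy.symm
        · exact hx'.symm


def chiZ (a n : ℕ) (x : ZMod (DD a n)) : ℤ := jacobiSym (x.val:ℤ) (DD a n)

lemma chiZ_cast (a n : ℕ) (k : ℕ) : chiZ a n k = chiD a n k := by
  unfold chiZ chiD
  rw [ZMod.val_natCast, Int.natCast_mod, ← jacobiSym.mod_left]

lemma chiZ_neg {a n : ℕ} (ha : Odd a) (hn : Odd n) (x : ZMod (DD a n)) : chiZ a n (-x) = chiZ a n x := by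
  have h8 := DD_mod8 ha hn
  have : NeZero (DD a n) := ⟨by omega⟩
  have hodd : Odd (DD a n) := by rw [Nat.odd_iff]; omega
  unfold chiZ
  have h1 : jacobiSym ((-x).val : ℤ) (DD a n) = jacobiSym (-(x.val : ℤ)) (DD a n) := by
    rw [jacobiSym.mod_left ((-x).val : ℤ), jacobiSym.mod_left (-(x.val : ℤ))]
    congr 1
    have : (((-x).val : ℤ) : ZMod (DD a n)) = ((-(x.val : ℤ) : ℤ) : ZMod (DD a n)) := by
      push_cast; simp
    exact (ZMod.intCast_eq_intCast_iff _ _ _).1 this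
  rw [h1, jacobiSym.neg _ hodd, ZMod.χ₄_nat_one_mod_four (by omega), one_mul]

def Nq (a n q : ℕ) (u v : ZMod q) : ZMod q := u^2 + a*n*u*v - a*v^2

theorem core_id {a n : ℕ} (ha : Odd a) (hn : Odd n) [IsDomain (RR a n)] [IsPrincipalIdealRing (RR a n)]
    (q : ℕ) [NeZero q] (f : ZMod q → ℤ) (hf : ∀ x, f (-x) = - f x)
    (hW : ∑ u, ∑ v, f (Nq a n q u v) = 0) :
    (cN a n 1 : ℤ) * ∑ k ∈ Finset.range (q * DD a n), ∑ m ∈ Finset.range q, (m:ℤ)*k*chiD a n k*f (k*m)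
     = DD a n * ∑ u, ∑ v, f (Nq a n q u v) * (b1 u * b1 v + a*n*b2 v - n*b2 u) := by
  have ha0 : 0 < a := ha.pos
  have hn0 : 0 < n := hn.pos
  have h8 := DD_mod8 ha hn
  have : NeZero (DD a n) := ⟨by omega⟩
  have hf0 := f_zero f hf
  have g1 : ∀ u v, gM q 1 a n f u v = f (Nq a n q u v) := by
    intro u v
    simp only [gM, Nq]; congr 2; push_cast; ring
  have g2 : ∀ u v, gM q a 1 (a*n) f u v = - f (Nq a n q v (-u)) := by
    intro u v
    simp only [gM, Nq]; rw [← Int.cast_neg, ← hf]; congr 2; push_cast; ring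
  have swap : ∀ F : ZMod q → ZMod q → ℝ, ∑ u, ∑ v, F v (-u) = ∑ u, ∑ v, F u v := by
    intro F
    rw [Finset.sum_comm]
    apply Finset.sum_congr rfl
    intro u _
    exact Equiv.sum_comp (Equiv.neg (ZMod q)) (fun v => F u v)
  have hWR : ∑ u, ∑ v, (f (Nq a n q u v) : ℝ) = 0 := by exact_mod_cast hW
  have l1 := cone_limit q 1 a n one_pos f hf0 (by simp only [g1]; exact hWR)
  have l2 := cone_limit q a 1 (a*n) ha0 f hf0 (by
    simp only [g2, Finset.sum_neg_distrib]
    rw [swap (fun u v => (f (Nq a n q u v) : ℝ)), hWR, neg_zero])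
  have l3 := dir_limit q (DD a n) (chiZ a n) (chiZ_neg ha hn) f hf
  have hsq : Tendsto (fun τ : ℝ => τ^2) (𝓝[>] 0) (𝓝[>] 0) := by
    apply tendsto_nhdsWithin_of_tendsto_nhds_of_eventually_within
    · have : Tendsto (fun τ : ℝ => τ^2) (𝓝 0) (𝓝 (0^2)) := (continuous_pow 2).tendsto 0
      simp at this
      exact this.mono_left nhdsWithin_le_nhds
    · filter_upwards [self_mem_nhdsWithin] with τ hτ
      have : (0:ℝ) < τ := hτ
      show (0:ℝ) < τ^2
      positivity
  have l3' := (l3.comp hsq).const_mul (cN a n 1 : ℝ)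
  have l12 := l1.add l2
  have heq : ∀ τ : ℝ, 0 < τ → (∑' p, coneTerm q 1 a n f τ p) + (∑' p, coneTerm q a 1 (a*n) f τ p) =
      (cN a n 1 : ℝ) * ∑' p, dirTerm q (DD a n) (chiZ a n) f (τ^2) p := by
    intro τ hτ
    have s1 := (cone_hasSum q 1 a n one_pos f τ hτ).add (cone_hasSum q a 1 (a*n) ha0 f τ hτ)
    have s2 := (dir_hasSum q (DD a n) (chiZ a n) f hf0 (τ^2) (by positivity)).mul_left (cN a n 1 : ℝ)
    refine HasSum.unique (hasSum_congr' s1 ?_) s2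
    intro N
    rw [← add_mul, ← mul_assoc]
    by_cases hN : N = 0
    · subst hN; simp [hf0]
    congr 1
    have h1 := cN_eq ha hn N (Nat.pos_of_ne_zero hN)
    have h2 := cN_cones ha0 hn0 N
    simp only [chiZ_cast]
    rw [← Nat.cast_add, ← h2]
    exact_mod_cast h1.symm
  have l12' := l12.congr' (f₂ := fun τ : ℝ => (cN a n 1 : ℝ) * ∑' p, dirTerm q (DD a n) (chiZ a n) f (τ^2) p) (by
    filter_upwards [self_mem_nhdsWithin] with τ hτ
    exact heq τ hτ)
  have hu := tendsto_nhds_unique l12' l3'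
  simp only [g1, g2, chiZ_cast] at hu
  have hsw : ∑ u, ∑ v, -(f (Nq a n q v (-u)):ℝ) * ((b1 u : ℝ) * b1 v + ((1:ℕ)*(a*n:ℕ)/a : ℝ) * b2 v - (a*n:ℕ) * b2 u) 
      = ∑ u, ∑ v, (f (Nq a n q u v) : ℝ) * (b1 u * b1 v + a*n*b2 v - n*b2 u) := by
    rw [← swap (fun u v => (f (Nq a n q u v) : ℝ) * (b1 u * b1 v + a*n*b2 v - n*b2 u))]
    apply Finset.sum_congr rfl
    intro u _
    apply Finset.sum_congr rfl
    intro v _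
    rw [b1_neg, b2_neg]
    have : (a:ℝ) ≠ 0 := by positivity
    push_cast
    field_simp
    ring
  rw [hsw] at hu
  have hq : (q:ℝ) ≠ 0 := by exact_mod_cast NeZero.ne q
  have hD : (DD a n:ℝ) ≠ 0 := by exact_mod_cast NeZero.ne (DD a n)
  have hfin : ((cN a n 1 : ℤ):ℝ) * ((∑ k ∈ Finset.range (q * DD a n), ∑ m ∈ Finset.range q, (m:ℤ)*k*chiD a n k*f (k*m) : ℤ) : ℝ)
     = (DD a n:ℤ) * ((∑ u, ∑ v, f (Nq a n q u v) * (b1 u * b1 v + a*n*b2 v - n*b2 u) : ℤ):ℝ) := by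
    push_cast at hu ⊢
    simp only [div_one] at hu
    field_simp at hu
    linear_combination (-1/2)*hu
  exact_mod_cast hfin


/-- the existence of an element of norm `-1` modulo `q` -/
def HasM1 (a n q : ℕ) : Prop := ∃ u v : ℤ, (q:ℤ) ∣ u^2 + a*n*u*v - a*v^2 + 1

lemma hasM1_mul {a n q q' : ℕ} (hc : Nat.Coprime q q') (h : HasM1 a n q) (h' : HasM1 a n q') :
    HasM1 a n (q*q') := by
  obtain ⟨u, v, h⟩ := h
  obtain ⟨u', v', h'⟩ := h'
  have hc' : IsCoprime (q:ℤ) (q':ℤ) := Nat.isCoprime_iff_coprime.mpr hc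
  obtain ⟨s, t, hst⟩ := hc'
  refine ⟨u*(t*q') + u'*(s*q), v*(t*q')+v'*(s*q), ?_⟩
  push_cast
  apply IsCoprime.mul_dvd (Nat.isCoprime_iff_coprime.mpr hc)
  · have : (q:ℤ) ∣ (u^2 + a*n*u*v - a*v^2 + 1) := h
    have e : t*q' = 1 - s*q := by linear_combination hst
    rw [e]
    have k1 : (q:ℤ) ∣ (u*(1 - s*q) + u'*(s*q)) - u := ⟨(u'-u)*s, by ring⟩
    have k2 : (q:ℤ) ∣ (v*(1 - s*q) + v'*(s*q)) - v := ⟨(v'-v)*s, by ring⟩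
    generalize (u*(1 - s*q) + u'*(s*q)) = U at k1 ⊢
    generalize (v*(1 - s*q) + v'*(s*q)) = V at k2 ⊢
    obtain ⟨x, hx⟩ := k1
    obtain ⟨y, hy⟩ := k2
    obtain ⟨z, hz⟩ := this
    have hU : U = u + q*x := by linear_combination hx
    have hV : V = v + q*y := by linear_combination hy
    subst hU hV
    exact ⟨z + 2*u*x + q*x^2 + a*n*(u*y+x*v+q*x*y) - a*(2*v*y+q*y^2), by linear_combination hz⟩
  · have : (q':ℤ) ∣ (u'^2 + a*n*u'*v' - a*v'^2 + 1) := h'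
    have e : s*q = 1 - t*q' := by linear_combination hst
    rw [e]
    have k1 : (q':ℤ) ∣ (u*(t*q') + u'*(1-t*q')) - u' := ⟨(u-u')*t, by ring⟩
    have k2 : (q':ℤ) ∣ (v*(t*q') + v'*(1-t*q')) - v' := ⟨(v-v')*t, by ring⟩
    generalize (u*(t*q') + u'*(1-t*q')) = U at k1 ⊢
    generalize (v*(t*q') + v'*(1-t*q')) = V at k2 ⊢
    obtain ⟨x, hx⟩ := k1
    obtain ⟨y, hy⟩ := k2
    obtain ⟨z, hz⟩ := this
    have hU : U = u' + q'*x := by linear_combination hx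
    have hV : V = v' + q'*y := by linear_combination hy
    subst hU hV
    exact ⟨z + 2*u'*x + q'*x^2 + a*n*(u'*y+x*v'+q'*x*y) - a*(2*v'*y+q'*y^2), by linear_combination hz⟩

lemma hasM1_prime {a n p : ℕ} (hp : p.Prime) (h2 : p ≠ 2) (hD : ¬ p ∣ DD a n) : HasM1 a n p := by
  haveI := Fact.mk hp
  have hD' : (DD a n : ZMod p) ≠ 0 := by rwa [Ne, ZMod.natCast_eq_zero_iff]
  have h2' : (2 : ZMod p) ≠ 0 := by
    have : ((2:ℕ) : ZMod p) ≠ 0 := by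
      rw [Ne, ZMod.natCast_eq_zero_iff]
      intro h
      exact h2 ((Nat.prime_dvd_prime_iff_eq hp Nat.prime_two).mp h)
    exact_mod_cast this
  obtain ⟨x, y, hxy⟩ := FiniteField.exists_root_sum_quadratic (R := ZMod p)
    (f := Polynomial.X^2 + Polynomial.C 4) (g := Polynomial.C (-(DD a n : ZMod p)) * Polynomial.X^2)
    (by rw [Polynomial.degree_X_pow_add_C (by norm_num)]; rfl)
    (by rw [Polynomial.degree_C_mul (neg_ne_zero.mpr hD'), Polynomial.degree_X_pow]; rfl) (by
      rw [ZMod.card]; exact Nat.odd_iff.mp (hp.odd_of_ne_two h2))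
  simp at hxy
  refine ⟨((x - a*n*y)/2 : ZMod p).val, (y.val : ℤ), ?_⟩
  rw [← ZMod.intCast_zmod_eq_zero_iff_dvd]
  push_cast
  rw [ZMod.natCast_zmod_val, ZMod.natCast_zmod_val]
  unfold DD at hxy
  push_cast at hxy
  have h4 : (4 : ZMod p) ≠ 0 := by
    have : (4 : ZMod p) = 2*2 := by norm_num
    rw [this]; exact mul_ne_zero h2' h2'
  field_simp
  have : (0 : ZMod p) = (p : ZMod p) := by simp
  linear_combination hxy

lemma hasM1_four {a n : ℕ} (ha : Odd a) (hn : Odd n) : HasM1 a n 4 := by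
  have key : ∀ A B : ZMod 4, A = 1 ∨ A = 3 → B = 1 ∨ B = 3 → ∃ u v : ZMod 4, u^2 + A*B*u*v - A*v^2 + 1 = 0 := by
    decide
  have c : ∀ k : ℕ, Odd k → (k : ZMod 4) = 1 ∨ (k : ZMod 4) = 3 := by
    intro k hk
    rw [Nat.odd_iff] at hk
    have : k % 4 = 1 ∨ k % 4 = 3 := by omega
    rcases this with h | h
    · left; rw [← ZMod.natCast_mod, h]; rfl
    · right; rw [← ZMod.natCast_mod, h]; rfl
  obtain ⟨u, v, h⟩ := key a n (c a ha) (c n hn)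
  refine ⟨u.val, v.val, ?_⟩
  rw [← ZMod.intCast_zmod_eq_zero_iff_dvd]
  push_cast
  rw [ZMod.natCast_zmod_val, ZMod.natCast_zmod_val]
  exact h

def NZ {q : ℕ} (a b u v : ZMod q) : ZMod q := u^2 + a*b*u*v - a*v^2

def T1 {q r : ℕ} [NeZero q] (X : ZMod q → ZMod r) (a b : ZMod q) : ZMod r :=
  ∑ u, ∑ v, X (NZ a b u v) * ((b1 u * b1 v : ℤ) : ZMod r)
def T2 {q r : ℕ} [NeZero q] (X : ZMod q → ZMod r) (a b : ZMod q) : ZMod r :=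
  ∑ u, ∑ v, X (NZ a b u v) * ((b2 v : ℤ) : ZMod r)
def T3 {q r : ℕ} [NeZero q] (X : ZMod q → ZMod r) (a b : ZMod q) : ZMod r :=
  ∑ u, ∑ v, X (NZ a b u v) * ((b2 u : ℤ) : ZMod r)

lemma T1_neg {q r : ℕ} [NeZero q] (X : ZMod q → ZMod r) (a b : ZMod q) : T1 X a (-b) = - T1 X a b := by
  unfold T1
  rw [← Finset.sum_neg_distrib]
  apply Finset.sum_congr rfl
  intro u _
  rw [← Finset.sum_neg_distrib, ← Equiv.sum_comp (Equiv.neg (ZMod q))]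
  apply Finset.sum_congr rfl
  intro v _
  have : NZ a (-b) u (-v) = NZ a b u v := by unfold NZ; ring
  simp only [Equiv.neg_apply, this, b1_neg]
  push_cast; ring

lemma T2_neg {q r : ℕ} [NeZero q] (X : ZMod q → ZMod r) (a b : ZMod q) : T2 X a (-b) = T2 X a b := by
  unfold T2
  apply Finset.sum_congr rfl
  intro u _
  rw [← Equiv.sum_comp (Equiv.neg (ZMod q))]
  apply Finset.sum_congr rfl
  intro v _
  have : NZ a (-b) u (-v) = NZ a b u v := by unfold NZ; ring
  simp only [Equiv.neg_apply, this, b2_neg]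

lemma T23 {q r : ℕ} [NeZero q] (X : ZMod q → ZMod r) (hX : ∀ x y, X (x*y) = X x * X y) (hX1 : X (-1) = -1)
    (a b : ZMod q) (ha : IsUnit a) : T2 X a b = - X a * T3 X a b := by
  obtain ⟨w, rfl⟩ := ha
  unfold T2 T3
  rw [Finset.mul_sum, Finset.sum_comm, ← Equiv.sum_comp (Equiv.neg (ZMod q))]
  apply Finset.sum_congr rfl
  intro u _
  rw [Finset.mul_sum, ← Equiv.sum_comp (Units.mulLeft w)]
  apply Finset.sum_congr rfl
  intro v _
  have : NZ (w:ZMod q) b (w * v) (-u) = (-1) * (w * NZ (w:ZMod q) b u v) := by unfold NZ; ring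
  simp only [Equiv.neg_apply, Units.mulLeft_apply, this, b2_neg, hX, hX1]
  ring

lemma sum_odd_zero {q : ℕ} [NeZero q] (f : ZMod q → ℤ) (hf : ∀ x, f (-x) = - f x) (a b : ZMod q)
    (h : ∃ u v, NZ a b u v = -1) : ∑ u, ∑ v, f (NZ a b u v) = 0 := by
  obtain ⟨u0, v0, h0⟩ := h
  unfold NZ at h0
  let e : (ZMod q × ZMod q) ≃ (ZMod q × ZMod q) := {
    toFun := fun p => (p.1*u0 + a*p.2*v0, p.1*v0+p.2*u0+a*b*p.2*v0)
    invFun := fun p => (p.1*(-u0-a*b*v0) + a*p.2*v0, p.1*v0+p.2*(-u0-a*b*v0)+a*b*p.2*v0)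
    left_inv := by
      rintro ⟨u, v⟩
      ext
      · simp only; linear_combination (-u)*h0
      · simp only; linear_combination (-v)*h0
    right_inv := by
      rintro ⟨u, v⟩
      ext
      · simp only; linear_combination (-u)*h0
      · simp only; linear_combination (-v)*h0 }
  have h1 : ∑ p : ZMod q × ZMod q, f (NZ a b p.1 p.2) = ∑ p : ZMod q × ZMod q, - f (NZ a b p.1 p.2) := by
    rw [← Equiv.sum_comp e]
    apply Finset.sum_congr rfl
    rintro ⟨u, v⟩ _
    rw [← hf]
    congr 1
    simp only [e, Equiv.coe_fn_mk]
    unfold NZ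
    linear_combination (u^2+a*b*u*v-a*v^2)*h0
  rw [Finset.sum_neg_distrib] at h1
  rw [Fintype.sum_prod_type] at h1
  simp only at h1
  omega

theorem eqn_mod {a n : ℕ} (ha : Odd a) (hn : Odd n) [IsDomain (RR a n)] [IsPrincipalIdealRing (RR a n)]
    (q r : ℕ) [NeZero q] (hr : r.Prime) (hr2 : r ≠ 2) (hrD : ¬ r ∣ DD a n) (hqD : Nat.Coprime q (DD a n))
    (X : ZMod q → ZMod r) (hX : ∀ x y, X (x*y) = X x * X y) (hX1 : X (-1) = -1)
    (hS : ∑ m ∈ Finset.range q, (m : ZMod r) * X m = 0) (hm : HasM1 a n q) :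
    X a * T1 X (a:ZMod q) (n:ZMod q) + T2 X (a : ZMod q) (n:ZMod q) * (n * (a * X a + 1)) = 0 := by
  haveI := Fact.mk hr
  have hodd : Odd r := hr.odd_of_ne_two hr2
  have hf : ∀ x, (X (-x)).valMinAbs = - (X x).valMinAbs := by
    intro x
    have : X (-x) = - X x := by rw [← neg_one_mul, hX, hX1, neg_one_mul]
    rw [this]
    apply ZMod.valMinAbs_neg_of_ne_half
    rw [Nat.odd_iff] at hodd
    omega
  have hex : ∃ u v : ZMod q, NZ (a:ZMod q) n u v = -1 := by
    obtain ⟨u, v, h⟩ := hm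
    rw [← ZMod.intCast_zmod_eq_zero_iff_dvd] at h
    push_cast at h
    exact ⟨u, v, by unfold NZ; linear_combination h⟩
  have hW := sum_odd_zero (fun x => (X x).valMinAbs) hf (a:ZMod q) (n:ZMod q) hex
  have hc := core_id ha hn q (fun x => (X x).valMinAbs) hf hW
  have hc' := congrArg (fun z : ℤ => (z : ZMod r)) hc
  push_cast at hc'
  simp only [ZMod.coe_valMinAbs, hX] at hc'
  have hz : ∑ k ∈ Finset.range (q * DD a n), ∑ m ∈ Finset.range q, (m : ZMod r) * k * (chiD a n k : ℤ) * (X k * X m) = 0 := by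
    apply Finset.sum_eq_zero
    intro k _
    have : ∑ m ∈ Finset.range q, (m : ZMod r) * k * (chiD a n k : ℤ) * (X k * X m)
       = (k * (chiD a n k : ℤ) * X k) * ∑ m ∈ Finset.range q, (m : ZMod r) * X m := by
      rw [Finset.mul_sum]
      apply Finset.sum_congr rfl
      intro m _
      ring
    rw [this, hS, mul_zero]
  rw [hz, mul_zero] at hc'
  have hD' : (DD a n : ZMod r) ≠ 0 := by rwa [Ne, ZMod.natCast_eq_zero_iff]
  have h0 := (mul_eq_zero.mp hc'.symm).resolve_left hD'
  have h1 : T1 X (a:ZMod q) n + a*n*T2 X (a:ZMod q) n - n*T3 X (a:ZMod q) n = 0 := by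
    rw [← h0]
    unfold T1 T2 T3
    simp only [Finset.mul_sum, ← Finset.sum_add_distrib, ← Finset.sum_sub_distrib]
    apply Finset.sum_congr rfl
    intro u _
    apply Finset.sum_congr rfl
    intro v _
    have : Nq a n q u v = NZ (a:ZMod q) n u v := by unfold Nq NZ; ring
    rw [this]
    push_cast
    ring
  have hau : IsUnit (a : ZMod q) := by
    rw [ZMod.isUnit_iff_coprime]
    apply Nat.Coprime.symm
    apply Nat.Coprime.coprime_dvd_right _ hqD
    unfold DD
    exact ⟨a*n^2+4, by ring⟩
  have h2 := T23 X hX hX1 (a:ZMod q) n hau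
  linear_combination (X a) * h1 + n * h2


lemma zsum_range {q : ℕ} [NeZero q] {M : Type*} [AddCommMonoid M] (g : ZMod q → M) :
    ∑ v, g v = ∑ v ∈ Finset.range q, g (v:ℕ) := by
  symm
  apply Finset.sum_bij (fun (v:ℕ) _ => (v : ZMod q))
  · intro v _; exact Finset.mem_univ _
  · intro v hv w hw h
    rw [ZMod.natCast_eq_natCast_iff'] at h
    rwa [Nat.mod_eq_of_lt (Finset.mem_range.mp hv), Nat.mod_eq_of_lt (Finset.mem_range.mp hw)] at h
  · intro x _
    exact ⟨x.val, Finset.mem_range.mpr (ZMod.val_lt x), ZMod.natCast_zmod_val x⟩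
  · intro v _; rfl

def om (q v : ℕ) : ℕ := if 2*v = q then 1 else 2

lemma half_sum {R : Type*} [CommRing R] (q : ℕ) (hq : 1 < q) (g : ℕ → R) (h0 : g 0 = 0)
    (hs : ∀ v, 1 ≤ v → v < q → g (q - v) = g v) :
    ∑ v ∈ Finset.range q, g v = ∑ v ∈ Finset.Ico 1 (q/2+1), (om q v : R) * g v := by
  have e1 : ∑ v ∈ Finset.range q, g v = ∑ v ∈ Finset.Ico 1 q, g v := by
    rw [Finset.range_eq_Ico, Finset.sum_eq_sum_Ico_succ_bot (by omega), h0, zero_add]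
  have e2 : ∑ v ∈ Finset.Ico (q/2+1) q, g v = ∑ v ∈ Finset.Ico 1 (q - q/2), g v := by
    apply Finset.sum_bij (fun v _ => q - v)
    · intro v hv; simp only [Finset.mem_Ico] at hv ⊢; omega
    · intro v hv w hw h; simp only [Finset.mem_Ico] at hv hw; omega
    · intro v hv; simp only [Finset.mem_Ico] at hv
      exact ⟨q - v, by simp only [Finset.mem_Ico]; omega, by omega⟩
    · intro v hv; simp only [Finset.mem_Ico] at hv
      rw [hs v (by omega) (by omega)]
  rw [e1, ← Finset.sum_Ico_consecutive g (show 1 ≤ q/2+1 by omega) (show q/2+1 ≤ q by omega), e2]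
  rcases Nat.even_or_odd q with he | ho
  · rw [Nat.even_iff] at he
    have : q - q/2 = q/2 := by omega
    rw [this, Finset.sum_Ico_succ_top (by omega), Finset.sum_Ico_succ_top (by omega)]
    have e3 : ∑ v ∈ Finset.Ico 1 (q/2), (om q v : R) * g v = ∑ v ∈ Finset.Ico 1 (q/2), g v + ∑ v ∈ Finset.Ico 1 (q/2), g v := by
      rw [← Finset.sum_add_distrib]
      apply Finset.sum_congr rfl
      intro v hv
      simp only [Finset.mem_Ico] at hv
      rw [om, if_neg (by omega)]; push_cast; ring
    rw [e3, om, if_pos (by omega)]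
    push_cast; ring
  · rw [Nat.odd_iff] at ho
    have : q - q/2 = q/2+1 := by omega
    rw [this, ← Finset.sum_add_distrib]
    apply Finset.sum_congr rfl
    intro v hv
    simp only [Finset.mem_Ico] at hv
    rw [om, if_neg (by omega)]; push_cast; ring

/-- parametrisation of residues `u` mod `q` by `(c,i)` -/
lemma param {q : ℕ} [NeZero q] {M : Type*} [AddCommMonoid M] (m e v : ℕ) (hm : m ∣ q) (hem : q ∣ e*m)
    (he : e % m = 1 % m) (hv : Nat.Coprime v m) (F : ZMod q → M) :
    ∑ u, F u = ∑ c ∈ Finset.range m, ∑ i ∈ Finset.range (q/m), F ((e*c*v + m*i : ℕ)) := by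
  have hq : 0 < q := Nat.pos_of_ne_zero (NeZero.ne q)
  have hm0 : 0 < m := Nat.pos_of_dvd_of_pos hm hq
  rw [← Finset.sum_product']
  symm
  have hinj : Set.InjOn (fun x : ℕ × ℕ => ((e*x.1*v + m*x.2 : ℕ) : ZMod q)) (Finset.range m ×ˢ Finset.range (q/m) : Finset (ℕ×ℕ)) := by
    rintro ⟨c, i⟩ h ⟨c', i'⟩ h' heq
    simp only [Finset.coe_product, Set.mem_prod, Finset.mem_coe, Finset.mem_range] at h h'
    simp only at heq
    rw [ZMod.natCast_eq_natCast_iff] at heq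
    have h1 : e*c*v + m*i ≡ e*c'*v + m*i' [MOD m] := heq.of_dvd hm
    have he' : e ≡ 1 [MOD m] := he
    have h2 : c*v ≡ c'*v [MOD m] := by
      have k1 : e*c*v + m*i ≡ 1*c*v + 0 [MOD m] :=
        ((he'.mul_right c).mul_right v).add ((Nat.modEq_zero_iff_dvd).mpr (Dvd.intro _ rfl))
      have k2 : e*c'*v + m*i' ≡ 1*c'*v + 0 [MOD m] :=
        ((he'.mul_right c').mul_right v).add ((Nat.modEq_zero_iff_dvd).mpr (Dvd.intro _ rfl))
      have := (k1.symm.trans h1).trans k2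
      simpa using this
    have h3 : c ≡ c' [MOD m] := Nat.ModEq.cancel_right_of_coprime hv.symm h2
    have hc : c = c' := by
      have := h3
      rwa [Nat.ModEq, Nat.mod_eq_of_lt h.1, Nat.mod_eq_of_lt h'.1] at this
    subst hc
    have h4 : m*i ≡ m*i' [MOD q] := Nat.ModEq.add_left_cancel' _ heq
    obtain ⟨k, rfl⟩ := hm
    have h5 : i ≡ i' [MOD k] := Nat.ModEq.mul_left_cancel' hm0.ne' h4
    rw [Nat.mul_div_cancel_left _ hm0] at h h'
    rw [Nat.ModEq, Nat.mod_eq_of_lt h.2, Nat.mod_eq_of_lt h'.2] at h5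
    rw [h5]
  have hcard : (Finset.range m ×ˢ Finset.range (q/m)).card = q := by
    rw [Finset.card_product, Finset.card_range, Finset.card_range, Nat.mul_div_cancel' hm]
  have himg : (Finset.range m ×ˢ Finset.range (q/m)).image (fun x : ℕ × ℕ => ((e*x.1*v + m*x.2 : ℕ) : ZMod q)) = Finset.univ := by
    apply Finset.eq_univ_of_card
    rw [Finset.card_image_of_injOn hinj, hcard, ZMod.card]
  rw [← himg, Finset.sum_image hinj]

/-- factorisation of the character value -/
lemma X_fact {q r : ℕ} [NeZero q] (X : ZMod q → ZMod r) (hX : ∀ x y, X (x*y) = X x * X y)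
    (a n : ℕ) (ha : Odd a) (hn : Odd n) (m e f v c i : ℕ) (hef : (e + f) % q = 1 % q) (hee : q ∣ e*f)
    (hem : q ∣ e*m) (hf2 : q ∣ f*(2*v)) (hfv : q ∣ f*(v*v)) :
    X (NZ (a:ZMod q) n ((e*c*v+m*i : ℕ):ZMod q) (v:ZMod q)) =
    X ((e:ZMod q) * (c*(c + a*n) - a) + f) * X ((e * (v*v) + m*i*(m*i+v) : ℕ) : ZMod q) := by
  rw [← hX]
  congr 1
  have h1 : (e:ZMod q) + f = 1 := by
    have : ((e+f : ℕ) : ZMod q) = ((1:ℕ) : ZMod q) := by rw [ZMod.natCast_eq_natCast_iff']; exact hef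
    push_cast at this; exact this
  have h2 : (e:ZMod q) * f = 0 := by
    have := (ZMod.natCast_eq_zero_iff _ _).mpr hee; push_cast at this; exact this
  have h3 : (e:ZMod q) * m = 0 := by
    have := (ZMod.natCast_eq_zero_iff _ _).mpr hem; push_cast at this; exact this
  have h4 : (f:ZMod q) * (2*v) = 0 := by
    have := (ZMod.natCast_eq_zero_iff _ _).mpr hf2; push_cast at this; exact this
  have h5 : (f:ZMod q) * (v*v) = 0 := by
    have := (ZMod.natCast_eq_zero_iff _ _).mpr hfv; push_cast at this; exact this
  obtain ⟨k, hk⟩ : ∃ k : ℕ, a*n = 2*k+1 := ha.mul hn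
  have hk' : (a:ZMod q)*n = 2*k+1 := by exact_mod_cast congrArg (fun z : ℕ => (z : ZMod q)) hk
  unfold NZ
  push_cast
  rw [hk']
  have hf : (f:ZMod q) = 1 - e := by linear_combination h1
  rw [hf] at h2 h4 h5 ⊢
  generalize (e:ZMod q) = e at *
  generalize (m:ZMod q) = m at *
  generalize (v:ZMod q) = v at *
  generalize (c:ZMod q) = c at *
  generalize (i:ZMod q) = i at *
  generalize (k:ZMod q) = k at *
  generalize (a:ZMod q) = a at *
  have h6 : m * (2*v) = 0 := by linear_combination m*h4 + 2*v*h3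
  linear_combination (2*c*v*i - (c*(c+(2*k+1))-a)*i*(m*i+v) + i*(m*i+v))*h3 + ((2*k+1)*c*v^2 - a*v^2 - v^2)*h2 + k*i*h6 - a*h5

structure Cls where
  m : ℕ
  e : ℕ
  f : ℕ
  g : ℕ
  tab : ℕ
  G : ℕ

def inC (k : Cls) (v : ℕ) : Prop := k.g ∣ v ∧ Nat.Coprime v k.m

instance (k : Cls) (v : ℕ) : Decidable (inC k v) := by unfold inC; infer_instance

structure ClsOk (q : ℕ) (k : Cls) : Prop where
  hm : k.m ∣ q
  hem : q ∣ k.e * k.m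
  he : k.e % k.m = 1 % k.m
  hef : (k.e + k.f) % q = 1 % q
  hee : q ∣ k.e * k.f
  hf2 : q ∣ k.f * (2 * k.g)
  hfv : q ∣ k.f * (k.g * k.g)

lemma sum_list_comm {R ι κ : Type*} [AddCommMonoid R] (s : Finset ι) (l : List κ) (F : κ → ι → R) :
    ∑ v ∈ s, (l.map (fun k => F k v)).sum = (l.map (fun k => ∑ v ∈ s, F k v)).sum := by
  induction l with
  | nil => simp
  | cons k l ih => simp [Finset.sum_add_distrib, ih]

/-- the weight table entry -/
noncomputable def Hm {q r : ℕ} [NeZero q] (X : ZMod q → ZMod r) (bu bv : ZMod q → ZMod r) (k : Cls) (c : ℕ) : ZMod r :=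
  ∑ v ∈ Finset.Ico 1 (q/2+1), if inC k v then
    (om q v : ZMod r) * bv v * ∑ i ∈ Finset.range (q/k.m), X ((k.e * (v*v) + k.m*i*(k.m*i+v) : ℕ)) * bu ((k.e*c*v + k.m*i : ℕ))
    else 0

lemma list_one {R κ : Type*} [CommRing R] (l : List κ) (P : κ → Prop) [DecidablePred P] (y : R)
    (h : (l.map (fun k => if P k then 1 else 0)).sum = 1) :
    y = (l.map (fun k => if P k then y else 0)).sum := by
  have key : ∀ l : List κ, (l.map (fun k => if P k then y else 0)).sum = (((l.map (fun k => if P k then 1 else 0)).sum : ℕ) : R) * y := by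
    intro l
    induction l with
    | nil => simp
    | cons k l ih =>
      simp only [List.map_cons, List.sum_cons, ih]
      push_cast
      split_ifs <;> ring
  rw [key, h]; simp

theorem fold_main {q r : ℕ} [NeZero q] (hq : 1 < q) (X : ZMod q → ZMod r) (hX : ∀ x y, X (x*y) = X x * X y)
    (a n : ℕ) (ha : Odd a) (hn : Odd n) (bu bv : ZMod q → ZMod r) (hpar : ∀ u v, bu (-u) * bv (-v) = bu u * bv v)
    (hb0 : bv 0 = 0) (cls : List Cls) (hok : ∀ k ∈ cls, ClsOk q k)
    (hpart : ∀ v ∈ Finset.Ico 1 (q/2+1), (cls.map (fun k => if inC k v then 1 else 0)).sum = 1) :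
    ∑ u, ∑ v, X (NZ (a:ZMod q) n u v) * (bu u * bv v) =
    (cls.map (fun k => ∑ c ∈ Finset.range k.m, X ((k.e:ZMod q) * (c*(c + a*n) - a) + k.f) * Hm X bu bv k c)).sum := by
  rw [Finset.sum_comm, zsum_range]
  set g : ℕ → ZMod r := fun v => ∑ u, X (NZ (a:ZMod q) n u (v:ZMod q)) * (bu u * bv (v:ZMod q)) with hg
  have hs : ∀ v, 1 ≤ v → v < q → g (q - v) = g v := by
    intro v h1 h2
    simp only [hg]
    rw [← Equiv.sum_comp (Equiv.neg (ZMod q))]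
    apply Finset.sum_congr rfl
    intro u _
    have e : ((q - v : ℕ) : ZMod q) = - v := by rw [Nat.cast_sub h2.le]; simp
    simp only [Equiv.neg_apply, e, hpar]
    congr 2
    unfold NZ; ring
  change ∑ v ∈ Finset.range q, g v = _
  rw [half_sum q hq g (by simp [hg, hb0]) hs]
  have e1 : ∀ v ∈ Finset.Ico 1 (q/2+1), (om q v : ZMod r) * g v = (cls.map (fun k => if inC k v then (om q v : ZMod r) * g v else 0)).sum := by
    intro v hv
    exact list_one cls (fun k => inC k v) _ (hpart v hv)
  rw [Finset.sum_congr rfl e1, sum_list_comm]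
  congr 1
  apply List.map_congr_left
  intro k hk
  have ok := hok k hk
  unfold Hm
  simp only [Finset.mul_sum]
  rw [Finset.sum_comm]
  apply Finset.sum_congr rfl
  intro v hv
  by_cases hin : inC k v
  · simp only [if_pos hin, hg]
    rw [param k.m k.e v ok.hm ok.hem ok.he hin.2, Finset.mul_sum]
    apply Finset.sum_congr rfl
    intro c _
    rw [Finset.mul_sum, Finset.mul_sum]
    apply Finset.sum_congr rfl
    intro i _
    obtain ⟨w, rfl⟩ := hin.1
    rw [X_fact X hX a n ha hn k.m k.e k.f (k.g*w) c i ok.hef ok.hee ok.hem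
      (ok.hf2.trans ⟨w, by ring⟩) (ok.hfv.trans ⟨w*w, by ring⟩)]
    ring
  · simp [if_neg hin]


/-! Kernel friendly loops -/
noncomputable def sumN (f : ℕ → ℕ) (k : ℕ) : ℕ := @Nat.rec (fun _ => ℕ) (nat_lit 0) (fun i acc => Nat.add acc (f i)) k
noncomputable def allN (k : ℕ) (f : ℕ → Bool) : Bool :=
  @Nat.rec (fun _ => Bool) true (fun i acc => @Bool.rec (fun _ => Bool) false acc (f i)) k
noncomputable def force {β : Type} (x : ℕ) (f : ℕ → β) : β := @Nat.rec (fun _ => β) (f (nat_lit 0)) (fun k _ => f k) (Nat.add x (nat_lit 1))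
noncomputable def impB (b c : Bool) : Bool := @Bool.rec (fun _ => Bool) true c b
noncomputable def lk (tab x : ℕ) : ℕ := Nat.mod (Nat.div tab (Nat.pow (nat_lit 128) x)) (nat_lit 128)

lemma sumN_eq (f : ℕ → ℕ) (k : ℕ) : sumN f k = ∑ i ∈ Finset.range k, f i := by
  induction k with
  | zero => rfl
  | succ k ih => rw [Finset.sum_range_succ, ← ih]; rfl

lemma allN_spec {k : ℕ} {f : ℕ → Bool} (h : allN k f = true) : ∀ i < k, f i = true := by
  induction k with
  | zero => intro i hi; omega
  | succ k ih =>
    have e : allN (k+1) f = @Bool.rec (fun _ => Bool) false (allN k f) (f k) := rfl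
    rw [e] at h
    cases hf : f k with
    | false => rw [hf] at h; exact absurd h (by simp)
    | true =>
      rw [hf] at h
      intro i hi
      rcases Nat.lt_succ_iff_lt_or_eq.mp hi with h1 | h1
      · exact ih h i h1
      · rw [h1]; exact hf

lemma force_eq {β : Type} (x : ℕ) (f : ℕ → β) : force x f = f x := rfl

lemma impB_spec {b c : Bool} (h : impB b c = true) (hb : b = true) : c = true := by
  subst hb; exact h

lemma lk_lt (tab x : ℕ) : lk tab x < 128 := Nat.mod_lt _ (by norm_num)

structure ED where
  q : ℕ
  r : ℕ
  xt : ℕ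
  comps : List (ℕ × ℕ)
  cls : List Cls

/-! checks -/
noncomputable def b1n (Q2 u : ℕ) : ℕ := @Nat.rec (fun _ => ℕ) (nat_lit 0) (fun k _ => Nat.add (Nat.add k k) Q2) u

noncomputable def omn (q v : ℕ) : ℕ := @Bool.rec (fun _ => ℕ) (nat_lit 2) (nat_lit 1) (Nat.beq (Nat.add v v) q)

noncomputable def Hn (q xt Q2 m e g hg qm c : ℕ) : ℕ :=
  sumN (fun t => force (Nat.mul g (Nat.add t (nat_lit 1))) fun v =>
    @Bool.rec (fun _ => ℕ) (nat_lit 0)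
     (force (Nat.mod (Nat.mul e (Nat.mul v v)) q) fun ev => force (Nat.mod (Nat.mul (Nat.mul e c) v) q) fun ecv =>
       Nat.mul (Nat.mul (omn q v) (b1n Q2 v)) 
        (sumN (fun i => force (Nat.mul m i) fun mi =>
          Nat.mul (lk xt (Nat.mod (Nat.add ev (Nat.mul mi (Nat.add mi v))) q)) (b1n Q2 (Nat.mod (Nat.add ecv mi) q))) qm))
     (Nat.beq (Nat.gcd v m) (nat_lit 1))) hg

noncomputable def Gn (q xt Q2 m e g hg qm : ℕ) : ℕ :=
  sumN (fun t => force (Nat.mul g (Nat.add t (nat_lit 1))) fun v =>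
    @Bool.rec (fun _ => ℕ) (nat_lit 0)
     (force (Nat.mod (Nat.mul e (Nat.mul v v)) q) fun ev => 
       Nat.mul (Nat.mul (omn q v) (Nat.mul v (Nat.add v Q2))) 
        (sumN (fun i => force (Nat.mul m i) fun mi =>
          lk xt (Nat.mod (Nat.add ev (Nat.mul mi (Nat.add mi v))) q)) qm))
     (Nat.beq (Nat.gcd v m) (nat_lit 1))) hg

noncomputable def clsCheck (q r xt : ℕ) (k : Cls) : Bool :=
  force q fun q => force r fun r => force xt fun xt => force k.m fun m => force k.e fun e => force k.g fun g => force k.tab fun tab =>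
  force ((r-1)*q+2) fun Q2 => force ((q/2)/g) fun hg => force (q/m) fun qm => force ((r-1)*q) fun Q1 =>
  (Nat.beq (q % m) 0 && Nat.beq (e*m%q) 0 && Nat.beq (e%m) (1%m) && Nat.beq ((e+k.f)%q) (1%q) && Nat.beq (e*k.f%q) 0 &&
    Nat.beq (k.f*(2*g)%q) 0 && Nat.beq (k.f*(g*g)%q) 0 && Nat.blt 0 g && Nat.blt m 1024 &&
    Nat.beq (Nat.mod (Gn q xt Q1 m e g hg qm) r) k.G &&
    allN m (fun c => Nat.beq (Nat.mod (Hn q xt Q2 m e g hg qm c) r) (lk tab c)))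

noncomputable def prodC : List (ℕ × ℕ) → ℕ → ℕ
  | [], _ => 1
  | p :: l, x => lk p.2 (x % p.1) * prodC l x

noncomputable def compCheck (q r : ℕ) (p : ℕ × ℕ) : Bool :=
  Nat.blt 0 p.1 && Nat.beq (q % p.1) 0 && allN p.1 (fun x => allN p.1 (fun y => Nat.beq (lk p.2 (x*y%p.1)) (lk p.2 x * lk p.2 y % r)))

noncomputable def EDcheck (E : ED) : Bool :=
  Nat.blt 1 E.q && Nat.blt 2 E.r && 
  E.comps.all (compCheck E.q E.r) && allN E.q (fun x => Nat.beq (prodC E.comps x % E.r) (lk E.xt x)) &&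
  Nat.beq (lk E.xt (E.q-1)) (E.r-1) && Nat.beq (sumN (fun x => x * lk E.xt x) E.q % E.r) 0 &&
  allN (E.q/2) (fun v => Nat.beq ((E.cls.map (fun k => cond (Nat.beq ((v+1)%k.g) 0 && Nat.beq (Nat.gcd (v+1) k.m) 1) 1 0)).sum) 1) &&
  E.cls.all (clsCheck E.q E.r E.xt)

noncomputable def ED.X (E : ED) (x : ZMod E.q) : ZMod E.r := (lk E.xt x.val : ZMod E.r)

lemma lk_cast {q r : ℕ} [NeZero q] (xt x : ℕ) : ((lk xt (x % q) : ℕ) : ZMod r) = ((lk xt ((x:ZMod q)).val : ℕ) : ZMod r) := by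
  rw [ZMod.val_natCast]

section
variable {q r : ℕ} [NeZero q]

lemma Q1_cast (hr : 0 < r) : (((r-1)*q : ℕ) : ZMod r) = -(q:ZMod r) := by
  push_cast [Nat.cast_sub (show 1 ≤ r from hr)]
  simp

lemma b1n_cast (hr : 0 < r) (u : ℕ) (hu : u < q) : ((b1n ((r-1)*q+2) u : ℕ) : ZMod r) = ((b1 (u : ZMod q) : ℤ) : ZMod r) := by
  unfold b1
  cases u with
  | zero => simp [b1n]
  | succ k =>
    have : b1n ((r-1)*q+2) (k+1) = k + k + ((r-1)*q+2) := rfl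
    rw [this, if_neg, ZMod.val_natCast, Nat.mod_eq_of_lt hu]
    · push_cast
      have := Q1_cast (q := q) hr
      push_cast at this
      rw [this]; ring
    · rw [ZMod.natCast_eq_zero_iff]
      intro h
      exact absurd (Nat.le_of_dvd (by omega) h) (by omega)

lemma b2n_cast (hr : 0 < r) (u : ℕ) (hu : u < q) : ((u * (u + (r-1)*q) : ℕ) : ZMod r) = ((b2 (u : ZMod q) : ℤ) : ZMod r) := by
  unfold b2
  rw [ZMod.val_natCast, Nat.mod_eq_of_lt hu]
  have := Q1_cast (q := q) hr
  push_cast at this ⊢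
  rw [this]; ring
end

lemma omn_eq (q v : ℕ) : omn q v = om q v := by
  unfold omn om
  by_cases h : 2*v = q
  · rw [if_pos h]
    have : Nat.beq (Nat.add v v) q = true := by rw [Nat.beq_eq]; show v + v = q; omega
    rw [this]
  · rw [if_neg h]
    have : Nat.beq (Nat.add v v) q = false := by
      rw [← Bool.not_eq_true, Nat.beq_eq]; show ¬ (v + v = q); omega
    rw [this]

lemma sum_inC {R : Type*} [AddCommMonoid R] (k : Cls) (h : ℕ) (hg : 0 < k.g) (F : ℕ → R) :
    ∑ v ∈ Finset.Ico 1 (h+1), (if inC k v then F v else 0) =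
    ∑ t ∈ Finset.range (h / k.g), (if Nat.gcd (k.g*(t+1)) k.m = 1 then F (k.g*(t+1)) else 0) := by
  symm
  have e : ∀ t, (if Nat.gcd (k.g*(t+1)) k.m = 1 then F (k.g*(t+1)) else 0) = (if inC k (k.g*(t+1)) then F (k.g*(t+1)) else 0) := by
    intro t
    congr 1
    simp [inC, Nat.Coprime]
  rw [Finset.sum_congr rfl (fun t _ => e t)]
  have hinj : Function.Injective (fun t => k.g*(t+1)) := by
    intro s t h
    have := Nat.eq_of_mul_eq_mul_left hg h
    omega
  rw [← Finset.sum_image (f := fun v => if inC k v then F v else 0) (g := fun t => k.g*(t+1)) (hinj.injOn)]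
  apply Finset.sum_subset
  · intro v hv
    rw [Finset.mem_image] at hv
    obtain ⟨t, ht, rfl⟩ := hv
    rw [Finset.mem_range, Nat.lt_iff_add_one_le, Nat.le_div_iff_mul_le hg] at ht
    rw [Finset.mem_Ico]
    constructor
    · exact Nat.mul_pos hg (by omega)
    · rw [mul_comm]; omega
  · intro v hv hn
    rw [if_neg]
    rintro ⟨⟨w, rfl⟩, _⟩
    apply hn
    rw [Finset.mem_Ico] at hv
    rw [Finset.mem_image]
    have hw : 0 < w := by
      rcases Nat.eq_zero_or_pos w with h | h
      · subst h; simp at hv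
      · exact h
    refine ⟨w-1, ?_, ?_⟩
    · rw [Finset.mem_range, Nat.lt_iff_add_one_le, Nat.le_div_iff_mul_le hg, mul_comm]
      have : w - 1 + 1 = w := by omega
      rw [this]; omega
    · have : w - 1 + 1 = w := by omega
      simp only [this]

lemma boolrec_beq (s t : ℕ) (x y : ℕ) : @Bool.rec (fun _ => ℕ) x y (Nat.beq s t) = if s = t then y else x := by
  by_cases h : s = t
  · rw [if_pos h]
    have : Nat.beq s t = true := by rwa [Nat.beq_eq]
    rw [this]
  · rw [if_neg h]
    have : Nat.beq s t = false := by rwa [← Bool.not_eq_true, Nat.beq_eq]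
    rw [this]

lemma Hn_cast {q r : ℕ} [NeZero q] (hq : 1 < q) (hr : 0 < r) (xt : ℕ) (k : Cls) (hg : 0 < k.g) (hm : 0 < k.m) (c : ℕ) :
    ((Hn q xt ((r-1)*q+2) k.m k.e k.g ((q/2)/k.g) (q/k.m) c : ℕ) : ZMod r) =
    Hm (fun x : ZMod q => (lk xt x.val : ZMod r)) (fun u => (b1 u : ℤ)) (fun v => (b1 v : ℤ)) k c := by
  unfold Hm Hn
  rw [sum_inC k (q/2) hg, sumN_eq, Nat.cast_sum]
  apply Finset.sum_congr rfl
  intro t ht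
  rw [Finset.mem_range, Nat.lt_iff_add_one_le, Nat.le_div_iff_mul_le hg] at ht
  have hv : k.g * (t+1) < q := by rw [mul_comm]; omega
  simp only [force_eq]
  rw [boolrec_beq]
  change ((if Nat.gcd (k.g*(t+1)) k.m = 1 then _ else _ : ℕ) : ZMod r) = _
  split_ifs with hco
  · rw [sumN_eq]
    change (((omn q (k.g*(t+1)) * b1n _ (k.g*(t+1))) * _ : ℕ) : ZMod r) = _
    rw [Nat.cast_mul, Nat.cast_mul, omn_eq, b1n_cast hr _ hv]
    congr 1
    rw [Nat.cast_sum]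
    apply Finset.sum_congr rfl
    intro i _
    change ((lk xt ((k.e * ((k.g*(t+1)) * (k.g*(t+1))) % q + k.m * i * (k.m*i + k.g*(t+1))) % q) * b1n ((r-1)*q+2) ((k.e*c*(k.g*(t+1)) % q + k.m*i) % q) : ℕ) : ZMod r) = _
    rw [Nat.cast_mul, Nat.mod_add_mod, Nat.mod_add_mod, lk_cast, b1n_cast hr _ (Nat.mod_lt _ (by omega))]
    congr 2
    simp
  · simp

lemma Gn_cast {q r : ℕ} [NeZero q] (hq : 1 < q) (hr : 0 < r) (xt : ℕ) (k : Cls) (hg : 0 < k.g) (hm : 0 < k.m) (c : ℕ) :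
    ((Gn q xt ((r-1)*q) k.m k.e k.g ((q/2)/k.g) (q/k.m) : ℕ) : ZMod r) =
    Hm (fun x : ZMod q => (lk xt x.val : ZMod r)) (fun u => 1) (fun v => (b2 v : ℤ)) k c := by
  unfold Hm Gn
  rw [sum_inC k (q/2) hg, sumN_eq, Nat.cast_sum]
  apply Finset.sum_congr rfl
  intro t ht
  rw [Finset.mem_range, Nat.lt_iff_add_one_le, Nat.le_div_iff_mul_le hg] at ht
  have hv : k.g * (t+1) < q := by rw [mul_comm]; omega
  simp only [force_eq]
  rw [boolrec_beq]
  change ((if Nat.gcd (k.g*(t+1)) k.m = 1 then _ else _ : ℕ) : ZMod r) = _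
  split_ifs with hco
  · rw [sumN_eq]
    change (((omn q (k.g*(t+1)) * ((k.g*(t+1)) * (k.g*(t+1) + (r-1)*q))) * _ : ℕ) : ZMod r) = _
    rw [Nat.cast_mul, Nat.cast_mul, omn_eq, b2n_cast hr _ hv]
    congr 1
    rw [Nat.cast_sum]
    apply Finset.sum_congr rfl
    intro i _
    change ((lk xt ((k.e * ((k.g*(t+1)) * (k.g*(t+1))) % q + k.m * i * (k.m*i + k.g*(t+1))) % q) : ℕ) : ZMod r) = _
    rw [Nat.mod_add_mod, lk_cast, mul_one]
  · simp

structure ClsTab {q r : ℕ} [NeZero q] (X : ZMod q → ZMod r) (k : Cls) : Prop where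
  ok : ClsOk q k
  mlt : k.m < 1024
  hH : ∀ c < k.m, (lk k.tab c : ZMod r) = Hm X (fun u => (b1 u : ℤ)) (fun v => (b1 v : ℤ)) k c
  hG : ∀ c, (k.G : ZMod r) = Hm X (fun u => 1) (fun v => (b2 v : ℤ)) k c

lemma cls_sound {q r xt : ℕ} [NeZero q] (hq : 1 < q) (hr : 2 < r) (k : Cls) (h : clsCheck q r xt k = true) :
    ClsTab (fun x : ZMod q => (lk xt x.val : ZMod r)) k := by
  unfold clsCheck at h
  simp only [force_eq, Bool.and_eq_true, Nat.beq_eq, Nat.blt_eq] at h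
  obtain ⟨⟨⟨⟨⟨⟨⟨⟨⟨⟨h1, h2⟩, h3⟩, h4⟩, h5⟩, h6⟩, h7⟩, h8⟩, h9⟩, h10⟩, h11⟩ := h
  have hm : 0 < k.m := Nat.pos_of_dvd_of_pos (Nat.dvd_of_mod_eq_zero h1) (by omega)
  refine ⟨⟨Nat.dvd_of_mod_eq_zero h1, Nat.dvd_of_mod_eq_zero h2, h3, h4, Nat.dvd_of_mod_eq_zero h5, Nat.dvd_of_mod_eq_zero h6, Nat.dvd_of_mod_eq_zero h7⟩, h9, ?_, ?_⟩
  · intro c hc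
    have := allN_spec h11 c hc
    rw [Nat.beq_eq] at this
    rw [← this, ← Hn_cast hq (by omega) xt k h8 hm c]
    exact ZMod.natCast_mod _ _
  · intro c
    rw [← h10, ← Gn_cast hq (by omega) xt k h8 hm c]
    exact ZMod.natCast_mod _ _

lemma prodC_mul {q r : ℕ} (l : List (ℕ × ℕ)) (h : ∀ p ∈ l, compCheck q r p = true) (x y : ℕ) :
    ((prodC l (x * y % q) : ℕ) : ZMod r) = (prodC l (x % q) : ZMod r) * (prodC l (y % q) : ZMod r) := by
  induction l with
  | nil => simp [prodC]
  | cons p l ih =>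
    have hp := h p (by simp)
    unfold compCheck at hp
    simp only [Bool.and_eq_true, Nat.beq_eq, Nat.blt_eq] at hp
    obtain ⟨⟨h1, h2⟩, h3⟩ := hp
    have hd : p.1 ∣ q := Nat.dvd_of_mod_eq_zero h2
    simp only [prodC]
    push_cast
    rw [ih (fun p' hp' => h p' (by simp [hp']))]
    have h4 := allN_spec (allN_spec h3 (x % p.1) (Nat.mod_lt _ h1)) (y % p.1) (Nat.mod_lt _ h1)
    rw [Nat.beq_eq] at h4
    rw [Nat.mod_mod_of_dvd _ hd, Nat.mod_mod_of_dvd _ hd, Nat.mod_mod_of_dvd _ hd, Nat.mul_mod, h4, ZMod.natCast_mod]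
    push_cast
    ring

structure EDok (E : ED) : Prop where
  hq : 1 < E.q
  hr : 2 < E.r
  hX : ∀ x y, E.X (x*y) = E.X x * E.X y
  hX1 : E.X (-1) = -1
  hS : ∑ m ∈ Finset.range E.q, (m : ZMod E.r) * E.X m = 0
  hpart : ∀ v ∈ Finset.Ico 1 (E.q/2+1), (E.cls.map (fun k => if inC k v then 1 else 0)).sum = 1
  hc : ∀ [NeZero E.q], ∀ k ∈ E.cls, ClsTab E.X k

theorem ED_sound (E : ED) (h : EDcheck E = true) : EDok E := by
  unfold EDcheck at h
  simp only [Bool.and_eq_true, Nat.beq_eq, Nat.blt_eq, List.all_eq_true] at h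
  obtain ⟨⟨⟨⟨⟨⟨⟨h1, h2⟩, h3⟩, h4⟩, h5⟩, h6⟩, h7⟩, h8⟩ := h
  haveI : NeZero E.q := ⟨by omega⟩
  have hlk : ∀ x : ZMod E.q, E.X x = (prodC E.comps (x.val % E.q) : ZMod E.r) := by
    intro x
    have := allN_spec h4 x.val (ZMod.val_lt x)
    rw [Nat.beq_eq] at this
    unfold ED.X
    rw [← this, ZMod.natCast_mod, Nat.mod_eq_of_lt (ZMod.val_lt x)]
  refine ⟨h1, h2, ?_, ?_, ?_, ?_, ?_⟩
  · intro x y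
    rw [hlk, hlk, hlk, ZMod.val_mul, Nat.mod_mod, prodC_mul E.comps h3]
  · unfold ED.X
    have : ((-1 : ZMod E.q)).val = E.q - 1 := by
      obtain ⟨k, hk⟩ : ∃ k, E.q = k + 1 := ⟨E.q - 1, by omega⟩
      have e : (-1 : ZMod E.q) = ((E.q - 1 : ℕ) : ZMod E.q) := by
        rw [Nat.cast_sub (by omega)]; simp
      rw [e, ZMod.val_natCast, Nat.mod_eq_of_lt (by omega)]
    rw [this, h5, Nat.cast_sub (by omega)]; simp
  · rw [sumN_eq] at h6
    have h6' := (ZMod.natCast_eq_zero_iff _ _).mpr (Nat.dvd_of_mod_eq_zero h6)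
    push_cast at h6'
    rw [← h6']
    apply Finset.sum_congr rfl
    intro x hx
    unfold ED.X
    rw [ZMod.val_natCast, Nat.mod_eq_of_lt (Finset.mem_range.mp hx)]
  · intro v hv
    rw [Finset.mem_Ico] at hv
    have := allN_spec h7 (v-1) (by omega)
    rw [Nat.beq_eq, show v - 1 + 1 = v by omega] at this
    refine Eq.trans ?_ this
    congr 1
    apply List.map_congr_left
    intro k _
    by_cases hin : inC k v
    · rw [if_pos hin]
      obtain ⟨i1, i2⟩ := hin
      have e1 : Nat.beq (v % k.g) 0 = true := by rw [Nat.beq_eq]; exact Nat.mod_eq_zero_of_dvd i1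
      have e2 : Nat.beq (Nat.gcd v k.m) 1 = true := by rw [Nat.beq_eq]; exact i2
      rw [e1, e2]; rfl
    · rw [if_neg hin]
      have e1 : (Nat.beq (v % k.g) 0 && Nat.beq (Nat.gcd v k.m) 1) = false := by
        rw [← Bool.not_eq_true, Bool.and_eq_true, Nat.beq_eq, Nat.beq_eq]
        rintro ⟨i1, i2⟩
        exact hin ⟨Nat.dvd_of_mod_eq_zero i1, i2⟩
      rw [e1]; rfl
  · intro _ k hk
    exact cls_sound h1 h2 k (h8 k hk)

/-! evaluation -/
noncomputable def clsS (q xt ab na m e f tab : ℕ) : ℕ :=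
  sumN (fun c => Nat.mul (lk xt (Nat.mod (Nat.add (Nat.mul e (Nat.add (Nat.mul c (Nat.add c ab)) na)) f) q))
    (Nat.add (lk tab c) (nat_lit 16777216))) m

noncomputable def evGo (q xt ab na : ℕ) (l : List Cls) : ℕ → ℕ → (ℕ → ℕ → Bool) → Bool :=
  @List.rec Cls (fun _ => ℕ → ℕ → (ℕ → ℕ → Bool) → Bool) (fun B C k => k B C)
   (fun cl _ ih B C k => force cl.m fun m => force cl.e fun e => force cl.f fun f => force cl.tab fun tab =>
     force (clsS q xt ab na m e f tab) fun S =>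
     force (Nat.add B (Nat.mod S (nat_lit 16777216))) fun B =>
     force (Nat.add C (Nat.mul cl.G (Nat.div S (nat_lit 16777216)))) fun C => ih B C k) l

noncomputable def evE (E : ED) (a n : ℕ) (k : ℕ → ℕ → Bool) : Bool :=
  force E.q fun q => force E.xt fun xt => force E.r fun r => force (Nat.mod a q) fun a => 
  force (Nat.mod (Nat.mul a n) q) fun ab =>
  force (Nat.sub q a) fun na => evGo q xt ab na E.cls (nat_lit 0) (nat_lit 0) fun B C =>
    force (Nat.mod B r) fun B => force (Nat.mod C r) fun C => k B C

noncomputable def yv (q xt ab na : ℕ) (k : Cls) (c : ℕ) : ℕ := lk xt ((k.e * (c*(c+ab) + na) + k.f) % q)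

noncomputable def vB (q xt ab na : ℕ) (l : List Cls) : ℕ := (l.map (fun k => ∑ c ∈ Finset.range k.m, yv q xt ab na k c * lk k.tab c)).sum
noncomputable def vC (q xt ab na : ℕ) (l : List Cls) : ℕ := (l.map (fun k => k.G * ∑ c ∈ Finset.range k.m, yv q xt ab na k c)).sum

lemma clsS_eq (q xt ab na : ℕ) (k : Cls) (hm : k.m < 1024) :
   clsS q xt ab na k.m k.e k.f k.tab % 16777216 = ∑ c ∈ Finset.range k.m, yv q xt ab na k c * lk k.tab c ∧
   clsS q xt ab na k.m k.e k.f k.tab / 16777216 = ∑ c ∈ Finset.range k.m, yv q xt ab na k c := by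
  have e : clsS q xt ab na k.m k.e k.f k.tab = ∑ c ∈ Finset.range k.m, yv q xt ab na k c * lk k.tab c + 16777216 * ∑ c ∈ Finset.range k.m, yv q xt ab na k c := by
    unfold clsS
    rw [sumN_eq, Finset.mul_sum, ← Finset.sum_add_distrib]
    apply Finset.sum_congr rfl
    intro c _
    change yv q xt ab na k c * (lk k.tab c + 16777216) = _
    ring
  have hb : ∑ c ∈ Finset.range k.m, yv q xt ab na k c * lk k.tab c < 16777216 := by
    calc _ ≤ ∑ c ∈ Finset.range k.m, 128*128 := by
          apply Finset.sum_le_sum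
          intro c _
          exact Nat.mul_le_mul (lk_lt _ _).le (lk_lt _ _).le
      _ = k.m * (128*128) := by simp
      _ < _ := by omega
  rw [e]
  constructor
  · rw [Nat.add_mul_mod_self_left, Nat.mod_eq_of_lt hb]
  · rw [Nat.add_mul_div_left _ _ (by norm_num), Nat.div_eq_of_lt hb, zero_add]

lemma evGo_eq (q xt ab na : ℕ) (l : List Cls) (hm : ∀ k ∈ l, k.m < 1024) (B C : ℕ) (f : ℕ → ℕ → Bool) :
    evGo q xt ab na l B C f = f (B + vB q xt ab na l) (C + vC q xt ab na l) := by
  induction l generalizing B C with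
  | nil => simp [evGo, vB, vC]
  | cons k l ih =>
    have e := clsS_eq q xt ab na k (hm k (by simp))
    change evGo q xt ab na l (B + clsS q xt ab na k.m k.e k.f k.tab % 16777216) (C + k.G * (clsS q xt ab na k.m k.e k.f k.tab / 16777216)) f = _
    rw [ih (fun k' hk' => hm k' (by simp [hk'])), e.1, e.2]
    simp only [vB, vC, List.map_cons, List.sum_cons, add_assoc]

noncomputable def ED.B (E : ED) (a n : ℕ) : ℕ := vB E.q E.xt ((a%E.q)*n%E.q) (E.q - a%E.q) E.cls % E.r
noncomputable def ED.C (E : ED) (a n : ℕ) : ℕ := vC E.q E.xt ((a%E.q)*n%E.q) (E.q - a%E.q) E.cls % E.r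

lemma evE_eq (E : ED) (hE : EDok E) (a n : ℕ) (f : ℕ → ℕ → Bool) : evE E a n f = f (E.B a n) (E.C a n) := by
  haveI : NeZero E.q := ⟨by have := hE.hq; omega⟩
  unfold evE
  simp only [force_eq]
  rw [evGo_eq _ _ _ _ _ (fun k hk => (hE.hc k hk).mlt)]
  have z : ∀ x, (nat_lit 0) + x = x := fun x => Nat.zero_add x
  rw [z, z]
  rfl

lemma list_cast {R κ : Type*} [CommRing R] (l : List κ) (F : κ → ℕ) (F' : κ → R) (h : ∀ k ∈ l, (F k : R) = F' k) :
    (((l.map F).sum : ℕ) : R) = (l.map F').sum := by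
  induction l with
  | nil => simp
  | cons k l ih =>
    simp only [List.map_cons, List.sum_cons]
    rw [Nat.cast_add, h k (by simp), ih (fun k' hk' => h k' (by simp [hk']))]

lemma yv_cast (E : ED) [NeZero E.q] (a n : ℕ) (k : Cls) (c : ℕ) :
    ((yv E.q E.xt ((a%E.q)*n%E.q) (E.q - a%E.q) k c : ℕ) : ZMod E.r) = E.X ((k.e:ZMod E.q) * (c*(c + a*n) - a) + k.f) := by
  unfold yv ED.X
  rw [lk_cast]
  congr 3
  have h := (Nat.mod_lt a (Nat.pos_of_ne_zero (NeZero.ne E.q))).le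
  push_cast [Nat.cast_sub h]
  simp
  ring

theorem EB_eq (E : ED) (hE : EDok E) [NeZero E.q] (a n : ℕ) (ha : Odd a) (hn : Odd n) :
    (E.B a n : ZMod E.r) = T1 E.X (a : ZMod E.q) (n : ZMod E.q) := by
  unfold ED.B vB T1
  rw [ZMod.natCast_mod]
  have := fold_main hE.hq E.X hE.hX a n ha hn (fun u => (b1 u : ℤ)) (fun v => (b1 v : ℤ))
    (by intro u v; simp only [b1_neg]; push_cast; ring) (by simp [b1]) E.cls (fun k hk => (hE.hc k hk).ok) hE.hpart
  simp only [Int.cast_mul]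
  rw [this]
  apply list_cast
  intro k hk
  push_cast
  apply Finset.sum_congr rfl
  intro c hc
  rw [yv_cast, (hE.hc k hk).hH c (Finset.mem_range.mp hc)]

theorem EC_eq (E : ED) (hE : EDok E) [NeZero E.q] (a n : ℕ) (ha : Odd a) (hn : Odd n) :
    (E.C a n : ZMod E.r) = T2 E.X (a : ZMod E.q) (n : ZMod E.q) := by
  unfold ED.C vC T2
  rw [ZMod.natCast_mod]
  have := fold_main hE.hq E.X hE.hX a n ha hn (fun u => 1) (fun v => (b2 v : ℤ))
    (by intro u v; simp only [b2_neg]) (by simp [b2]) E.cls (fun k hk => (hE.hc k hk).ok) hE.hpart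
  simp only [one_mul] at this
  rw [this]
  apply list_cast
  intro k hk
  push_cast
  rw [Finset.mul_sum]
  apply Finset.sum_congr rfl
  intro c hc
  rw [yv_cast, (hE.hc k hk).hG c]
  ring


/-- character data modulo 105 with values modulo 13 -/
def E0 : ED := ⟨105, 13, 16966152420978291580452653492044600272285089344858746683387069473524271797774285557985453802845039103523118645892749179478279830967925810395108749452434683372125059895814797687542372172721360709264823922540492188400402560,
  [(3, 196736), (5, 3238084736), (7, 53122579873920)],
   [⟨3, 70, 36, 35, 50432, 0⟩,
    ⟨5, 21, 85, 21, 1889665792, 0⟩,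
    ⟨15, 91, 15, 7, 326932229621223823034672104960, 0⟩,
    ⟨7, 15, 91, 15, 26597660935040, 0⟩,
    ⟨21, 85, 21, 5, 33012068219382479824034068779607953408000, 0⟩,
    ⟨35, 36, 70, 3, 3130238968691641664472680930532007821594157700218138925685252652399624960, 5⟩,
    ⟨105, 1, 0, 1, 1522493761687227404375021496128578977415779807804165313790552767589951100437845873517375507101818536245131558404632246096543047888938744556078528325395718204354313540309496710692328290664392585729572122716837488592209408, 3⟩]⟩

theorem E0_ok : EDok E0 := ED_sound E0 (by decide +kernel)

/-- character data modulo 420 with values modulo 13 -/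
def E1 : ED := ⟨420, 13, 100036509200107592268253488473662800800231550619056396438939672868244665190134305213311383834575136535763811613766747050239954174064586782352983904090015793079763053143657640719272950337665878601475772164713351886031194258963689198767203513887416897116611321273217282776386713980767676852469579856459259898945254666253760094315670338228628242583156458793591063689837026210949589172426876523045008169612809895946102586671618153345270175040219176874615053260214178169200068016684079388685674064322590155337210384064838517746594264754836079930178758930652278015940982341153702141338898433851257885863555651130237888291160948007648009337941170574279026340251191887038130451060037681265197997976091483513706600819396862684140061649079341958049820333936302964193293840499600768818664039596724671971011529641975521969793759757600975670933406688041953086295545037095701090587858300344700240000,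
  [(4, 25165952), (3, 196736), (5, 293798016), (7, 52914823512192)],
   [⟨1, 0, 1, 210, 0, 0⟩,
    ⟨4, 105, 316, 105, 25165952, 0⟩,
    ⟨3, 280, 141, 70, 147968, 0⟩,
    ⟨12, 385, 36, 35, 610430942110837723235456, 0⟩,
    ⟨5, 336, 85, 42, 1096844416, 0⟩,
    ⟨20, 21, 400, 21, 55045330341657971335128665731623532200960, 0⟩,
    ⟨15, 196, 225, 14, 3508535453825629713298423349504, 0⟩,
    ⟨60, 301, 120, 7, 191055584838371205036738472442714232139608428392679728900431976080789431239417070954437060514810697274273458675677657754124800, 0⟩,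
    ⟨7, 120, 301, 30, 9208703501696, 8⟩,
    ⟨28, 225, 196, 15, 8674262990824528085833367992037345942302418138422952689920, 6⟩,
    ⟨21, 400, 21, 10, 1470786805433321313919546118086597418255872, 0⟩,
    ⟨84, 85, 336, 5, 87060814843259873171913464496863681481093818125287536611961286732790660473620201417173766220310831228987335277043755304247112691913712339360002635626500123926810409374788354304, 0⟩,
    ⟨35, 36, 385, 6, 27932194693910183852698163266163751540020318648015339669331916290605056, 12⟩,
    ⟨140, 141, 280, 3, 402934894943468033851290219699276929496501287071390665082243796242440352005350049249421478702797300941524621746020085365517298201282455822218895823980234820017320602113609713325673385266820297974808789175738402326860561581026419607055041609171029245950291030551171827363368062236752454225085440, 9⟩,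
    ⟨105, 316, 105, 2, 2879261381789182981194516538308639899210330259622458537191508511101065598439282774116317061007615196831896894961013132199941654523471774163314156975764313228645760696908693238562777623046990197797356032819283452582036864, 0⟩,
    ⟨420, 1, 0, 1, 5596994094527897966412909300443435233410943172093120729407060863831839292641677683602935728151035138521459958936361284470911292781881697066663010706687532864313589004513974030803516430948703463744874559651110761648300926323333051435206262549925282830305264637264038044066492040038332730002408420640599625847115090332371420993692504569651036826579050570471071182596483157109123058435382302900134393146616658006011744858848824831439811602991059304224944307345433316781811103679618969120142620555959384944112288413299427829038674214811750916442264619521565201943747040365325827615687798547409192830268017578008291908895780180895911318503588605839043065980981876113287137802789496353424380962890076406688390092259299461334367484317849205271778267921472737382462354442864780839180582553852534214561555636762426589124554347699581519672362097429883396086655979999534997092732529216061440, 0⟩]⟩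

theorem E1_ok : EDok E1 := ED_sound E1 (by decide +kernel)

/-- character data modulo 140 with values modulo 13 -/
def E2 : ED := ⟨140, 13, 958013093890676919565567546800438493558318325530634573617532041864312642775024605601576492988626362264143871881209243424645115203710201487291163587534591922716599341747436306450021906675715488743350577283592331372839182021075675588559209083855113618268002098353446302128633989848144574385488000,
  [(4, 25165952), (5, 3238084736), (7, 52914823512192)],
   [⟨1, 0, 1, 70, 0, 0⟩,
    ⟨4, 105, 36, 35, 25165952, 0⟩,
    ⟨5, 56, 85, 14, 1092682880, 0⟩,
    ⟨20, 21, 120, 7, 77074013508740490784487228755683859022592, 0⟩,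
    ⟨7, 120, 21, 10, 48553533767936, 0⟩,
    ⟨28, 85, 56, 5, 9483562834780281764116291225227930470261561269810863571072, 0⟩,
    ⟨35, 36, 105, 2, 914779851075220965959919629659018159201813347018173094448755390023796096, 0⟩,
    ⟨140, 1, 0, 1, 802721554078862499622334719773626671106143498173103596988247545819508543304426971599269544246705305145891078032369234703732631247121673447287066033020348544268088529797345357632714964479924802132249496659305726120990711611588038866002265604574186201316803740065096030689787366846252698717749632, 4⟩]⟩

theorem E2_ok : EDok E2 := ED_sound E2 (by decide +kernel)

/-- character data modulo 91 with values modulo 37 -/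
def E3 : ED := ⟨91, 37, 160895469853235776095908882660016406892336718845039055490781534806679646859920033942351236631259503689219288436147349315384520267805243050732830373816928991596391247177679397937929343348359296,
  [(7, 5294105460864), (13, 700736709177445778515427456)],
   [⟨7, 78, 14, 13, 84155333675264, 0⟩,
    ⟨13, 14, 78, 7, 641191245787963844223861248, 0⟩,
    ⟨91, 1, 0, 1, 134676084671895279582802736376942925891604412648099763556189007971968200631507190185607040975388724512244442161878678004478700157382575342750972152529236783686530881871007455811885349174641536, 11⟩]⟩

theorem E3_ok : EDok E3 := ED_sound E3 (by decide +kernel)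

/-- character data modulo 273 with values modulo 37 -/
def E4 : ED := ⟨273, 37, 52520173627441621988238808902330515292792239468497994026443009839892628783096335181979320895079233771421485203553879824745635565239536459342213387392631334437021292652112204629926537385899099269601619825005817966413910646005749924333843692626447745217621234657040785420952327252899889585979495542023864170998019179716169871486805520336360615768462781492289622574966627273534642585718883744536155473929145377227398585651744076075723961498856984706411567275139929862238772276265673723264533950927923190914936663818225665194417258109117063625769606123989950758986921948529918080,
  [(3, 589952), (7, 158710372925568), (13, 699849050047828567167041664)],
   [⟨3, 91, 183, 91, 37248, 0⟩,
    ⟨7, 78, 196, 39, 154687542378752, 0⟩,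
    ⟨21, 169, 105, 13, 45997344067460866281184296993691466716938752, 0⟩,
    ⟨13, 105, 169, 21, 700153441657014996057653376, 0⟩,
    ⟨39, 196, 78, 7, 4057508263796122546414509469665352765706406663328889027983755217551018080304513408, 0⟩,
    ⟨91, 183, 91, 3, 49639874511044873376193554899503168064952586796934828384188407757533799833194474736131069878158070881467380860586590101673322962430667855223023850519196927522116945380570522513736623590788352, 28⟩,
    ⟨273, 1, 0, 1, 39254290382753448784876640554051284611533176106476521156780340967088882162643257862968129449560649668291379398340315529258578527087829145174383980920090091171978354150675062412525015485617467306681241473010204368411813923814624790964852598274056382350831181138049673268747498656568617274095434207922660652263502997892791775821365198360973017103367135924932384805407617389412540774305684172924303803236726294212132768416321656236815007899654534513686269372548398561308596923467704798955115947986823922390214175575858266231614325994616262407581195821184132028794388849285825792, 21⟩]⟩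

theorem E4_ok : EDok E4 := ED_sound E4 (by decide +kernel)

/-- character data modulo 148 with values modulo 7 -/
def E5 : ED := ⟨148, 7, 34517112722843997562400921308260602855950559009531277337285226541812335354596167259371163628631683478782536397210356526276933785664606172947048151090805188274731234003249033390854423704256387266472587043423808001625990723743021611626961405989269206119617730959554523947390168481927398980896238337503488347472000,
  [(4, 12583040), (37, 7521481840404522526551807362769944119166375522190405227594186475492966744192)],
   [⟨1, 0, 1, 74, 0, 0⟩,
    ⟨4, 37, 112, 37, 2097920, 0⟩,
    ⟨37, 112, 37, 2, 36242464247143840810750557273939693232931589514840405174768402169936809656576, 0⟩,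
    ⟨148, 1, 0, 1, 351112947578859891937249057583750108944667102111345437791191396201181761212609441527490344692740541157470321070857137330187249860977660212039822207679673747059714059274762395560856501528836213455123890628193427109234425393335891729961888121815489173462017501867895030400649276620961330507671701206530523136, 0⟩]⟩

theorem E5_ok : EDok E5 := ED_sound E5 (by decide +kernel)

/-- character data modulo 185 with values modulo 13 -/
def E6 : ED := ⟨185, 13, 64030922722877787497608622813500509396840424973694176479080952321758259867311514397457380486410802685523358993461027691559841035376866218396279265447886801961805088306226630963353732419821017645557999022091919162329547619616507277821142126892144024895655074861929571503008850885856776445613276487002259844306085035727041543563045431115206624926591429967817532964834530021182114814534795392,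
  [(5, 293798016), (37, 87470003721362900003069172591788853535576594744452490118937899059208383398016)],
   [⟨5, 111, 75, 37, 1342178304, 0⟩,
    ⟨37, 75, 111, 5, 36583493527205202230582639246530343007202609329893661332215296366407986545664, 5⟩,
    ⟨185, 1, 0, 1, 5748441334767037843612492308788831244361052841763831681357928119369822837276234622472939023156075968514006400009290568588587624552551065656607697718558012650934433124338060836277970809630190326586451776985215993029927265911538548471025688786836429838118146230826815070395689855909263443213640762056622471531871121685093479415877687937387834717700253863170208557494596796868609205172487680, 3⟩]⟩

theorem E6_ok : EDok E6 := ED_sound E6 (by decide +kernel)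

/-- character data modulo 273 with values modulo 73 -/
def E7 : ED := ⟨273, 73, 104893172807191292799726550501779397419433196331810948367492292983479524953617838290208032504906254550590940429817668641780885072892664286473037556571949892203585924177139518167353283016456738831598590471964203645905918961598742613480839133457133941576858966857679321288529765882659231559109987186826907345228243482035040925731484151940935504927337406959177370780127171136972374114560861729035959938121670103809764916698254780619279204866224073585605002462934766860215311824742604833857071151303515542102746664956088992924676149753782939316589194961949172930679195773664886912,
  [(3, 1179776), (7, 319133669408896), (13, 1396320024083106432482558080)],
   [⟨3, 91, 183, 91, 887168, 0⟩,
    ⟨7, 78, 196, 39, 141028767061120, 0⟩,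
    ⟨21, 169, 105, 13, 3311977937631570606966074940825616414827392, 0⟩,
    ⟨13, 105, 169, 21, 492660111684941012831262720, 56⟩,
    ⟨39, 196, 78, 7, 4660725974230077231027018774385306564410035584664210920873484999097058825710637312, 34⟩,
    ⟨91, 183, 91, 3, 233300806847127516588971491843971465142617819596176198926546227249154559458860550222081027284936013560087443856504565164614342747209125190361707327101893585392943622499498821582243393077430912, 53⟩,
    ⟨273, 1, 0, 1, 86229354998024354473840086686543192982115557117246857725055438339928843816005597793267155439317056077931894527589518463583429007864065114434824212956454817770671066797510699778097057041523244634236951489257164820403218850654038535285109398480836860023706812437055949017519885446838480812375387302155487421416895159301176469204172829615668385115587737491206737522048547174115545377828313948902199936016462769136784087746251103507689060556284860175093715620743683309650909605153662981733228885619206351204902839510136510944896812980956741564649969901901275510743706306189870848, 40⟩]⟩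

theorem E7_ok : EDok E7 := ED_sound E7 (by decide +kernel)

/-- character data modulo 455 with values modulo 73 -/
def E8 : ED := ⟨455, 73, 34106643336964924219226967987879465036051646328096385394438596808833855768133437766751361979457234475302334596063348017394118978584734179188380577411741038229462386037062448164688950824765154007088463588828958913880531919839710237035284644722099079165362868712307140568372951035014457429094775207491723308773835790954875462315389239656337843970169054513263913529665827330046811733781508758988754438293409544862228818171147136569590219999304699961204296660607722466646186145148582509128622882657156984687788630165683716104946079899245660968104306243606369555873900287768184828128031629972440821013738863015892124559192478494140443634133643571564378550925815300704097392070864886175331533724602073405760976034489737076175155183721202468007377774804464301398641270894977239551299212818130599936767889158243126589116627264717265565888261523072408594251910728068771890529336590827371768580811960266897900193623847681193268628620752171897309926279945345429464858752,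
  [(5, 19424264320), (7, 6599235076224), (13, 20561774070592711556202624)],
   [⟨5, 91, 365, 91, 15928362752, 0⟩,
    ⟨7, 260, 196, 65, 270415022966272, 0⟩,
    ⟨35, 351, 105, 13, 31903901960971984979661852461646567197128184340823797446820614362513473664, 0⟩,
    ⟨13, 105, 351, 35, 1396678259007317905540628608, 0⟩,
    ⟨65, 196, 260, 7, 7632095087419502544811308971289861809808538188552120668660975749059265481778051074440400196656176406319248777628573295519387716321173376, 0⟩,
    ⟨91, 365, 91, 5, 55042682756497174531808196930355193553275343137209096737332160968050963411674598022844889281422990732000006137733251132372262304806261054137302702749791455523652783132298157860472114869902976, 0⟩,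
    ⟨455, 1, 0, 1, 32781412495452350800188328270221435537115288159867585967095887903733658143221711648288822992643218011766944975419705425673664338518408924597114949533834868824172564790711704617880552260896685505123078802310178991480823771527052970859676971012534684091395241965475416960262295635022946528547560106763000598494634360800430366515367112685602745290810206796469476791059320587208770131769356419540703463242901860910000804998731695753453005328884521818096153386480276968872272234132218505022397435460611205478131205909459201877212252626635026230503188799343057030433264795609988408677049830405297070918790367823662607836336465172426477320250502293384887586493186710429272361880903794580159213396554493117154432046240836671665839521234428151108757959474930304438864527220023500420887560962573575354391674616509573443617010549614121638846425631482066402860449241450050284460041923205682696590746848630269490190091512071950284329151997242805388305665625020530704826880, 1⟩]⟩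

theorem E8_ok : EDok E8 := ED_sound E8 (by decide +kernel)

/-- character data modulo 455 with values modulo 73 -/
def E9 : ED := ⟨455, 73, 33948751176650705736202123578016206040707949569926538103401869471929563707539739745260994826079494381878986336547381768179051039728416249867260101185166097877190823552164857295528404096642456074605051857106744622641324474984585332446001409583143027434096682713672998573174355003569288396307465627799186945020651887899472531875723730270570015906587323307873789856633485935321913804120565061414742270989899070795151975354791609272702441094069481588223364153887834323659046367366570590103298853566104930075713397134232420538467977176090668735820819482811709022463366378015583716874939168542311626231240620482871099493964318304915757121407105684146037028039296687555065723613280648818049097091430786776744495361095394415180071296868554784562385195047692678774274394190193595826414206900304310138284173698629655243485001898424857968753646315415720886948942379274146028621232175852760019920022724486209668748468020964749139875879115476077694731528829104830677090432,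
  [(5, 420610176), (7, 4690238636160), (13, 1396847682618274470978879616)],
   [⟨5, 91, 365, 91, 11416981376, 0⟩,
    ⟨7, 260, 196, 65, 128520756614656, 0⟩,
    ⟨35, 351, 105, 13, 18256768071238059831040965023529166457723292378083475451937034176865751040, 0⟩,
    ⟨13, 105, 351, 35, 319349324938586338931907712, 0⟩,
    ⟨65, 196, 260, 7, 20489695442724892136402256219523140627630465494777067883472225661710770313186062280422053141769847088022454883298898654027786175277454976, 0⟩,
    ⟨91, 365, 91, 5, 152688043338837010090509847232739701785336602205960076475182361251799804832556577612486794952212450409934146164095724245371405809652647047072531035075638538427270756661003495523094079187047296, 27⟩,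
    ⟨455, 1, 0, 1, 19444325660601708322180480676258084497680665715098627631705830837877248980762663804651837932402668668160653145295697541249266846313581990164971586831013779833924645272866804755030445297644870465284052003637311173835300576922966324823389935225187793953381683423980477838160801986008537282345889414077046388937375576273086855975604492532518750669404295129141924124946261391349630760776042820591792468815211603937501532358433666611042105231384406986541092083850274155693688983630162292051783991396971691769775311739716575796705293724441986751795326342160573703815297076569950392473615590108426769656171635311930149037669132191013770028984034723404023737871962537167896459605743041160811008180841174659635666641678982959518088210006680295888984729189881422322427652087813938116833851592729870100804308766802408046036863501519894071976783889611231118231549572837189480559094915851903416352650764291889660048659133652067753031864063353768476169227544944195574321152, 8⟩]⟩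

theorem E9_ok : EDok E9 := ED_sound E9 (by decide +kernel)

/-- character data modulo 111 with values modulo 19 -/
def E10 : ED := ⟨111, 19, 112606122438909117990587602876722173926727791298499498940149576170738258512871618201959051571637029245948380958133570666809232675736430347922358612908085939429718285388356938825165653047721835847487915228538216739861854308638608359552,
  [(3, 295040), (37, 8202159751940467766997261169989569529787481879626113775000572329389602390144)],
   [⟨3, 37, 75, 37, 262528, 0⟩,
    ⟨37, 75, 37, 3, 123653240847697299021562889974656053948162893946054388869977397301032314339584, 13⟩,
    ⟨111, 1, 0, 1, 25276988586640838047211457607960436698214476748410710941273358353328305005705341937264717180212314433045250404243210371578615497902306103218047002930389753502886514740045683082268618646729847970067711123519389713180426081623215343488, 18⟩]⟩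

theorem E10_ok : EDok E10 := ED_sound E10 (by decide +kernel)

/-- character data modulo 148 with values modulo 19 -/
def E11 : ED := ⟨148, 19, 103553093535367689349693805972234952929903328302792382367249786291452923814559747643410934391285045325618374752595261394581696516829962258051988840705878876388511554116791744521055519541782608795893016623479197053509143091400595706328324986608275062161168247874651559917319888078446164419896915757272943625764992,
  [(4, 37748864), (37, 7753384317975801740307211476155347310016986511727787255475844876251456225408)],
   [⟨1, 0, 1, 74, 0, 0⟩,
    ⟨4, 37, 112, 37, 18875648, 0⟩,
    ⟨37, 112, 37, 2, 7805512886076527584916549554572235854345484190221932898646130150305955989760, 0⟩,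
    ⟨148, 1, 0, 1, 80945747357608241073874250722658727475608307756388148479465833171127300289392511027734208821530799905162884367938241806889719061583912029812056436120046279768735624729042572139969365313300541737922191456591294957531354094342086470146367621003791433338742946616559691431718818564765823068055557173243364954505856, 6⟩]⟩

theorem E11_ok : EDok E11 := ED_sound E11 (by decide +kernel)

/-- character data modulo 481 with values modulo 73 -/
def E12 : ED := ⟨481, 73, 208105416025557314241454367139779922368951059822531093124941330566791751654813564117552955242088293908704474628316809619098564826955840736779767858194280403871115340712202296963781328015816296609973791864039433495132371503735487591407728317754803432301144843629249370533162312689812174115610810378604272454528533454225727239216446310725253473510266613120834558002119552454260796932014675426507783120446575335688413508875483974320147992536031698434505542840055492035065503035207926054957104677074164466528841605627771677319920663726529445332327963016533846343262388448279019283585890675650509065302251565630643829825487149208647242353883218524350542843317287854317652828263840786714677186724293126431503219907671203874443908426610764087152912768748730900398020135657944971975492988624865860396854200353531929292638422285511948617047986353564239544679463478152072199333010311343358750456263949343377056727849637853985808631453959559192246217919201773359660413353025765816577016299975424450361462843790178603001544832,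
  [(13, 1403337975842084527819243648), (37, 11308268333504728937910978537732171642308010489813886080743589397672368406656)],
   [⟨13, 222, 260, 37, 5771259414575450759413760, 32⟩,
    ⟨37, 260, 222, 13, 168105007997956283430584325619738032164700058710044628553964647930940927711488, 0⟩,
    ⟨481, 1, 0, 1, 81917337307200899326903545832669176734167805108105667951739700422377618934655938390339761371541112027754764791044169074207334305326041860153421105008416808047812699924115416658944400703966029876480221157775661051315369418794611302583238595179815264560176465520269156137454856181483001101076107037412046346918321463631339970322765526497493703400516704904149446118562655292603353364976078741309581778699331378095818354442677160564973269457914667127944922169667955228852305762124727230013806705086068555996170974865805473408444569416050911890975942125857466860144007557172042487669508075248100670226774475873214466872962978184394298254402995155709252542331406031632161558315907909772970589668409328765733451900776060089872314206244353375663078298000515643068215494678362045781048308859591086805753729043942022095613368428781096357208638575669715816434033836966747191798933973081196774728027241346976203321491219827471421415387127035352707906821979096235060738989949791713621777493178210661929777430592274930617226880, 66⟩]⟩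

theorem E12_ok : EDok E12 := ED_sound E12 (by decide +kernel)


/-! Local tests -/
noncomputable def nt (p mask x y : ℕ) : Bool :=
  Nat.beq (Nat.mod (Nat.div mask (Nat.pow (nat_lit 2) (Nat.mod (Nat.mul x (Nat.add (Nat.mul x (Nat.mul y y)) (nat_lit 4))) p))) (nat_lit 2)) (nat_lit 1)

noncomputable def eqT (r X B C x y : ℕ) : Bool :=
  Nat.beq (Nat.mod (Nat.add (Nat.mul X B) (Nat.mul (Nat.mod (Nat.mul C (Nat.add (Nat.mul x X) (nat_lit 1))) r) y)) r) (nat_lit 0)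

def maskOK (p mask : ℕ) : Prop := 0 < p ∧ ∀ d < p, mask / 2^d % 2 = 1 ∨ ∃ z < p, z^2 % p = d

def PL : List ℕ := [3,5,7,13,19,37,73]
def Mtot : ℕ := 4*3*5*7*13*19*37*73

structure SolP (a n : ℕ) : Prop where
  ha : Odd a
  hn : n % 4 = 1
  hnt : ∀ p mask, maskOK p mask → p ∈ PL → p ≠ a → nt p mask a n = true
  heq : ∀ E : ED, EDok E → ∀ (c : ℕ) (ps : List ℕ), (c = 1 ∨ c = 4) → E.q = c * ps.prod → ps.Nodup →
    (∀ p ∈ E.r :: ps, p ∈ PL ∧ p ≠ a) → eqT E.r (lk E.xt (a % E.q)) (E.B a n) (E.C a n) a n = true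

lemma nt_congr {p : ℕ} (mask : ℕ) {x y x' y' : ℕ} (hx : x % p = x' % p) (hy : y % p = y' % p) :
    nt p mask x y = nt p mask x' y' := by
  have : (x * (x * (y*y) + 4)) % p = (x' * (x' * (y'*y') + 4)) % p := by
    have h1 : x ≡ x' [MOD p] := hx
    have h2 : y ≡ y' [MOD p] := hy
    exact (h1.mul ((h1.mul (h2.mul h2)).add_right 4))
  unfold nt
  have e : Nat.mod (Nat.mul x (Nat.add (Nat.mul x (Nat.mul y y)) (nat_lit 4))) p =
    Nat.mod (Nat.mul x' (Nat.add (Nat.mul x' (Nat.mul y' y')) (nat_lit 4))) p := this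
  rw [e]

lemma nt_of {p mask a n : ℕ} (hm : maskOK p mask) (h : ∀ x : ℤ, ¬ (p:ℤ) ∣ x^2 - DD a n) : nt p mask a n = true := by
  obtain ⟨hp, hm⟩ := hm
  rcases hm ((a * (a * (n*n) + 4)) % p) (Nat.mod_lt _ hp) with h1 | ⟨z, _, hz⟩
  · unfold nt
    rw [Nat.beq_eq]
    exact h1
  · exfalso
    apply h z
    have : (DD a n) ≡ z^2 [MOD p] := by
      unfold Nat.ModEq
      rw [hz]
      congr 1
      unfold DD; ring
    have := (Nat.modEq_iff_dvd.mp this)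
    push_cast at this
    exact this

lemma eqT_iff {r X B C x y : ℕ} : eqT r X B C x y = true ↔ ((X:ZMod r) * B + C * (x * X + 1) * y = 0) := by
  unfold eqT
  rw [Nat.beq_eq]
  have : Nat.mod (Nat.add (Nat.mul X B) (Nat.mul (Nat.mod (Nat.mul C (Nat.add (Nat.mul x X) (nat_lit 1))) r) y)) r = (X*B + (C * (x*X+1) % r) * y) % r := rfl
  rw [this, ← Nat.dvd_iff_mod_eq_zero, ← ZMod.natCast_eq_zero_iff]
  push_cast
  rw [ZMod.natCast_mod]
  push_cast
  rfl

lemma notdvd_of {p a n : ℕ} (h : ∀ x : ℤ, ¬ (p:ℤ) ∣ x^2 - DD a n) : ¬ p ∣ DD a n := by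
  intro hd
  apply h 0
  have : (p:ℤ) ∣ (DD a n : ℤ) := by exact_mod_cast hd
  simpa using this

lemma PL_prime {p : ℕ} (h : p ∈ PL) : p.Prime ∧ p ≠ 2 ∧ p ∣ Mtot ∧ p ≤ 73 := by
  simp only [PL, List.mem_cons, List.not_mem_nil, or_false] at h
  rcases h with rfl | rfl | rfl | rfl | rfl | rfl | rfl <;> refine ⟨by norm_num, by norm_num, by norm_num [Mtot], by norm_num⟩

lemma listM1 {a n : ℕ} (ps : List ℕ) (hnd : ps.Nodup) (h : ∀ p ∈ ps, p ∈ PL ∧ ¬ p ∣ DD a n) :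
    HasM1 a n ps.prod ∧ Nat.Coprime ps.prod (DD a n) ∧ Nat.Coprime 4 ps.prod := by
  induction ps with
  | nil => refine ⟨⟨0, 0, by simp⟩, by simp, by simp⟩
  | cons p ps ih =>
    obtain ⟨h1, h2⟩ := List.nodup_cons.mp hnd
    obtain ⟨i1, i2, i3⟩ := ih h2 (fun q hq => h q (List.mem_cons_of_mem _ hq))
    obtain ⟨hp, hpD⟩ := h p (List.mem_cons_self ..)
    obtain ⟨pp, p2, _⟩ := PL_prime hp
    rw [List.prod_cons]
    refine ⟨hasM1_mul ?_ (hasM1_prime pp p2 hpD) i1, Nat.Coprime.mul_left ((Nat.Prime.coprime_iff_not_dvd pp).mpr hpD) i2,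
      Nat.Coprime.mul_right ?_ i3⟩
    · rw [Nat.coprime_list_prod_right_iff]
      intro q hq
      rw [Nat.coprime_primes pp (PL_prime (h q (List.mem_cons_of_mem _ hq)).1).1]
      rintro rfl
      exact h1 hq
    · have : Nat.Coprime 2 p := (Nat.coprime_primes Nat.prime_two pp).mpr (Ne.symm p2)
      exact Nat.Coprime.pow_left 2 this

lemma prod_dvd_Mtot {c : ℕ} (hc : c = 1 ∨ c = 4) (ps : List ℕ) (hnd : ps.Nodup) (h : ∀ p ∈ ps, p ∈ PL) : c * ps.prod ∣ Mtot := by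
  have h1 : ps.prod ∣ PL.prod := by
    have hs : ps.Subperm PL := hnd.subperm h
    obtain ⟨l, hl, hl'⟩ := hs
    rw [← hl.prod_eq]
    exact hl'.prod_dvd_prod
  have : Mtot = 4 * PL.prod := by norm_num [Mtot, PL]
  rw [this]
  apply Nat.mul_dvd_mul _ h1
  rcases hc with rfl | rfl <;> norm_num

theorem good_of {a n : ℕ} (ha : Odd a) (hn : Odd n) [IsDomain (RR a n)] [IsPrincipalIdealRing (RR a n)] (hbig : 109 < a*n) :
    ∃ n', SolP a n' := by
  have hin : ∀ p ∈ PL, p ≠ a → ∀ x : ℤ, ¬ (p:ℤ) ∣ x^2 - DD a n := by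
    intro p hp hpa
    obtain ⟨h1, h2, _, h3⟩ := PL_prime hp
    exact inert_small ha hn p h1 h2 hpa (by omega)
  -- choice of the sign
  obtain ⟨n', h4, s, hs, hcong⟩ : ∃ n' : ℕ, n' % 4 = 1 ∧ ∃ s : ℤ, (s = 1 ∨ s = -1) ∧ (Mtot:ℤ) ∣ n' - s*n := by
    have h2 : n % 2 = 1 := Nat.odd_iff.mp hn
    by_cases h : n % 4 = 1
    · exact ⟨n, h, 1, Or.inl rfl, by simp⟩
    · refine ⟨(Mtot-1)*n, ?_, -1, Or.inr rfl, n, ?_⟩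
      · have : Mtot - 1 = 4*(7*13*15*19*37*73) - 1 := by norm_num [Mtot]
        have e : (Mtot - 1) % 4 = 3 := by rw [this]
        rw [Nat.mul_mod, e]
        have : n % 4 = 3 := by omega
        rw [this]
      · push_cast [show 1 ≤ Mtot by norm_num [Mtot]]
        ring
  have hn' : Odd n' := Nat.odd_iff.mpr (by omega)
  have hz : ∀ k : ℕ, k ∣ Mtot → (n' : ZMod k) = s * n := by
    intro k hk
    have : (k:ℤ) ∣ n' - s*n := dvd_trans (by exact_mod_cast hk) hcong
    rw [← ZMod.intCast_zmod_eq_zero_iff_dvd] at this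
    push_cast at this
    exact sub_eq_zero.mp this
  have hs2 : s^2 = 1 := by rcases hs with rfl | rfl <;> norm_num
  refine ⟨n', ha, h4, ?_, ?_⟩
  · intro p mask hm hp hpa
    apply nt_of hm
    intro x hx
    apply hin p hp hpa x
    obtain ⟨_, _, h3, _⟩ := PL_prime hp
    obtain ⟨k, hk⟩ := dvd_trans (show (p:ℤ) ∣ Mtot by exact_mod_cast h3) hcong
    have e : (x^2 - (DD a n : ℤ)) = (x^2 - (DD a n' : ℤ)) + p * (k*a^2*(n'+s*n)) := by
      unfold DD; push_cast
      linear_combination (a^2*((n':ℤ)+s*n)) * hk + (a:ℤ)^2*n^2 * hs2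
    rw [e]
    exact dvd_add hx (dvd_mul_right _ _)
  · intro E hE c ps hc hq hnd hps
    haveI : NeZero E.q := ⟨by have := hE.hq; omega⟩
    obtain ⟨hr, hra⟩ := hps E.r (List.mem_cons_self ..)
    obtain ⟨rp, r2, rM, _⟩ := PL_prime hr
    have hpp : ∀ p ∈ ps, p ∈ PL ∧ ¬ p ∣ DD a n := fun p hp => 
      ⟨(hps p (List.mem_cons_of_mem _ hp)).1, notdvd_of (hin p (hps p (List.mem_cons_of_mem _ hp)).1 (hps p (List.mem_cons_of_mem _ hp)).2)⟩
    obtain ⟨l1, l2, l3⟩ := listM1 ps hnd hpp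
    have hqM : E.q ∣ Mtot := by rw [hq]; exact prod_dvd_Mtot hc ps hnd (fun p hp => (hpp p hp).1)
    have hm : HasM1 a n E.q ∧ Nat.Coprime E.q (DD a n) := by
      rw [hq]
      rcases hc with rfl | rfl
      · rw [one_mul]; exact ⟨l1, l2⟩
      · refine ⟨hasM1_mul l3 (hasM1_four ha hn) l1, Nat.Coprime.mul_left ?_ l2⟩
        have : Nat.Coprime 2 (DD a n) := by
          rw [Nat.coprime_two_left, Nat.odd_iff]
          have := DD_mod8 ha hn
          omega
        exact Nat.Coprime.pow_left 2 this
    have key := eqn_mod ha hn E.q E.r rp r2 (notdvd_of (hin _ hr hra)) hm.2 E.X hE.hX hE.hX1 hE.hS hm.1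
    rw [eqT_iff, EB_eq E hE a n' ha hn', EC_eq E hE a n' ha hn', hz _ hqM, hz _ rM]
    have hXa : ((lk E.xt (a % E.q) : ℕ) : ZMod E.r) = E.X (a : ZMod E.q) := by
      unfold ED.X; exact lk_cast _ _
    rw [hXa]
    rcases hs with rfl | rfl
    · push_cast
      rw [one_mul, one_mul]
      linear_combination key
    · push_cast
      rw [neg_one_mul, neg_one_mul, T1_neg, T2_neg]
      linear_combination -key

/-! Loops and tests with their specifications -/
noncomputable def ext (M p x y : ℕ) (k : ℕ → ℕ → Bool) : Bool :=
  allN p fun i => force (Nat.add x (Nat.mul M i)) fun x' => allN p fun j => force (Nat.add y (Nat.mul M j)) fun y' => k x' y'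

noncomputable def extn (M p y : ℕ) (k : ℕ → Bool) : Bool :=
  allN p fun j => force (Nat.add y (Nat.mul M j)) fun y' => k y'

noncomputable def tE (E : ED) (x y : ℕ) (k : Bool) : Bool :=
  evE E x y fun B C => impB (eqT E.r (lk E.xt (Nat.mod x E.q)) B C x y) k

noncomputable def pairE (E F : ED) (r M x y : ℕ) (k : ℕ → ℕ → Bool) : Bool :=
  evE E x y fun B C => evE F x y fun B' C' =>
  force (lk E.xt (Nat.mod x E.q)) fun X => force (lk F.xt (Nat.mod x F.q)) fun X' =>
  force (Nat.mul X B) fun P => force (Nat.mul X' B') fun P' =>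
  allN r fun i => force (Nat.add x (Nat.mul M i)) fun x1 =>
    force (Nat.mod (Nat.mul C (Nat.add (Nat.mul x1 X) (nat_lit 1))) r) fun W =>
    force (Nat.mod (Nat.mul C' (Nat.add (Nat.mul x1 X') (nat_lit 1))) r) fun W' =>
    impB (Nat.beq (Nat.mod (Nat.mul P W') r) (Nat.mod (Nat.mul P' W) r)) 
     (allN r fun j => force (Nat.add y (Nat.mul M j)) fun y1 =>
       impB (Nat.beq (Nat.mod (Nat.add P (Nat.mul W y1)) r) (nat_lit 0))
        (impB (Nat.beq (Nat.mod (Nat.add P' (Nat.mul W' y1)) r) (nat_lit 0)) (k x1 y1)))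

lemma ext_mod (a M p : ℕ) : a % M + M * (a / M % p) = a % (M*p) := (Nat.mod_mul ..).symm

lemma ext_spec {M p a n : ℕ} (hp : 0 < p) {k : ℕ → ℕ → Bool} (h : ext M p (a%M) (n%M) k = true) : k (a%(M*p)) (n%(M*p)) = true := by
  unfold ext at h
  have h1 := allN_spec h _ (Nat.mod_lt (a/M) hp)
  rw [force_eq] at h1
  have h2 := allN_spec h1 _ (Nat.mod_lt (n/M) hp)
  rw [force_eq] at h2
  rw [← ext_mod, ← ext_mod]
  exact h2

lemma extn_spec {M p n : ℕ} (hp : 0 < p) {k : ℕ → Bool} (h : extn M p (n%M) k = true) : k (n%(M*p)) = true := by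
  unfold extn at h
  have h2 := allN_spec h _ (Nat.mod_lt (n/M) hp)
  rw [force_eq] at h2
  rw [← ext_mod]
  exact h2

lemma B_congr (E : ED) {x y x' y' : ℕ} (hx : x % E.q = x' % E.q) (hy : y % E.q = y' % E.q) : E.B x y = E.B x' y' := by
  unfold ED.B
  rw [hx, Nat.mul_mod _ y, hy, ← Nat.mul_mod]
lemma C_congr (E : ED) {x y x' y' : ℕ} (hx : x % E.q = x' % E.q) (hy : y % E.q = y' % E.q) : E.C x y = E.C x' y' := by
  unfold ED.C
  rw [hx, Nat.mul_mod _ y, hy, ← Nat.mul_mod]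

lemma cast_eq_of_mod {r x y : ℕ} (h : x % r = y % r) : (x : ZMod r) = y := (ZMod.natCast_eq_natCast_iff _ _ _).mpr h

/-- side conditions for the use of a character -/
structure Ad (E : ED) (a c : ℕ) (ps : List ℕ) : Prop where
  ok : EDok E
  hc : c = 1 ∨ c = 4
  hq : E.q = c * ps.prod
  nd : ps.Nodup
  hp : ∀ p ∈ E.r :: ps, p ∈ PL ∧ p ≠ a

lemma tE_spec {a n c x y : ℕ} {ps : List ℕ} (G : SolP a n) {E : ED} (hE : Ad E a c ps) {k : Bool}
    (hx : x % E.q = a % E.q) (hy : y % E.q = n % E.q) (hx' : x % E.r = a % E.r) (hy' : y % E.r = n % E.r)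
    (h : tE E x y k = true) : k = true := by
  unfold tE at h
  rw [evE_eq E hE.ok] at h
  apply impB_spec h
  have := G.heq E hE.ok c ps hE.hc hE.hq hE.nd hE.hp
  rw [eqT_iff] at this ⊢
  rw [B_congr E hx hy, C_congr E hx hy, cast_eq_of_mod hx', cast_eq_of_mod hy']
  have e : Nat.mod x E.q = a % E.q := hx
  rw [e]; exact this

lemma nt_spec {a n p mask x y : ℕ} (G : SolP a n) (hm : maskOK p mask) (hp : p ∈ PL) (hpa : p ≠ a)
    (hx : x % p = a % p) (hy : y % p = n % p) {k : Bool} (h : impB (nt p mask x y) k = true) : k = true := by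
  apply impB_spec h
  rw [nt_congr mask hx hy]
  exact G.hnt p mask hm hp hpa

lemma eqT_parts {r X B C x y : ℕ} : eqT r X B C x y = 
  Nat.beq (Nat.mod (Nat.add (Nat.mul X B) (Nat.mul (Nat.mod (Nat.mul C (Nat.add (Nat.mul x X) (nat_lit 1))) r) y)) r) (nat_lit 0) := rfl

lemma pairE_spec {a n c c' r M : ℕ} {ps ps' : List ℕ} (G : SolP a n) {E F : ED} (hE : Ad E a c ps) (hF : Ad F a c' ps')
    (hr : E.r = r) (hr' : F.r = r) (hM : E.q ∣ M) (hM' : F.q ∣ M) {k : ℕ → ℕ → Bool}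
    (h : pairE E F r M (a%M) (n%M) k = true) : k (a%(M*r)) (n%(M*r)) = true := by
  unfold pairE at h
  rw [evE_eq E hE.ok, evE_eq F hF.ok] at h
  simp only [force_eq] at h
  have r0 : 0 < r := by have := hE.ok.hr; omega
  have h1 := G.heq E hE.ok c ps hE.hc hE.hq hE.nd hE.hp
  have h2 := G.heq F hF.ok c' ps' hF.hc hF.hq hF.nd hF.hp
  have m1 : ∀ z : ℕ, z % M % E.q = z % E.q := fun z => Nat.mod_mod_of_dvd _ hM
  have m2 : ∀ z : ℕ, z % M % F.q = z % F.q := fun z => Nat.mod_mod_of_dvd _ hM'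
  rw [B_congr E (m1 a) (m1 n), C_congr E (m1 a) (m1 n), B_congr F (m2 a) (m2 n), C_congr F (m2 a) (m2 n)] at h
  rw [show Nat.mod (a % M) E.q = a % E.q from m1 a, show Nat.mod (a % M) F.q = a % F.q from m2 a] at h
  rw [hr] at h1
  rw [hr'] at h2
  generalize E.B a n = B at *
  generalize E.C a n = C at *
  generalize F.B a n = B' at *
  generalize F.C a n = C' at *
  generalize lk E.xt (a % E.q) = X at *
  generalize lk F.xt (a % F.q) = X' at *
  have h3 := allN_spec h _ (Nat.mod_lt (a/M) r0)
  rw [show Nat.add (a % M) (Nat.mul M (a / M % r)) = a % (M*r) from ext_mod _ _ _] at h3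
  have ea : ((a % (M*r) : ℕ) : ZMod r) = a := cast_eq_of_mod (Nat.mod_mod_of_dvd _ (dvd_mul_left _ _))
  have en : ((n % (M*r) : ℕ) : ZMod r) = n := cast_eq_of_mod (Nat.mod_mod_of_dvd _ (dvd_mul_left _ _))
  have h1' : eqT r X B C (a%(M*r)) (n%(M*r)) = true := by rw [eqT_iff, ea, en]; rwa [eqT_iff] at h1
  have h2' : eqT r X' B' C' (a%(M*r)) (n%(M*r)) = true := by rw [eqT_iff, ea, en]; rwa [eqT_iff] at h2
  rw [eqT_iff] at h1 h2
  have h4 := impB_spec h3 (by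
    rw [Nat.beq_eq]
    have : (X*B * (C' * ((a%(M*r))*X'+1) % r)) % r = (X'*B' * (C * ((a%(M*r))*X+1) % r)) % r := by
      rw [← Nat.ModEq, ← ZMod.natCast_eq_natCast_iff]
      push_cast
      rw [ZMod.natCast_mod, ZMod.natCast_mod]
      push_cast
      have ea' := ea
      rw [ea']
      linear_combination (C' * (a*X'+1) : ZMod r) * h1 - (C * (a*X+1) : ZMod r) * h2
    exact this)
  have h5 := allN_spec h4 _ (Nat.mod_lt (n/M) r0)
  rw [show Nat.add (n % M) (Nat.mul M (n / M % r)) = n % (M*r) from ext_mod _ _ _] at h5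
  exact impB_spec (impB_spec h5 h1') h2'


/-- nonresidues modulo 3 -/
def mk3 : ℕ := 4
lemma mk3_ok : maskOK 3 mk3 := by unfold maskOK mk3; decide +kernel
/-- nonresidues modulo 5 -/
def mk5 : ℕ := 12
lemma mk5_ok : maskOK 5 mk5 := by unfold maskOK mk5; decide +kernel
/-- nonresidues modulo 7 -/
def mk7 : ℕ := 104
lemma mk7_ok : maskOK 7 mk7 := by unfold maskOK mk7; decide +kernel
/-- nonresidues modulo 13 -/
def mk13 : ℕ := 2532
lemma mk13_ok : maskOK 13 mk13 := by unfold maskOK mk13; decide +kernel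
/-- nonresidues modulo 19 -/
def mk19 : ℕ := 324876
lemma mk19_ok : maskOK 19 mk19 := by unfold maskOK mk19; decide +kernel
/-- nonresidues modulo 37 -/
def mk37 : ℕ := 41370444132
lemma mk37_ok : maskOK 37 mk37 := by unfold maskOK mk37; decide +kernel
/-- nonresidues modulo 73 -/
def mk73 : ℕ := 384875580742593342624
lemma mk73_ok : maskOK 73 mk73 := by unfold maskOK mk73; decide +kernel
lemma Ad0 {a : ℕ} (h3 : 3 ≠ a) (h5 : 5 ≠ a) (h7 : 7 ≠ a) (h13 : 13 ≠ a) : Ad E0 a 1 [3, 5, 7] := by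
  refine ⟨E0_ok, by norm_num, by decide +kernel, by decide, ?_⟩
  intro p hp
  have hp' : p = 13 ∨ p = 3 ∨ p = 5 ∨ p = 7 := by
    rcases List.mem_cons.mp hp with h | h
    · exact Or.inl h
    · right; simpa using h
  rcases hp' with rfl | rfl | rfl | rfl
  · exact ⟨by decide, h13⟩
  · exact ⟨by decide, h3⟩
  · exact ⟨by decide, h5⟩
  · exact ⟨by decide, h7⟩
lemma Ad1 {a : ℕ} (h3 : 3 ≠ a) (h5 : 5 ≠ a) (h7 : 7 ≠ a) (h13 : 13 ≠ a) : Ad E1 a 4 [3, 5, 7] := by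
  refine ⟨E1_ok, by norm_num, by decide +kernel, by decide, ?_⟩
  intro p hp
  have hp' : p = 13 ∨ p = 3 ∨ p = 5 ∨ p = 7 := by
    rcases List.mem_cons.mp hp with h | h
    · exact Or.inl h
    · right; simpa using h
  rcases hp' with rfl | rfl | rfl | rfl
  · exact ⟨by decide, h13⟩
  · exact ⟨by decide, h3⟩
  · exact ⟨by decide, h5⟩
  · exact ⟨by decide, h7⟩
lemma Ad2 {a : ℕ} (h5 : 5 ≠ a) (h7 : 7 ≠ a) (h13 : 13 ≠ a) : Ad E2 a 4 [5, 7] := by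
  refine ⟨E2_ok, by norm_num, by decide +kernel, by decide, ?_⟩
  intro p hp
  have hp' : p = 13 ∨ p = 5 ∨ p = 7 := by
    rcases List.mem_cons.mp hp with h | h
    · exact Or.inl h
    · right; simpa using h
  rcases hp' with rfl | rfl | rfl
  · exact ⟨by decide, h13⟩
  · exact ⟨by decide, h5⟩
  · exact ⟨by decide, h7⟩
lemma Ad3 {a : ℕ} (h7 : 7 ≠ a) (h13 : 13 ≠ a) (h37 : 37 ≠ a) : Ad E3 a 1 [7, 13] := by
  refine ⟨E3_ok, by norm_num, by decide +kernel, by decide, ?_⟩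
  intro p hp
  have hp' : p = 37 ∨ p = 7 ∨ p = 13 := by
    rcases List.mem_cons.mp hp with h | h
    · exact Or.inl h
    · right; simpa using h
  rcases hp' with rfl | rfl | rfl
  · exact ⟨by decide, h37⟩
  · exact ⟨by decide, h7⟩
  · exact ⟨by decide, h13⟩
lemma Ad4 {a : ℕ} (h3 : 3 ≠ a) (h7 : 7 ≠ a) (h13 : 13 ≠ a) (h37 : 37 ≠ a) : Ad E4 a 1 [3, 7, 13] := by
  refine ⟨E4_ok, by norm_num, by decide +kernel, by decide, ?_⟩
  intro p hp
  have hp' : p = 37 ∨ p = 3 ∨ p = 7 ∨ p = 13 := by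
    rcases List.mem_cons.mp hp with h | h
    · exact Or.inl h
    · right; simpa using h
  rcases hp' with rfl | rfl | rfl | rfl
  · exact ⟨by decide, h37⟩
  · exact ⟨by decide, h3⟩
  · exact ⟨by decide, h7⟩
  · exact ⟨by decide, h13⟩
lemma Ad5 {a : ℕ} (h7 : 7 ≠ a) (h37 : 37 ≠ a) : Ad E5 a 4 [37] := by
  refine ⟨E5_ok, by norm_num, by decide +kernel, by decide, ?_⟩
  intro p hp
  have hp' : p = 7 ∨ p = 37 := by
    rcases List.mem_cons.mp hp with h | h
    · exact Or.inl h
    · right; simpa using h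
  rcases hp' with rfl | rfl
  · exact ⟨by decide, h7⟩
  · exact ⟨by decide, h37⟩
lemma Ad6 {a : ℕ} (h5 : 5 ≠ a) (h13 : 13 ≠ a) (h37 : 37 ≠ a) : Ad E6 a 1 [5, 37] := by
  refine ⟨E6_ok, by norm_num, by decide +kernel, by decide, ?_⟩
  intro p hp
  have hp' : p = 13 ∨ p = 5 ∨ p = 37 := by
    rcases List.mem_cons.mp hp with h | h
    · exact Or.inl h
    · right; simpa using h
  rcases hp' with rfl | rfl | rfl
  · exact ⟨by decide, h13⟩
  · exact ⟨by decide, h5⟩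
  · exact ⟨by decide, h37⟩
lemma Ad7 {a : ℕ} (h3 : 3 ≠ a) (h7 : 7 ≠ a) (h13 : 13 ≠ a) (h73 : 73 ≠ a) : Ad E7 a 1 [3, 7, 13] := by
  refine ⟨E7_ok, by norm_num, by decide +kernel, by decide, ?_⟩
  intro p hp
  have hp' : p = 73 ∨ p = 3 ∨ p = 7 ∨ p = 13 := by
    rcases List.mem_cons.mp hp with h | h
    · exact Or.inl h
    · right; simpa using h
  rcases hp' with rfl | rfl | rfl | rfl
  · exact ⟨by decide, h73⟩
  · exact ⟨by decide, h3⟩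
  · exact ⟨by decide, h7⟩
  · exact ⟨by decide, h13⟩
lemma Ad8 {a : ℕ} (h5 : 5 ≠ a) (h7 : 7 ≠ a) (h13 : 13 ≠ a) (h73 : 73 ≠ a) : Ad E8 a 1 [5, 7, 13] := by
  refine ⟨E8_ok, by norm_num, by decide +kernel, by decide, ?_⟩
  intro p hp
  have hp' : p = 73 ∨ p = 5 ∨ p = 7 ∨ p = 13 := by
    rcases List.mem_cons.mp hp with h | h
    · exact Or.inl h
    · right; simpa using h
  rcases hp' with rfl | rfl | rfl | rfl
  · exact ⟨by decide, h73⟩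
  · exact ⟨by decide, h5⟩
  · exact ⟨by decide, h7⟩
  · exact ⟨by decide, h13⟩
lemma Ad9 {a : ℕ} (h5 : 5 ≠ a) (h7 : 7 ≠ a) (h13 : 13 ≠ a) (h73 : 73 ≠ a) : Ad E9 a 1 [5, 7, 13] := by
  refine ⟨E9_ok, by norm_num, by decide +kernel, by decide, ?_⟩
  intro p hp
  have hp' : p = 73 ∨ p = 5 ∨ p = 7 ∨ p = 13 := by
    rcases List.mem_cons.mp hp with h | h
    · exact Or.inl h
    · right; simpa using h
  rcases hp' with rfl | rfl | rfl | rfl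
  · exact ⟨by decide, h73⟩
  · exact ⟨by decide, h5⟩
  · exact ⟨by decide, h7⟩
  · exact ⟨by decide, h13⟩
lemma Ad10 {a : ℕ} (h3 : 3 ≠ a) (h19 : 19 ≠ a) (h37 : 37 ≠ a) : Ad E10 a 1 [3, 37] := by
  refine ⟨E10_ok, by norm_num, by decide +kernel, by decide, ?_⟩
  intro p hp
  have hp' : p = 19 ∨ p = 3 ∨ p = 37 := by
    rcases List.mem_cons.mp hp with h | h
    · exact Or.inl h
    · right; simpa using h
  rcases hp' with rfl | rfl | rfl
  · exact ⟨by decide, h19⟩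
  · exact ⟨by decide, h3⟩
  · exact ⟨by decide, h37⟩
lemma Ad11 {a : ℕ} (h19 : 19 ≠ a) (h37 : 37 ≠ a) : Ad E11 a 4 [37] := by
  refine ⟨E11_ok, by norm_num, by decide +kernel, by decide, ?_⟩
  intro p hp
  have hp' : p = 19 ∨ p = 37 := by
    rcases List.mem_cons.mp hp with h | h
    · exact Or.inl h
    · right; simpa using h
  rcases hp' with rfl | rfl
  · exact ⟨by decide, h19⟩
  · exact ⟨by decide, h37⟩
lemma Ad12 {a : ℕ} (h13 : 13 ≠ a) (h37 : 37 ≠ a) (h73 : 73 ≠ a) : Ad E12 a 1 [13, 37] := by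
  refine ⟨E12_ok, by norm_num, by decide +kernel, by decide, ?_⟩
  intro p hp
  have hp' : p = 73 ∨ p = 13 ∨ p = 37 := by
    rcases List.mem_cons.mp hp with h | h
    · exact Or.inl h
    · right; simpa using h
  rcases hp' with rfl | rfl | rfl
  · exact ⟨by decide, h73⟩
  · exact ⟨by decide, h13⟩
  · exact ⟨by decide, h37⟩

noncomputable def dG5 (x y : ℕ) : Bool := impB (nt (nat_lit 73) mk73 x y) (tE E9 x y (tE E1 x y false))
noncomputable def dG4 (x y : ℕ) : Bool := impB (nt (nat_lit 37) mk37 x y) (tE E5 x y (tE E6 x y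
  (pairE E7 E8 (nat_lit 73) (nat_lit 202020) x y dG5)))
noncomputable def dG3 (x y : ℕ) : Bool := impB (nt (nat_lit 13) mk13 x y) (pairE E3 E4 (nat_lit 37) (nat_lit 5460) x y dG4)
noncomputable def dG2 (x y : ℕ) : Bool := impB (nt (nat_lit 3) mk3 x y) (pairE E0 E2 (nat_lit 13) (nat_lit 420) x y dG3)
noncomputable def dG1 (x y : ℕ) : Bool := impB (Nat.beq (Nat.mod x (nat_lit 2)) (nat_lit 1)) (impB (Nat.beq (Nat.mod y (nat_lit 4)) (nat_lit 1))
  (ext (nat_lit 140) (nat_lit 3) x y dG2))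
noncomputable def dG0 (x y : ℕ) : Bool := impB (nt (nat_lit 7) mk7 x y) (ext (nat_lit 35) (nat_lit 4) x y dG1)
noncomputable def dG : Bool := ext (nat_lit 1) (nat_lit 5) (nat_lit 0) (nat_lit 0) fun x y => impB (nt (nat_lit 5) mk5 x y)
   (ext (nat_lit 5) (nat_lit 7) x y dG0)

lemma dG_true : dG = true := by decide +kernel


noncomputable def tEn (E : ED) (r M x y : ℕ) (k : ℕ → Bool) : Bool :=
  evE E x y fun B C => force (lk E.xt (Nat.mod x E.q)) fun X => extn M r y fun y1 => impB (eqT r X B C x y1) (k y1)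

lemma tEn_spec {a n c r M : ℕ} {ps : List ℕ} (G : SolP a n) {E : ED} (hE : Ad E a c ps) {k : ℕ → Bool}
    (hr : E.r = r) (hM : E.q ∣ M) (h : tEn E r M a (n%M) k = true) : k (n%(M*r)) = true := by
  unfold tEn at h
  rw [evE_eq E hE.ok, force_eq] at h
  have r0 : 0 < r := by have := hE.ok.hr; omega
  have h1 := G.heq E hE.ok c ps hE.hc hE.hq hE.nd hE.hp
  rw [B_congr E (y := n % M) rfl (Nat.mod_mod_of_dvd n hM), C_congr E (y := n % M) rfl (Nat.mod_mod_of_dvd n hM)] at h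
  have h2 := extn_spec r0 h
  apply impB_spec h2
  rw [hr, eqT_iff] at h1
  rw [eqT_iff, cast_eq_of_mod (Nat.mod_mod_of_dvd n (dvd_mul_left r M))]
  exact h1

lemma generic {a n : ℕ} (G : SolP a n) (h3 : 3 ≠ a) (h5 : 5 ≠ a) (h7 : 7 ≠ a) (h13 : 13 ≠ a) (h37 : 37 ≠ a) (h73 : 73 ≠ a) : False := by
  have h := dG_true
  unfold dG at h
  have e0 : ∀ z, z % 1 = 0 := fun z => Nat.mod_one z
  have h := ext_spec (M := 1) (p := 5) (a := a) (n := n) (by norm_num) (by rw [e0, e0]; exact h)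
  norm_num only at h
  have h := nt_spec G mk5_ok (by decide) h5 (Nat.mod_mod_of_dvd _ (by norm_num)) (Nat.mod_mod_of_dvd _ (by norm_num)) h
  have h := ext_spec (M := 5) (p := 7) (by norm_num) h
  norm_num only at h
  unfold dG0 at h
  have h := nt_spec G mk7_ok (by decide) h7 (Nat.mod_mod_of_dvd _ (by norm_num)) (Nat.mod_mod_of_dvd _ (by norm_num)) h
  have h := ext_spec (M := 35) (p := 4) (by norm_num) h
  norm_num only at h
  unfold dG1 at h
  have h := impB_spec h (by
    rw [Nat.beq_eq]; show a % 140 % 2 = 1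
    have := Nat.odd_iff.mp G.ha
    omega)
  have h := impB_spec h (by
    rw [Nat.beq_eq]; show n % 140 % 4 = 1
    have := G.hn
    omega)
  have h := ext_spec (M := 140) (p := 3) (by norm_num) h
  norm_num only at h
  unfold dG2 at h
  have h := nt_spec G mk3_ok (by decide) h3 (Nat.mod_mod_of_dvd _ (by norm_num)) (Nat.mod_mod_of_dvd _ (by norm_num)) h
  have h := pairE_spec (r := 13) (M := 420) G (Ad0 h3 h5 h7 h13) (Ad2 h5 h7 h13) rfl rfl (by decide +kernel) (by decide +kernel) h
  norm_num only at h
  unfold dG3 at h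
  have h := nt_spec G mk13_ok (by decide) h13 (Nat.mod_mod_of_dvd _ (by norm_num)) (Nat.mod_mod_of_dvd _ (by norm_num)) h
  have h := pairE_spec (r := 37) (M := 5460) G (Ad3 h7 h13 h37) (Ad4 h3 h7 h13 h37) rfl rfl (by decide +kernel) (by decide +kernel) h
  norm_num only at h
  unfold dG4 at h
  have h := nt_spec G mk37_ok (by decide) h37 (Nat.mod_mod_of_dvd _ (by norm_num)) (Nat.mod_mod_of_dvd _ (by norm_num)) h
  have h := tE_spec G (Ad5 h7 h37) (Nat.mod_mod_of_dvd _ (by decide +kernel)) (Nat.mod_mod_of_dvd _ (by decide +kernel)) (Nat.mod_mod_of_dvd _ (by decide +kernel)) (Nat.mod_mod_of_dvd _ (by decide +kernel)) h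
  have h := tE_spec G (Ad6 h5 h13 h37) (Nat.mod_mod_of_dvd _ (by decide +kernel)) (Nat.mod_mod_of_dvd _ (by decide +kernel)) (Nat.mod_mod_of_dvd _ (by decide +kernel)) (Nat.mod_mod_of_dvd _ (by decide +kernel)) h
  have h := pairE_spec (r := 73) (M := 202020) G (Ad7 h3 h7 h13 h73) (Ad8 h5 h7 h13 h73) rfl rfl (by decide +kernel) (by decide +kernel) h
  norm_num only at h
  unfold dG5 at h
  have h := nt_spec G mk73_ok (by decide) h73 (Nat.mod_mod_of_dvd _ (by norm_num)) (Nat.mod_mod_of_dvd _ (by norm_num)) h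
  have h := tE_spec G (Ad9 h5 h7 h13 h73) (Nat.mod_mod_of_dvd _ (by decide +kernel)) (Nat.mod_mod_of_dvd _ (by decide +kernel)) (Nat.mod_mod_of_dvd _ (by decide +kernel)) (Nat.mod_mod_of_dvd _ (by decide +kernel)) h
  have h := tE_spec G (Ad1 h3 h5 h7 h13) (Nat.mod_mod_of_dvd _ (by decide +kernel)) (Nat.mod_mod_of_dvd _ (by decide +kernel)) (Nat.mod_mod_of_dvd _ (by decide +kernel)) (Nat.mod_mod_of_dvd _ (by decide +kernel)) h
  exact absurd h (by simp)

noncomputable def dS3 (y : ℕ) : Bool := 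
  extn (nat_lit 4) (nat_lit 5) y fun y => impB (nt (nat_lit 5) mk5 (nat_lit 3) y) <|
  extn (nat_lit 20) (nat_lit 7) y fun y => impB (nt (nat_lit 7) mk7 (nat_lit 3) y) <|
  tEn E2 (nat_lit 13) (nat_lit 140) (nat_lit 3) y fun y => impB (nt (nat_lit 13) mk13 (nat_lit 3) y) <|
  tEn E3 (nat_lit 37) (nat_lit 1820) (nat_lit 3) y fun y => impB (nt (nat_lit 37) mk37 (nat_lit 3) y) <|
  tE E5 (nat_lit 3) y <| false

lemma dS3_true : dS3 (nat_lit 1) = true := by decide +kernel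

lemma special3 {n : ℕ} (G : SolP 3 n) : False := by
  have h := dS3_true
  unfold dS3 at h
  have e : n % 4 = 1 := G.hn
  have h := extn_spec (M := 4) (p := 5) (n := n) (by norm_num) (by rw [e]; exact h)
  norm_num only at h
  have h := nt_spec G mk5_ok (by decide) (by decide) rfl (Nat.mod_mod_of_dvd _ (by norm_num)) h
  have h := extn_spec (M := 20) (p := 7) (n := n) (by norm_num) h
  norm_num only at h
  have h := nt_spec G mk7_ok (by decide) (by decide) rfl (Nat.mod_mod_of_dvd _ (by norm_num)) h
  have h := tEn_spec (r := 13) (M := 140) G (Ad2 (by decide) (by decide) (by decide)) rfl (by decide +kernel) h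
  norm_num only at h
  have h := nt_spec G mk13_ok (by decide) (by decide) rfl (Nat.mod_mod_of_dvd _ (by norm_num)) h
  have h := tEn_spec (r := 37) (M := 1820) G (Ad3 (by decide) (by decide) (by decide)) rfl (by decide +kernel) h
  norm_num only at h
  have h := nt_spec G mk37_ok (by decide) (by decide) rfl (Nat.mod_mod_of_dvd _ (by norm_num)) h
  have h := tE_spec G (Ad5 (by decide) (by decide)) rfl (Nat.mod_mod_of_dvd _ (by decide +kernel)) rfl (Nat.mod_mod_of_dvd _ (by decide +kernel)) h
  exact absurd h (by simp)

noncomputable def dS5 (y : ℕ) : Bool := 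
  extn (nat_lit 4) (nat_lit 3) y fun y => impB (nt (nat_lit 3) mk3 (nat_lit 5) y) <|
  extn (nat_lit 12) (nat_lit 7) y fun y => impB (nt (nat_lit 7) mk7 (nat_lit 5) y) <|
  extn (nat_lit 84) (nat_lit 13) y fun y => impB (nt (nat_lit 13) mk13 (nat_lit 5) y) <|
  tEn E3 (nat_lit 37) (nat_lit 1092) (nat_lit 5) y fun y => impB (nt (nat_lit 37) mk37 (nat_lit 5) y) <|
  tE E4 (nat_lit 5) y <|
  tE E5 (nat_lit 5) y <| false

lemma dS5_true : dS5 (nat_lit 1) = true := by decide +kernel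

lemma special5 {n : ℕ} (G : SolP 5 n) : False := by
  have h := dS5_true
  unfold dS5 at h
  have e : n % 4 = 1 := G.hn
  have h := extn_spec (M := 4) (p := 3) (n := n) (by norm_num) (by rw [e]; exact h)
  norm_num only at h
  have h := nt_spec G mk3_ok (by decide) (by decide) rfl (Nat.mod_mod_of_dvd _ (by norm_num)) h
  have h := extn_spec (M := 12) (p := 7) (n := n) (by norm_num) h
  norm_num only at h
  have h := nt_spec G mk7_ok (by decide) (by decide) rfl (Nat.mod_mod_of_dvd _ (by norm_num)) h
  have h := extn_spec (M := 84) (p := 13) (n := n) (by norm_num) h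
  norm_num only at h
  have h := nt_spec G mk13_ok (by decide) (by decide) rfl (Nat.mod_mod_of_dvd _ (by norm_num)) h
  have h := tEn_spec (r := 37) (M := 1092) G (Ad3 (by decide) (by decide) (by decide)) rfl (by decide +kernel) h
  norm_num only at h
  have h := nt_spec G mk37_ok (by decide) (by decide) rfl (Nat.mod_mod_of_dvd _ (by norm_num)) h
  have h := tE_spec G (Ad4 (by decide) (by decide) (by decide) (by decide)) rfl (Nat.mod_mod_of_dvd _ (by decide +kernel)) rfl (Nat.mod_mod_of_dvd _ (by decide +kernel)) h
  have h := tE_spec G (Ad5 (by decide) (by decide)) rfl (Nat.mod_mod_of_dvd _ (by decide +kernel)) rfl (Nat.mod_mod_of_dvd _ (by decide +kernel)) h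
  exact absurd h (by simp)

noncomputable def dS7 (y : ℕ) : Bool := 
  extn (nat_lit 4) (nat_lit 3) y fun y => impB (nt (nat_lit 3) mk3 (nat_lit 7) y) <|
  extn (nat_lit 12) (nat_lit 5) y fun y => impB (nt (nat_lit 5) mk5 (nat_lit 7) y) <|
  extn (nat_lit 60) (nat_lit 37) y fun y => impB (nt (nat_lit 37) mk37 (nat_lit 7) y) <|
  tEn E6 (nat_lit 13) (nat_lit 2220) (nat_lit 7) y fun y => impB (nt (nat_lit 13) mk13 (nat_lit 7) y) <|
  tEn E10 (nat_lit 19) (nat_lit 28860) (nat_lit 7) y fun y => impB (nt (nat_lit 19) mk19 (nat_lit 7) y) <|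
  tE E11 (nat_lit 7) y <|
  tEn E12 (nat_lit 73) (nat_lit 548340) (nat_lit 7) y fun y => impB (nt (nat_lit 73) mk73 (nat_lit 7) y) <| false

lemma dS7_true : dS7 (nat_lit 1) = true := by decide +kernel

lemma special7 {n : ℕ} (G : SolP 7 n) : False := by
  have h := dS7_true
  unfold dS7 at h
  have e : n % 4 = 1 := G.hn
  have h := extn_spec (M := 4) (p := 3) (n := n) (by norm_num) (by rw [e]; exact h)
  norm_num only at h
  have h := nt_spec G mk3_ok (by decide) (by decide) rfl (Nat.mod_mod_of_dvd _ (by norm_num)) h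
  have h := extn_spec (M := 12) (p := 5) (n := n) (by norm_num) h
  norm_num only at h
  have h := nt_spec G mk5_ok (by decide) (by decide) rfl (Nat.mod_mod_of_dvd _ (by norm_num)) h
  have h := extn_spec (M := 60) (p := 37) (n := n) (by norm_num) h
  norm_num only at h
  have h := nt_spec G mk37_ok (by decide) (by decide) rfl (Nat.mod_mod_of_dvd _ (by norm_num)) h
  have h := tEn_spec (r := 13) (M := 2220) G (Ad6 (by decide) (by decide) (by decide)) rfl (by decide +kernel) h
  norm_num only at h
  have h := nt_spec G mk13_ok (by decide) (by decide) rfl (Nat.mod_mod_of_dvd _ (by norm_num)) h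
  have h := tEn_spec (r := 19) (M := 28860) G (Ad10 (by decide) (by decide) (by decide)) rfl (by decide +kernel) h
  norm_num only at h
  have h := nt_spec G mk19_ok (by decide) (by decide) rfl (Nat.mod_mod_of_dvd _ (by norm_num)) h
  have h := tE_spec G (Ad11 (by decide) (by decide)) rfl (Nat.mod_mod_of_dvd _ (by decide +kernel)) rfl (Nat.mod_mod_of_dvd _ (by decide +kernel)) h
  have h := tEn_spec (r := 73) (M := 548340) G (Ad12 (by decide) (by decide) (by decide)) rfl (by decide +kernel) h
  norm_num only at h
  have h := nt_spec G mk73_ok (by decide) (by decide) rfl (Nat.mod_mod_of_dvd _ (by norm_num)) h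
  exact absurd h (by simp)

noncomputable def dS13 (y : ℕ) : Bool := 
  extn (nat_lit 4) (nat_lit 3) y fun y => impB (nt (nat_lit 3) mk3 (nat_lit 13) y) <|
  extn (nat_lit 12) (nat_lit 7) y fun y => impB (nt (nat_lit 7) mk7 (nat_lit 13) y) <|
  extn (nat_lit 84) (nat_lit 37) y fun y => impB (nt (nat_lit 37) mk37 (nat_lit 13) y) <|
  tE E5 (nat_lit 13) y <|
  tEn E11 (nat_lit 19) (nat_lit 3108) (nat_lit 13) y fun y => impB (nt (nat_lit 19) mk19 (nat_lit 13) y) <| false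

lemma dS13_true : dS13 (nat_lit 1) = true := by decide +kernel

lemma special13 {n : ℕ} (G : SolP 13 n) : False := by
  have h := dS13_true
  unfold dS13 at h
  have e : n % 4 = 1 := G.hn
  have h := extn_spec (M := 4) (p := 3) (n := n) (by norm_num) (by rw [e]; exact h)
  norm_num only at h
  have h := nt_spec G mk3_ok (by decide) (by decide) rfl (Nat.mod_mod_of_dvd _ (by norm_num)) h
  have h := extn_spec (M := 12) (p := 7) (n := n) (by norm_num) h
  norm_num only at h
  have h := nt_spec G mk7_ok (by decide) (by decide) rfl (Nat.mod_mod_of_dvd _ (by norm_num)) h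
  have h := extn_spec (M := 84) (p := 37) (n := n) (by norm_num) h
  norm_num only at h
  have h := nt_spec G mk37_ok (by decide) (by decide) rfl (Nat.mod_mod_of_dvd _ (by norm_num)) h
  have h := tE_spec G (Ad5 (by decide) (by decide)) rfl (Nat.mod_mod_of_dvd _ (by decide +kernel)) rfl (Nat.mod_mod_of_dvd _ (by decide +kernel)) h
  have h := tEn_spec (r := 19) (M := 3108) G (Ad11 (by decide) (by decide)) rfl (by decide +kernel) h
  norm_num only at h
  have h := nt_spec G mk19_ok (by decide) (by decide) rfl (Nat.mod_mod_of_dvd _ (by norm_num)) h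
  exact absurd h (by simp)

noncomputable def dS37 (y : ℕ) : Bool := 
  extn (nat_lit 4) (nat_lit 3) y fun y => impB (nt (nat_lit 3) mk3 (nat_lit 37) y) <|
  extn (nat_lit 12) (nat_lit 5) y fun y => impB (nt (nat_lit 5) mk5 (nat_lit 37) y) <|
  extn (nat_lit 60) (nat_lit 7) y fun y => impB (nt (nat_lit 7) mk7 (nat_lit 37) y) <|
  tEn E0 (nat_lit 13) (nat_lit 420) (nat_lit 37) y fun y => impB (nt (nat_lit 13) mk13 (nat_lit 37) y) <|
  tE E2 (nat_lit 37) y <|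
  tEn E7 (nat_lit 73) (nat_lit 5460) (nat_lit 37) y fun y => impB (nt (nat_lit 73) mk73 (nat_lit 37) y) <|
  tE E8 (nat_lit 37) y <| false

lemma dS37_true : dS37 (nat_lit 1) = true := by decide +kernel

lemma special37 {n : ℕ} (G : SolP 37 n) : False := by
  have h := dS37_true
  unfold dS37 at h
  have e : n % 4 = 1 := G.hn
  have h := extn_spec (M := 4) (p := 3) (n := n) (by norm_num) (by rw [e]; exact h)
  norm_num only at h
  have h := nt_spec G mk3_ok (by decide) (by decide) rfl (Nat.mod_mod_of_dvd _ (by norm_num)) h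
  have h := extn_spec (M := 12) (p := 5) (n := n) (by norm_num) h
  norm_num only at h
  have h := nt_spec G mk5_ok (by decide) (by decide) rfl (Nat.mod_mod_of_dvd _ (by norm_num)) h
  have h := extn_spec (M := 60) (p := 7) (n := n) (by norm_num) h
  norm_num only at h
  have h := nt_spec G mk7_ok (by decide) (by decide) rfl (Nat.mod_mod_of_dvd _ (by norm_num)) h
  have h := tEn_spec (r := 13) (M := 420) G (Ad0 (by decide) (by decide) (by decide) (by decide)) rfl (by decide +kernel) h
  norm_num only at h
  have h := nt_spec G mk13_ok (by decide) (by decide) rfl (Nat.mod_mod_of_dvd _ (by norm_num)) h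
  have h := tE_spec G (Ad2 (by decide) (by decide) (by decide)) rfl (Nat.mod_mod_of_dvd _ (by decide +kernel)) rfl (Nat.mod_mod_of_dvd _ (by decide +kernel)) h
  have h := tEn_spec (r := 73) (M := 5460) G (Ad7 (by decide) (by decide) (by decide) (by decide)) rfl (by decide +kernel) h
  norm_num only at h
  have h := nt_spec G mk73_ok (by decide) (by decide) rfl (Nat.mod_mod_of_dvd _ (by norm_num)) h
  have h := tE_spec G (Ad8 (by decide) (by decide) (by decide) (by decide)) rfl (Nat.mod_mod_of_dvd _ (by decide +kernel)) rfl (Nat.mod_mod_of_dvd _ (by decide +kernel)) h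
  exact absurd h (by simp)

noncomputable def dS73 (y : ℕ) : Bool := 
  extn (nat_lit 4) (nat_lit 3) y fun y => impB (nt (nat_lit 3) mk3 (nat_lit 73) y) <|
  extn (nat_lit 12) (nat_lit 5) y fun y => impB (nt (nat_lit 5) mk5 (nat_lit 73) y) <|
  extn (nat_lit 60) (nat_lit 7) y fun y => impB (nt (nat_lit 7) mk7 (nat_lit 73) y) <|
  tEn E0 (nat_lit 13) (nat_lit 420) (nat_lit 73) y fun y => impB (nt (nat_lit 13) mk13 (nat_lit 73) y) <|
  tE E2 (nat_lit 73) y <| false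

lemma dS73_true : dS73 (nat_lit 1) = true := by decide +kernel

lemma special73 {n : ℕ} (G : SolP 73 n) : False := by
  have h := dS73_true
  unfold dS73 at h
  have e : n % 4 = 1 := G.hn
  have h := extn_spec (M := 4) (p := 3) (n := n) (by norm_num) (by rw [e]; exact h)
  norm_num only at h
  have h := nt_spec G mk3_ok (by decide) (by decide) rfl (Nat.mod_mod_of_dvd _ (by norm_num)) h
  have h := extn_spec (M := 12) (p := 5) (n := n) (by norm_num) h
  norm_num only at h
  have h := nt_spec G mk5_ok (by decide) (by decide) rfl (Nat.mod_mod_of_dvd _ (by norm_num)) h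
  have h := extn_spec (M := 60) (p := 7) (n := n) (by norm_num) h
  norm_num only at h
  have h := nt_spec G mk7_ok (by decide) (by decide) rfl (Nat.mod_mod_of_dvd _ (by norm_num)) h
  have h := tEn_spec (r := 13) (M := 420) G (Ad0 (by decide) (by decide) (by decide) (by decide)) rfl (by decide +kernel) h
  norm_num only at h
  have h := nt_spec G mk13_ok (by decide) (by decide) rfl (Nat.mod_mod_of_dvd _ (by norm_num)) h
  have h := tE_spec G (Ad2 (by decide) (by decide) (by decide)) rfl (Nat.mod_mod_of_dvd _ (by decide +kernel)) rfl (Nat.mod_mod_of_dvd _ (by decide +kernel)) h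
  exact absurd h (by simp)


/-- the remaining small cases -/
def smallOK (a n : ℕ) : Bool := a % 2 == 0 || n % 2 == 0 || decide (109 < a*n) || decide (DD a n ≤ 1253) ||
  [3,5,7,11,13,17,19,23,29,31,37,41,43,47,53,59,61,67,71,73].any (fun p => p != a && decide (3*p ≤ 2*(a*n)) && (List.range p).any (fun z => z^2 % p == DD a n % p))
lemma small_dec : ∀ a < 110, ∀ n < 110, smallOK a n = true := by decide +kernel

theorem not_pid {a n : ℕ} (ha : Odd a) (hn : Odd n) [IsDomain (RR a n)] [IsPrincipalIdealRing (RR a n)] (hD : 1253 < DD a n) : False := by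
  by_cases hb : 109 < a*n
  · obtain ⟨n', G⟩ := good_of ha hn hb
    by_cases h3 : 3 = a
    · subst h3; exact special3 G
    by_cases h5 : 5 = a
    · subst h5; exact special5 G
    by_cases h7 : 7 = a
    · subst h7; exact special7 G
    by_cases h13 : 13 = a
    · subst h13; exact special13 G
    by_cases h37 : 37 = a
    · subst h37; exact special37 G
    by_cases h73 : 73 = a
    · subst h73; exact special73 G
    exact generic G h3 h5 h7 h13 h37 h73
  · have a0 := ha.pos
    have n0 := hn.pos
    have h := small_dec a (by nlinarith) n (by nlinarith)
    have ha' := Nat.odd_iff.mp ha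
    have hn' := Nat.odd_iff.mp hn
    unfold smallOK at h
    simp only [Bool.or_eq_true, beq_iff_eq, decide_eq_true_eq, List.any_eq_true, Bool.and_eq_true, bne_iff_ne, List.mem_range] at h
    rcases h with (((h | h) | h) | h) | ⟨p, hp, ⟨hpa, hs⟩, z, hz, hzz⟩
    · omega
    · omega
    · omega
    · omega
    · have pp : p.Prime ∧ p ≠ 2 := by
        simp only [List.mem_cons, List.not_mem_nil, or_false] at hp
        rcases hp with rfl | rfl | rfl | rfl | rfl | rfl | rfl | rfl | rfl | rfl | rfl | rfl | rfl | rfl | rfl | rfl | rfl | rfl | rfl | rfl <;> norm_num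
      apply inert_small ha hn p pp.1 pp.2 hpa hs z
      have : DD a n ≡ z^2 [MOD p] := hzz.symm
      have := (Nat.modEq_iff_dvd.mp this)
      push_cast at this
      exact this

/-- For odd positive integers `a` and `m`, let `d = a²m² + 4a`. If `d` is
squarefree and `d > 1253`, then `h(d) > 1`, where `h(d)` is the class number
of the real quadratic field `ℚ(√d)`. -/
theorem stmt_11 (a m d : ℤ) (ha : Odd a) (ha0 : 0 < a)
    (hm : Odd m) (hm0 : 0 < m) (hd : d = a ^ 2 * m ^ 2 + 4 * a)
    (hsf : Squarefree d) (hd1253 : 1253 < d)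
    (K : Type) [Field K] [NumberField K] (hdeg : Module.finrank ℚ K = 2)
    (α : K) (hα : α ^ 2 = (d : K)) :
    1 < NumberField.classNumber K := by
  by_contra hlt
  have hpos : 0 < NumberField.classNumber K := Fintype.card_pos
  have h1 : NumberField.classNumber K = 1 := by omega
  rw [NumberField.classNumber_eq_one_iff] at h1
  obtain ⟨a', rfl⟩ := Int.eq_ofNat_of_zero_le ha0.le
  obtain ⟨n, rfl⟩ := Int.eq_ofNat_of_zero_le hm0.le
  have ha' : Odd a' := by exact_mod_cast ha
  have hn' : Odd n := by exact_mod_cast hm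
  have hdd : d = (DD a' n : ℕ) := by rw [hd]; unfold DD; push_cast; ring
  subst hdd
  have hsf' : Squarefree (DD a' n) := by rwa [Int.squarefree_natCast] at hsf
  have hD : 1253 < DD a' n := by exact_mod_cast hd1253
  obtain ⟨e⟩ := rr_equiv a' n ha' hn' hsf' K hdeg α (by rw [hα]; push_cast; rfl)
  haveI : IsDomain (RR a' n) := e.toMulEquiv.isDomain _
  haveI := h1
  haveI : IsPrincipalIdealRing (RR a' n) := IsPrincipalIdealRing.of_surjective e.symm.toRingHom e.symm.surjective
  exact not_pid ha' hn' hD
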